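/- Let τ > 1 and let α be an irrational number with α ∈ DC(τ), i.e. there exists γ > 0 such that q_{n+1} ≤ γ^{-1} q_n^τ for all n ∈ ℕ. Then for every s > τ + 1 the Lyapunov exponent is discontinuous at some point of the Gevrey class G^s(S¹, SL(2,ℝ)) in the G^s topology: there exist D ∈ G^s(S¹, SL(2,ℝ)) with L(α,D) > 0, a constant K > 0, and a sequence A_j ∈ G^{s,K}(S¹, SL(2,ℝ)) such that ‖A_j − D‖_{s,K} → 0 as j → ∞ but limsup_{j→∞} L(α, A_j) < L(α, D). -/

import Mathlib

open Filter MeasureTheory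

noncomputable section

attribute [local instance] Matrix.normedAddCommGroup Matrix.normedSpace

/-- The Euclidean operator norm of a 2×2 real matrix. -/
def opNorm (M : Matrix (Fin 2) (Fin 2) ℝ) : ℝ :=
  ‖Matrix.toEuclideanCLM (𝕜 := ℝ) M‖

/-- The iterated cocycle `A^n(x) = A(x + (n-1)α) ⋯ A(x + α) A(x)` over the rotation by `α`. -/
def cocIter (α : ℝ) (A : ℝ → Matrix (Fin 2) (Fin 2) ℝ) :
    ℕ → ℝ → Matrix (Fin 2) (Fin 2) ℝ
  | 0, _ => 1
  | n + 1, x => A (x + (n : ℝ) * α) * cocIter α A n x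

/-- The Lyapunov exponent `L(α, A) = lim_n (1/n) ∫_{S¹} log ‖A^n(x)‖ dx` (the limit exists by
subadditivity, so it agrees with the `limsup` used here). -/
def lyap (α : ℝ) (A : ℝ → Matrix (Fin 2) (Fin 2) ℝ) : ℝ :=
  limsup (fun n : ℕ =>
    (n : ℝ)⁻¹ * ∫ x in (0 : ℝ)..1, Real.log (opNorm (cocIter α A n x))) atTop

/-- The `C^l` norm `max_{0 ≤ k ≤ l} sup_x ‖∂^k A(x)‖` of a matrix-valued map on the circle. -/
def cNorm (l : ℕ) (A : ℝ → Matrix (Fin 2) (Fin 2) ℝ) : ℝ :=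
  ⨆ k : Fin (l + 1), ⨆ x : ℝ, ‖iteratedDeriv (k : ℕ) A x‖

/-- Gauss map iterates of `α`: `x₀ = {α}`, `x_{n+1} = {1/x_n}`. -/
def gaussIter (α : ℝ) : ℕ → ℝ
  | 0 => Int.fract α
  | n + 1 => Int.fract (gaussIter α n)⁻¹

/-- `cfa α n` is the partial quotient `a_{n+1} = ⌊1/x_n⌋` of the continued fraction of `α`. -/
def cfa (α : ℝ) (n : ℕ) : ℕ := ⌊(gaussIter α n)⁻¹⌋₊

/-- Denominators `q_n` of the continued fraction convergents of `α`:
`q₀ = 1`, `q₁ = a₁`, `q_{n+2} = a_{n+2} q_{n+1} + q_n`. -/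
def cfq (α : ℝ) : ℕ → ℕ
  | 0 => 1
  | 1 => cfa α 0
  | n + 2 => cfa α (n + 1) * cfq α (n + 1) + cfq α n

/-- `sup_x ‖∂^k A(x)‖`. -/
def supDeriv (k : ℕ) (A : ℝ → Matrix (Fin 2) (Fin 2) ℝ) : ℝ :=
  ⨆ x : ℝ, ‖iteratedDeriv k A x‖

/-- The `k`-th term of the Gevrey norm `‖A‖_{s,K}`. -/
def gevreySeq (s K : ℝ) (A : ℝ → Matrix (Fin 2) (Fin 2) ℝ) (k : ℕ) : ℝ :=
  (1 + (k : ℝ) ^ 2) * supDeriv k A / (K ^ k * (k.factorial : ℝ) ^ s)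

/-- The Gevrey norm `‖A‖_{s,K} = (4π²/3) sup_k (1+k²) sup_x ‖∂^k A(x)‖ / (K^k (k!)^s)`. -/
def gevreyNorm (s K : ℝ) (A : ℝ → Matrix (Fin 2) (Fin 2) ℝ) : ℝ :=
  (4 * Real.pi ^ 2 / 3) * ⨆ k : ℕ, gevreySeq s K A k

/-- Membership in the Gevrey class `G^{s,K}`: `A` is smooth, each `sup_x ‖∂^k A(x)‖` is
finite, and the defining sequence of `‖A‖_{s,K}` is bounded. -/
def MemGevrey (s K : ℝ) (A : ℝ → Matrix (Fin 2) (Fin 2) ℝ) : Prop :=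
  ContDiff ℝ (⊤ : ℕ∞) A ∧
    (∀ k : ℕ, BddAbove (Set.range fun x : ℝ => ‖iteratedDeriv k A x‖)) ∧
    BddAbove (Set.range (gevreySeq s K A))

/-! ### Continued fractions -/

/-- distance to the nearest integer -/
def nd (x : ℝ) : ℝ := |x - round x|

lemma nd_le (x : ℝ) (k : ℤ) : nd x ≤ |x - k| := round_le x k

lemma nd_nonneg (x : ℝ) : 0 ≤ nd x := abs_nonneg _

lemma nd_le_half (x : ℝ) : nd x ≤ 1 / 2 := abs_sub_round x

lemma nd_sub (x y : ℝ) : nd (x - y) ≤ nd x + nd y := by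
  calc nd (x - y) ≤ |(x - y) - ((round x - round y : ℤ) : ℝ)| := nd_le _ _
    _ = |(x - round x) - (y - round y)| := by push_cast; congr 1; ring
    _ ≤ _ := abs_sub _ _

lemma nd_add_int (x : ℝ) (k : ℤ) : nd (x + k) = nd x := by
  unfold nd; rw [round_add_intCast]; push_cast; congr 1; ring

lemma nd_add_one (x : ℝ) : nd (x + 1) = nd x := by
  simpa using nd_add_int x 1

lemma nd_neg (x : ℝ) : nd (-x) = nd x := by
  apply le_antisymm
  · calc nd (-x) ≤ |(-x) - ((-(round x) : ℤ) : ℝ)| := nd_le _ _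
      _ = |-(x - round x)| := by push_cast; congr 1; ring
      _ = _ := abs_neg _
  · calc nd x ≤ |x - ((-(round (-x)) : ℤ) : ℝ)| := nd_le _ _
      _ = |-(-x - round (-x))| := by push_cast; congr 1; ring
      _ = _ := abs_neg _

/-- numerators -/
def cfp (α : ℝ) : ℕ → ℤ
  | 0 => ⌊α⌋
  | 1 => cfa α 0 * ⌊α⌋ + 1
  | n + 2 => cfa α (n + 1) * cfp α (n + 1) + cfp α n

def cfd (α : ℝ) (n : ℕ) : ℝ := (cfq α n : ℝ) * α - cfp α n

lemma fract_irr {x : ℝ} (hx : Irrational x) :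
    0 < Int.fract x ∧ Int.fract x < 1 ∧ Irrational (Int.fract x) := by
  have h : Irrational (Int.fract x) := by
    rw [Int.fract]; exact hx.sub_intCast _
  refine ⟨?_, Int.fract_lt_one x, h⟩
  exact lt_of_le_of_ne (Int.fract_nonneg x) (fun h0 => h.ne_zero h0.symm)

lemma gauss_spec (α : ℝ) (hα : Irrational α) (n : ℕ) :
    0 < gaussIter α n ∧ gaussIter α n < 1 ∧ Irrational (gaussIter α n) := by
  induction n with
  | zero => exact fract_irr hα
  | succ n ih => exact fract_irr ih.2.2.inv

lemma cfa_eq (α : ℝ) (hα : Irrational α) (n : ℕ) :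
    (cfa α n : ℝ) = (gaussIter α n)⁻¹ - gaussIter α (n + 1) := by
  have h := gauss_spec α hα n
  have : (0:ℝ) ≤ (gaussIter α n)⁻¹ := by have := h.1; positivity
  unfold cfa
  rw [natCast_floor_eq_intCast_floor this]
  show _ = _ - Int.fract (gaussIter α n)⁻¹
  rw [Int.fract]; ring

lemma cfa_pos (α : ℝ) (hα : Irrational α) (n : ℕ) : 1 ≤ cfa α n := by
  have h := gauss_spec α hα n
  unfold cfa
  rw [Nat.one_le_floor_iff]
  exact (one_le_inv₀ h.1).2 h.2.1.le

lemma cfd_zero (α : ℝ) : cfd α 0 = gaussIter α 0 := by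
  show ((1:ℕ):ℝ) * α - (⌊α⌋:ℤ) = Int.fract α
  rw [Int.fract]; push_cast; ring

lemma cfd_succ (α : ℝ) (hα : Irrational α) (n : ℕ) :
    cfd α (n + 1) = - cfd α n * gaussIter α (n + 1) := by
  induction n with
  | zero =>
    rw [cfd_zero]
    have h := cfa_eq α hα 0
    have h0 := (gauss_spec α hα 0).1
    have hg : gaussIter α 0 = α - ⌊α⌋ := rfl
    have : cfd α (0 + 1) = cfa α 0 * gaussIter α 0 - 1 := by
      simp only [cfd, cfq, cfp, hg, zero_add]; push_cast; ring
    rw [this, h]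
    field_simp
    ring
  | succ n ih =>
    have h := cfa_eq α hα (n + 1)
    have h0 := (gauss_spec α hα (n + 1)).1
    have : cfd α (n + 1 + 1) = cfa α (n + 1) * cfd α (n + 1) + cfd α n := by
      simp only [cfd, cfq, cfp]; push_cast; ring
    have h2 : cfd α n = - cfd α (n+1) * (gaussIter α (n + 1))⁻¹ := by
      rw [ih]; field_simp
    rw [this, h, h2]
    ring

lemma cfdet (α : ℝ) (n : ℕ) :
    (cfq α (n + 1) : ℤ) * cfp α n - cfp α (n + 1) * cfq α n = (-1) ^ (n + 1) := by
  induction n with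
  | zero => simp [cfq, cfp]
  | succ n ih =>
    have : (cfq α (n + 1 + 1) : ℤ) * cfp α (n + 1) - cfp α (n + 1 + 1) * cfq α (n + 1)
       = - ((cfq α (n + 1) : ℤ) * cfp α n - cfp α (n + 1) * cfq α n) := by
      simp only [cfq, cfp]; push_cast; ring
    rw [this, ih, pow_succ (-1) (n+1)]; ring

lemma cfq_pos (α : ℝ) (hα : Irrational α) : ∀ n, 1 ≤ cfq α n
  | 0 => le_rfl
  | 1 => cfa_pos α hα 0
  | n + 2 => by
    have := cfq_pos α hα n
    simp only [cfq]; omega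

lemma cfq_mono (α : ℝ) (hα : Irrational α) (n : ℕ) : cfq α n ≤ cfq α (n + 1) := by
  cases n with
  | zero => exact cfa_pos α hα 0
  | succ n =>
    have := cfa_pos α hα (n + 1)
    simp only [cfq]; nlinarith [cfq_pos α hα (n+1)]

lemma cfq_lt (α : ℝ) (hα : Irrational α) (n : ℕ) : cfq α (n + 1) < cfq α (n + 2) := by
  have := cfa_pos α hα (n + 1)
  have h := cfq_pos α hα n
  simp only [cfq]; nlinarith [cfq_pos α hα (n+1)]

lemma cfq_ge (α : ℝ) (hα : Irrational α) (n : ℕ) : n ≤ cfq α n := by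
  cases n with
  | zero => simp
  | succ n =>
    induction n with
    | zero => exact cfq_pos α hα 1
    | succ n ih =>
      have : cfq α (n+1) < cfq α (n+1+1) := cfq_lt α hα n
      omega

lemma cfd_ne (α : ℝ) (hα : Irrational α) (n : ℕ) : 0 < |cfd α n| := by
  induction n with
  | zero => rw [cfd_zero]; exact abs_pos.2 (gauss_spec α hα 0).1.ne'
  | succ n ih =>
    rw [cfd_succ α hα, abs_mul, abs_neg]
    exact mul_pos ih (abs_pos.2 (gauss_spec α hα (n+1)).1.ne')

lemma cfd_lower (α : ℝ) (hα : Irrational α) (n : ℕ) :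
    1 / (2 * (cfq α (n + 1) : ℝ)) ≤ |cfd α n| := by
  have hq := cfq_pos α hα (n + 1)
  have hq' : (1:ℝ) ≤ cfq α (n + 1) := by exact_mod_cast hq
  have hm : (cfq α n : ℝ) ≤ cfq α (n + 1) := by exact_mod_cast cfq_mono α hα n
  have h1 : |(cfq α (n+1) : ℝ) * cfd α n - cfq α n * cfd α (n + 1)| = 1 := by
    have h := cfdet α n
    have h' : ((cfq α (n + 1) : ℝ)) * cfp α n - cfp α (n + 1) * cfq α n = (-1) ^ (n + 1) := by
      exact_mod_cast h
    have : (cfq α (n+1) : ℝ) * cfd α n - cfq α n * cfd α (n + 1) = - (-1) ^ (n + 1) := by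
      rw [← h']; unfold cfd; ring
    rw [this, abs_neg, abs_pow]; simp
  have h2 : |cfd α (n + 1)| ≤ |cfd α n| := by
    have g := gauss_spec α hα (n + 1)
    rw [cfd_succ α hα, abs_mul, abs_neg, abs_of_pos g.1]
    have := abs_nonneg (cfd α n)
    nlinarith [g.2.1]
  have h3 : 1 ≤ (cfq α (n+1) : ℝ) * |cfd α n| + cfq α n * |cfd α (n + 1)| := by
    rw [← h1]
    refine (abs_sub _ _).trans ?_
    rw [abs_mul, abs_mul]; simp
  rw [div_le_iff₀ (by positivity)]
  have : (cfq α n : ℝ) * |cfd α (n + 1)| ≤ cfq α (n+1) * |cfd α n| := by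
    gcongr
  nlinarith

lemma best_approx (α : ℝ) (hα : Irrational α) (n : ℕ) (k : ℕ) (hk : 0 < k)
    (hk2 : k < cfq α (n + 1)) : |cfd α n| ≤ nd ((k : ℝ) * α) := by
  unfold nd
  generalize round ((k:ℝ) * α) = p
  set d : ℤ := (-1) ^ (n + 1) with hd
  have hdd : d * d = 1 := by rw [hd, ← mul_pow]; simp
  have hdet := cfdet α n
  rw [← hd] at hdet
  set q := (cfq α n : ℤ) with hq
  set q' := (cfq α (n + 1) : ℤ) with hq'
  set P := cfp α n
  set P' := cfp α (n + 1)
  set a : ℤ := d * (-(k * P') + p * q') with ha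
  set b : ℤ := d * (k * P - p * q) with hb
  have e1 : a * q + b * q' = k := by
    have : a * q + b * q' = d * (k * (q' * P - P' * q)) := by rw [ha, hb]; ring
    rw [this, hdet]; linear_combination (k:ℤ) * hdd
  have e2 : a * P + b * P' = p := by
    have : a * P + b * P' = d * (p * (q' * P - P' * q)) := by rw [ha, hb]; ring
    rw [this, hdet]; linear_combination (p:ℤ) * hdd
  have hqpos : 0 < q := by have := cfq_pos α hα n; omega
  have hkq : (k : ℤ) < q' := by omega
  have hk0 : (0 : ℤ) < k := by omega
  have g := gauss_spec α hα (n + 1)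
  have e3 : (k : ℝ) * α - p = cfd α n * (a - b * gaussIter α (n + 1)) := by
    have e1' : (a : ℝ) * cfq α n + b * cfq α (n + 1) = k := by exact_mod_cast e1
    have e2' : (a : ℝ) * P + b * P' = p := by exact_mod_cast e2
    have : (k : ℝ) * α - p = a * cfd α n + b * cfd α (n + 1) := by
      rw [← e1', ← e2']; unfold cfd; ring
    rw [this, cfd_succ α hα]; ring
  rw [e3, abs_mul]
  have : 1 ≤ |(a : ℝ) - b * gaussIter α (n + 1)| := by
    rcases lt_trichotomy b 0 with hb0 | hb0 | hb0
    · have ha1 : 1 ≤ a := by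
        by_contra hcon
        have : a ≤ 0 := by omega
        nlinarith
      have ha1' : (1 : ℝ) ≤ a := by exact_mod_cast ha1
      have hb1' : (b : ℝ) ≤ 0 := by exact_mod_cast hb0.le
      rw [le_abs]; left; nlinarith [g.1]
    · have ha1 : a ≠ 0 := by
        rintro h0; rw [h0, hb0] at e1; simp at e1; omega
      rw [hb0]; simp only [Int.cast_zero, zero_mul, sub_zero]
      exact_mod_cast Int.one_le_abs ha1
    · have ha1 : a ≤ -1 := by
        by_contra hcon
        have : 0 ≤ a := by omega
        nlinarith
      have ha1' : (a : ℝ) ≤ -1 := by exact_mod_cast ha1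
      have hb1' : (0 : ℝ) ≤ b := by exact_mod_cast hb0.le
      rw [le_abs]; right; nlinarith [g.1]
  nlinarith [abs_nonneg (cfd α n)]

/-- (N2) -/
lemma arith2 (α : ℝ) (hα : Irrational α) (n k : ℕ) (hk : 0 < k) (hk2 : k < cfq α (n + 1)) :
    1 / (2 * (cfq α (n + 1) : ℝ)) ≤ nd ((k : ℝ) * α) :=
  (cfd_lower α hα n).trans (best_approx α hα n k hk hk2)

/-- (N1) -/
lemma arith1 (α : ℝ) (hα : Irrational α) (τ : ℝ) (hτ : 1 < τ) 
    (hDC : ∃ γ : ℝ, 0 < γ ∧ ∀ n : ℕ,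
      (cfq α (n + 1) : ℝ) ≤ γ⁻¹ * (cfq α n : ℝ) ^ τ) :
    ∃ g : ℝ, 0 < g ∧ ∀ k : ℕ, 0 < k → g / (k : ℝ) ^ τ ≤ nd ((k : ℝ) * α) := by
  obtain ⟨γ, hγ, h⟩ := hDC
  refine ⟨γ / 2, by positivity, fun k hk => ?_⟩
  have hex : ∃ n, k < cfq α n := ⟨k + 1, cfq_ge α hα (k + 1)⟩
  classical
  have h1 := Nat.find_spec hex
  have h2 := @Nat.find_min _ _ hex
  obtain ⟨n, hn⟩ : ∃ n, Nat.find hex = n + 1 := by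
    refine Nat.exists_eq_succ_of_ne_zero ?_
    intro h0; rw [h0] at h1; simp [cfq] at h1; omega
  rw [hn] at h1
  have h3 : cfq α n ≤ k := by
    have := @h2 n (by omega); omega
  refine le_trans ?_ (arith2 α hα n k hk h1)
  have hq0 : (1:ℝ) ≤ cfq α n := by exact_mod_cast cfq_pos α hα n
  have hq1 : (1:ℝ) ≤ cfq α (n+1) := by exact_mod_cast cfq_pos α hα (n+1)
  have hk' : (cfq α n : ℝ) ≤ k := by exact_mod_cast h3
  have hkp : (0:ℝ) < k := by exact_mod_cast hk
  have h4 : (cfq α (n + 1) : ℝ) ≤ γ⁻¹ * (k : ℝ) ^ τ := by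
    refine (h n).trans ?_
    gcongr
  have hkt : 0 < (k:ℝ) ^ τ := by positivity
  rw [div_le_div_iff₀ hkt (by positivity)]
  have : γ * (cfq α (n + 1) : ℝ) ≤ (k : ℝ) ^ τ := by
    calc γ * (cfq α (n + 1) : ℝ) ≤ γ * (γ⁻¹ * (k : ℝ) ^ τ) := by gcongr
      _ = _ := by field_simp
  linarith

/-! ### Pointwise Gevrey-type algebra norms -/

/-- weight -/
def cw (σ R : ℝ) (k : ℕ) : ℝ := R ^ k * (k.factorial : ℝ) ^ σ

lemma cw_pos (σ : ℝ) {R : ℝ} (hR : 0 < R) (k : ℕ) : 0 < cw σ R k := by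
  unfold cw; positivity

/-- partial sums -/
def SS (σ R : ℝ) (N : ℕ) (f : ℝ → ℝ) (y : ℝ) : ℝ :=
  ∑ k ∈ Finset.range N, |iteratedDeriv k f y| / cw σ R k

lemma SS_nonneg (σ : ℝ) {R : ℝ} (hR : 0 < R) (N : ℕ) (f : ℝ → ℝ) (y : ℝ) : 0 ≤ SS σ R N f y := by
  unfold SS
  exact Finset.sum_nonneg fun k _ => div_nonneg (abs_nonneg _) (cw_pos σ hR k).le

/-- smooth functions (short name) -/
abbrev Sm (f : ℝ → ℝ) : Prop := ContDiff ℝ (⊤ : ℕ∞) f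

lemma Sm.at {f : ℝ → ℝ} (hf : Sm f) (k : ℕ) (y : ℝ) : ContDiffAt ℝ k f y :=
  (hf.of_le (by exact_mod_cast le_top)).contDiffAt

lemma weight_mul {σ R : ℝ} (hσ : 1 ≤ σ) (hR : 0 < R) (i j : ℕ) :
    ((i + j).choose i : ℝ) / cw σ R (i + j) ≤ 1 / (cw σ R i * cw σ R j) := by
  have hi : (0:ℝ) < i.factorial := by positivity
  have hj : (0:ℝ) < j.factorial := by positivity
  have hk : (0:ℝ) < (i+j).factorial := by positivity
  have hch : ((i + j).choose i : ℝ) * (i.factorial * j.factorial) = (i+j).factorial := by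
    have := Nat.add_choose_mul_factorial_mul_factorial i j
    rw [← Nat.choose_symm_add] at this
    rw [← mul_assoc]; exact_mod_cast this
  have hle : (i.factorial * j.factorial : ℝ) ≤ (i+j).factorial := by
    have := Nat.factorial_mul_factorial_dvd_factorial_add i j
    exact_mod_cast Nat.le_of_dvd (Nat.factorial_pos _) this
  rw [div_le_div_iff₀ (cw_pos σ hR _) (mul_pos (cw_pos σ hR _) (cw_pos σ hR _))]
  unfold cw
  have e : ((i + j).choose i : ℝ) * (R ^ i * (i.factorial:ℝ) ^ σ * (R ^ j * (j.factorial:ℝ) ^ σ))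
      = R ^ (i + j) * (((i + j).choose i : ℝ) * (i.factorial * j.factorial : ℝ) ^ σ) := by
    rw [Real.mul_rpow hi.le hj.le, pow_add]; ring
  rw [e, one_mul]
  gcongr
  have e2 : ∀ x : ℝ, 0 < x → x ^ σ = x * x ^ (σ - 1) := by
    intro x hx
    rw [Real.rpow_sub_one hx.ne']; field_simp
  rw [e2 _ (mul_pos hi hj), e2 _ hk, ← mul_assoc, hch]
  gcongr

lemma SS_mul {σ R : ℝ} (hσ : 1 ≤ σ) (hR : 0 < R) (N : ℕ) {f g : ℝ → ℝ} (hf : Sm f) (hg : Sm g)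
    (y : ℝ) : SS σ R N (fun x => f x * g x) y ≤ SS σ R N f y * SS σ R N g y := by
  unfold SS
  set a : ℕ → ℝ := fun i => |iteratedDeriv i f y| / cw σ R i with ha
  set b : ℕ → ℝ := fun i => |iteratedDeriv i g y| / cw σ R i with hb
  have ha0 : ∀ i, 0 ≤ a i := fun i => div_nonneg (abs_nonneg _) (cw_pos σ hR i).le
  have hb0 : ∀ i, 0 ≤ b i := fun i => div_nonneg (abs_nonneg _) (cw_pos σ hR i).le
  have h1 : ∀ k, |iteratedDeriv k (fun x => f x * g x) y| / cw σ R k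
      ≤ ∑ p ∈ Finset.HasAntidiagonal.antidiagonal k, a p.1 * b p.2 := by
    intro k
    have := iteratedDeriv_mul (hf.at k y) (hg.at k y)
    have e : (fun x => f x * g x) = f * g := rfl
    rw [e, this, Finset.Nat.sum_antidiagonal_eq_sum_range_succ (fun i j => a i * b j)]
    rw [div_le_iff₀ (cw_pos σ hR k), Finset.sum_mul]
    refine (Finset.abs_sum_le_sum_abs _ _).trans (Finset.sum_le_sum fun i hi => ?_)
    have hik : i ≤ k := by simpa [Nat.lt_succ_iff] using hi
    have hw := weight_mul hσ hR i (k - i)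
    rw [Nat.add_sub_cancel' hik] at hw
    have hh : (k.choose i : ℝ) ≤ cw σ R k / (cw σ R i * cw σ R (k - i)) := by
      rw [div_le_iff₀ (cw_pos σ hR k)] at hw
      refine hw.trans (le_of_eq ?_); ring
    rw [abs_mul, abs_mul, Nat.abs_cast, ha, hb]
    calc (k.choose i : ℝ) * |iteratedDeriv i f y| * |iteratedDeriv (k - i) g y|
        ≤ cw σ R k / (cw σ R i * cw σ R (k - i)) * |iteratedDeriv i f y|
          * |iteratedDeriv (k - i) g y| := by gcongr
      _ = _ := by
        have h1 := (cw_pos σ hR i).ne'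
        have h2 := (cw_pos σ hR (k - i)).ne'
        field_simp
  refine (Finset.sum_le_sum fun k _ => h1 k).trans ?_
  rw [Finset.sum_mul_sum, ← Finset.sum_product', Finset.sum_sigma']
  refine (Finset.sum_le_sum_of_subset_of_nonneg (s := Finset.sigma (Finset.range N) fun k => Finset.HasAntidiagonal.antidiagonal k) (subset_refl _) (fun _ _ _ => mul_nonneg (ha0 _) (hb0 _))).trans ?_
  rw [← Finset.sum_image (s := (Finset.range N).sigma fun k => Finset.HasAntidiagonal.antidiagonal k)
    (g := fun x : (Σ _ : ℕ, ℕ × ℕ) => x.2) (f := fun p : ℕ × ℕ => a p.1 * b p.2)]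
  · refine Finset.sum_le_sum_of_subset_of_nonneg ?_ (fun _ _ _ => mul_nonneg (ha0 _) (hb0 _))
    intro p hp
    simp only [Finset.mem_image, Finset.mem_sigma, Finset.mem_range, Finset.HasAntidiagonal.mem_antidiagonal,
      Sigma.exists, Finset.mem_product] at hp ⊢
    obtain ⟨k, q, ⟨hk, hq⟩, rfl⟩ := hp
    omega
  · intro x hx y hy hxy
    simp only [Finset.coe_sigma, Set.mem_sigma_iff, Finset.mem_coe,
      Finset.HasAntidiagonal.mem_antidiagonal] at hx hy
    rcases x with ⟨k, q⟩
    rcases y with ⟨k', q'⟩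
    simp only at hxy hx hy
    subst hxy
    have : k = k' := by rw [← hx.2, ← hy.2]
    subst this; rfl

/-- `f` is smooth and has pointwise norm at most `M` at `y`. -/
def SB (σ R : ℝ) (f : ℝ → ℝ) (y M : ℝ) : Prop := Sm f ∧ ∀ N, SS σ R N f y ≤ M

section
variable {σ R : ℝ} {f g : ℝ → ℝ} {y M M' : ℝ}

lemma SB.nonneg (h : SB σ R f y M) : 0 ≤ M := by simpa [SS] using h.2 0

lemma SB.mono (h : SB σ R f y M) (hM : M ≤ M') : SB σ R f y M' := ⟨h.1, fun N => (h.2 N).trans hM⟩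

lemma SB.mul (hσ : 1 ≤ σ) (hR : 0 < R) (h : SB σ R f y M) (h' : SB σ R g y M') :
    SB σ R (fun x => f x * g x) y (M * M') :=
  ⟨h.1.mul h'.1, fun N => (SS_mul hσ hR N h.1 h'.1 y).trans
    (mul_le_mul (h.2 N) (h'.2 N) (SS_nonneg _ hR _ _ _) h.nonneg)⟩

lemma SS_add (hR : 0 < R) (N : ℕ) (hf : Sm f) (hg : Sm g) :
    SS σ R N (fun x => f x + g x) y ≤ SS σ R N f y + SS σ R N g y := by
  unfold SS
  rw [← Finset.sum_add_distrib]
  refine Finset.sum_le_sum fun k _ => ?_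
  rw [← add_div]
  have : iteratedDeriv k (fun x => f x + g x) y = iteratedDeriv k f y + iteratedDeriv k g y :=
    iteratedDeriv_add (hf.at k y) (hg.at k y)
  rw [this]
  have := cw_pos σ hR k
  gcongr
  exact abs_add_le _ _

lemma SB.add (hR : 0 < R) (h : SB σ R f y M) (h' : SB σ R g y M') :
    SB σ R (fun x => f x + g x) y (M + M') :=
  ⟨h.1.add h'.1, fun N => (SS_add hR N h.1 h'.1).trans (add_le_add (h.2 N) (h'.2 N))⟩

lemma SS_const_mul (hR : 0 < R) (N : ℕ) (c : ℝ) :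
    SS σ R N (fun x => c * f x) y = |c| * SS σ R N f y := by
  unfold SS
  rw [Finset.mul_sum]
  refine Finset.sum_congr rfl fun k _ => ?_
  have : iteratedDeriv k (fun x => c * f x) y = c * iteratedDeriv k f y :=
    iteratedDeriv_const_mul_field (n := k) c f
  rw [this, abs_mul, mul_div_assoc]

lemma SB.const_mul (hR : 0 < R) (h : SB σ R f y M) (c : ℝ) :
    SB σ R (fun x => c * f x) y (|c| * M) :=
  ⟨contDiff_const.mul h.1, fun N => by rw [SS_const_mul hR]; exact mul_le_mul_of_nonneg_left (h.2 N) (abs_nonneg _)⟩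

lemma SB.neg (hR : 0 < R) (h : SB σ R f y M) : SB σ R (fun x => - f x) y M := by
  have := h.const_mul hR (-1)
  simpa using this

lemma SB.sub (hR : 0 < R) (h : SB σ R f y M) (h' : SB σ R g y M') :
    SB σ R (fun x => f x - g x) y (M + M') := by
  have := h.add hR (h'.neg hR)
  simpa [sub_eq_add_neg] using this

lemma SB.const (hR : 0 < R) (c y : ℝ) : SB σ R (fun _ => c) y |c| := by
  refine ⟨contDiff_const, fun N => ?_⟩
  unfold SS
  cases N with
  | zero => simp
  | succ N =>
    rw [Finset.sum_range_succ', Finset.sum_eq_zero]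
    · simp [cw]
    · intro k _
      rw [iteratedDeriv_const]; simp

lemma SB.pow (hσ : 1 ≤ σ) (hR : 0 < R) (h : SB σ R f y M) (n : ℕ) :
    SB σ R (fun x => f x ^ n) y (M ^ n) := by
  induction n with
  | zero => simpa using SB.const (σ := σ) hR 1 y
  | succ n ih => simpa [pow_succ] using ih.mul hσ hR h

lemma SB.sum (hR : 0 < R) {F : ℕ → ℝ → ℝ} {C : ℕ → ℝ} (n : ℕ) (h : ∀ i < n, SB σ R (F i) y (C i)) :
    SB σ R (fun x => ∑ i ∈ Finset.range n, F i x) y (∑ i ∈ Finset.range n, C i) := by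
  induction n with
  | zero => simpa using SB.const (σ := σ) hR 0 y
  | succ n ih =>
    simp only [Finset.sum_range_succ]
    exact (ih fun i hi => h i (by omega)).add hR (h n (by omega))

lemma SB.shift {c : ℝ} (h : SB σ R f (y + c) M) : SB σ R (fun x => f (x + c)) y M := by
  refine ⟨h.1.comp (contDiff_id.add contDiff_const), fun N => ?_⟩
  have := h.2 N
  unfold SS at this ⊢
  refine le_trans (le_of_eq (Finset.sum_congr rfl fun k _ => ?_)) this
  rw [iteratedDeriv_comp_add_const]

lemma SB.congr (h : SB σ R f y M) (hg : Sm g) (hfg : g =ᶠ[nhds y] f) : SB σ R g y M := by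
  refine ⟨hg, fun N => ?_⟩
  have := h.2 N
  unfold SS at this ⊢
  refine le_trans (le_of_eq (Finset.sum_congr rfl fun k _ => ?_)) this
  rw [hfg.iteratedDeriv_eq]

lemma SB.affine (hR : 0 < R) {c : ℝ} (hc : 0 < c) (h : SB σ R f (c * y) M) :
    SB σ (c * R) (fun x => f (c * x)) y M := by
  refine ⟨h.1.comp (contDiff_const.mul contDiff_id), fun N => ?_⟩
  have := h.2 N
  unfold SS at this ⊢
  refine le_trans (le_of_eq (Finset.sum_congr rfl fun k _ => ?_)) this
  have e : iteratedDeriv k (fun x => f (c * x)) y = c ^ k * iteratedDeriv k f (c * y) := by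
    have := iteratedDeriv_comp_const_mul (n := k) (h.1.of_le (by exact_mod_cast le_top)) c
    rw [this]
  rw [e, abs_mul, abs_pow, abs_of_pos hc]
  unfold cw
  rw [mul_pow]
  have : 0 < c ^ k := by positivity
  have h2 : (0:ℝ) < (k.factorial : ℝ) ^ σ := by positivity
  field_simp

lemma SB.reflect (c : ℝ) (h : SB σ R f (c - y) M) :
    SB σ R (fun x => f (c - x)) y M := by
  refine ⟨h.1.comp (contDiff_const.sub contDiff_id), fun N => ?_⟩
  have := h.2 N
  unfold SS at this ⊢
  refine le_trans (le_of_eq (Finset.sum_congr rfl fun k _ => ?_)) this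
  have := iteratedDeriv_comp_const_sub k f c
  rw [this]
  simp [abs_mul]

lemma SB.monoR {R' : ℝ} (hR : 0 < R) (hRR : R ≤ R') (h : SB σ R f y M) : SB σ R' f y M := by
  refine ⟨h.1, fun N => le_trans ?_ (h.2 N)⟩
  unfold SS
  refine Finset.sum_le_sum fun k _ => ?_
  have := cw_pos σ hR k
  have : cw σ R k ≤ cw σ R' k := by unfold cw; gcongr
  gcongr

/-- sharpening by enlarging the radius -/
lemma SB.sharpen {A : ℝ} (hR : 0 < R) (hA : 1 ≤ A) (h : SB σ R f y M) :
    SB σ (R * A) f y (|f y| + M / A) := by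
  refine ⟨h.1, fun N => ?_⟩
  have h2 := h.2
  cases N with
  | zero => simp [SS]; have := h.nonneg; positivity
  | succ N =>
    have h3 := h2 (N + 1)
    unfold SS at h3 ⊢
    rw [Finset.sum_range_succ'] at h3 ⊢
    have e : |iteratedDeriv 0 f y| / cw σ (R * A) 0 = |f y| := by simp [cw]
    have e' : 0 ≤ |iteratedDeriv 0 f y| / cw σ R 0 := div_nonneg (abs_nonneg _) (cw_pos _ hR _).le
    rw [e, add_comm]
    gcongr
    have h4 : ∑ k ∈ Finset.range N, |iteratedDeriv (k + 1) f y| / cw σ R (k + 1) ≤ M := by linarith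
    calc _ ≤ ∑ k ∈ Finset.range N, (|iteratedDeriv (k + 1) f y| / cw σ R (k + 1)) / A := by
          refine Finset.sum_le_sum fun k _ => ?_
          rw [div_div]
          have := cw_pos σ hR (k+1)
          have hA0 : 0 < A := by linarith
          have : cw σ R (k + 1) * A ≤ cw σ (R * A) (k + 1) := by
            unfold cw
            rw [mul_pow, mul_right_comm]
            have : A ≤ A ^ (k + 1) := le_self_pow₀ hA (by omega)
            gcongr
          gcongr
      _ ≤ _ := by rw [← Finset.sum_div]; gcongr

lemma SB.abs_le (h : SB σ R f y M) : |f y| ≤ M := by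
  have := h.2 1
  simpa [SS, cw] using this

lemma SB.deriv_le (hR : 0 < R) (h : SB σ R f y M) (k : ℕ) :
    |iteratedDeriv k f y| ≤ M * cw σ R k := by
  have := h.2 (k + 1)
  rw [← div_le_iff₀ (cw_pos σ hR k)]
  refine le_trans ?_ this
  unfold SS
  exact Finset.single_le_sum (f := fun k => |iteratedDeriv k f y| / cw σ R k)
    (fun k _ => div_nonneg (abs_nonneg _) (cw_pos σ hR k).le) (by simp)

lemma SB.of_deriv_le (hR : 0 < R) (hf : Sm f) (h : ∀ k, |iteratedDeriv k f y| ≤ M * cw σ R k) :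
    SB σ (R * 2) f y (2 * M) := by
  refine ⟨hf, fun N => ?_⟩
  have hM : 0 ≤ M := by
    have := (abs_nonneg _).trans (h 0)
    simpa [cw] using this
  unfold SS
  calc _ ≤ ∑ k ∈ Finset.range N, M * (1 / 2 : ℝ) ^ k := by
        refine Finset.sum_le_sum fun k _ => ?_
        rw [div_le_iff₀ (cw_pos σ (by positivity) k)]
        refine (h k).trans (le_of_eq ?_)
        unfold cw
        rw [mul_pow, div_pow, one_pow]
        field_simp
    _ = M * ∑ k ∈ Finset.range N, (1 / 2 : ℝ) ^ k := by rw [Finset.mul_sum]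
    _ ≤ M * 2 := by
        gcongr
        exact sum_geometric_two_le N
    _ = _ := by ring

/-- Reciprocal. -/
lemma SB.recip (hσ : 1 ≤ σ) (hR : 0 < R) {m : ℝ} (hm : m < 1) (hf0 : ∀ x, f x ≠ 1)
    (h : SB σ R f y m) : SB σ R (fun x => 1 / (1 - f x)) y (1 / (1 - m)) := by
  have hs : Sm (fun x => 1 / (1 - f x)) :=
    contDiff_const.div (contDiff_const.sub h.1) (fun x => sub_ne_zero.2 (hf0 x).symm)
  refine ⟨hs, fun N => ?_⟩
  have e : (fun x => 1 / (1 - f x)) = fun x => 1 + f x * (1 / (1 - f x)) := by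
    funext x
    have := sub_ne_zero.2 (hf0 x).symm
    field_simp; ring
  set φ := fun x => 1 / (1 - f x) with hφ
  have h1 : SS σ R N φ y ≤ 1 + m * SS σ R N φ y := by
    conv_lhs => rw [e]
    refine (SS_add hR N contDiff_const (h.1.mul hs)).trans ?_
    have h0 := (SB.const (σ := σ) hR 1 y).2 N
    have h2 := SS_mul hσ hR N h.1 hs y
    rw [abs_one] at h0
    have h3 := mul_le_mul_of_nonneg_right (h.2 N) (SS_nonneg σ hR N φ y)
    linarith
  rw [le_div_iff₀ (by linarith)]
  nlinarith

/-- Change of Gevrey exponent. -/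
lemma SB.convert {θ ρ : ℝ} (hR : 0 < R) (hρ : 0 < ρ) (hθ : 0 < θ) (h : SB σ R f y M) :
    SB (σ + θ) ρ f y (Real.exp (θ * (R / ρ) ^ (1 / θ)) * M) := by
  refine ⟨h.1, fun N => ?_⟩
  refine le_trans ?_ (mul_le_mul_of_nonneg_left (h.2 N) (Real.exp_pos _).le)
  unfold SS
  rw [Finset.mul_sum]
  refine Finset.sum_le_sum fun k _ => ?_
  have hk : (0:ℝ) < k.factorial := by positivity
  set a := (R / ρ) ^ (1 / θ) with ha
  have ha0 : 0 < a := by positivity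
  have h1 : a ^ k / k.factorial ≤ Real.exp a := Real.pow_div_factorial_le_exp _ ha0.le k
  have h2 : (R / ρ) ^ k / (k.factorial : ℝ) ^ θ ≤ Real.exp (θ * a) := by
    have : (a ^ k / k.factorial) ^ θ ≤ (Real.exp a) ^ θ := by gcongr
    rw [← Real.exp_mul, mul_comm a, Real.div_rpow (by positivity) hk.le] at this
    convert this using 2
    rw [ha, ← Real.rpow_natCast, ← Real.rpow_natCast, ← Real.rpow_mul (by positivity),
      ← Real.rpow_mul (by positivity)]
    congr 1; field_simp
  have h3 : cw σ R k ≤ Real.exp (θ * a) * cw (σ + θ) ρ k := by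
    have : (0:ℝ) < (k.factorial : ℝ) ^ θ := by positivity
    rw [div_le_iff₀ this, div_pow, div_le_iff₀ (by positivity)] at h2
    unfold cw
    rw [Real.rpow_add hk]
    calc _ ≤ (Real.exp (θ * a) * (k.factorial : ℝ) ^ θ * ρ ^ k) * (k.factorial : ℝ) ^ σ := by gcongr
      _ = _ := by ring
  have hc := cw_pos σ hR k
  have hc' := cw_pos (σ + θ) hρ k
  rw [← mul_div_assoc, div_le_div_iff₀ hc' hc]
  calc _ ≤ |iteratedDeriv k f y| * (Real.exp (θ * a) * cw (σ + θ) ρ k) := by gcongr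
    _ = _ := by ring

end

/-! ### The Gevrey bump -/

def gb (N : ℕ) (x : ℝ) : ℝ := expNegInvGlue (x ^ N)

lemma gb_smooth (N : ℕ) : Sm (gb N) := expNegInvGlue.contDiff.comp (contDiff_id.pow N)

lemma gb_pos_eq (N : ℕ) {x : ℝ} (hx : 0 < x) : gb N x = Real.exp (-(x ^ N)⁻¹) := by
  unfold gb expNegInvGlue
  rw [if_neg (by have : 0 < x ^ N := by positivity
                 linarith)]

lemma gb_neg_eq {N : ℕ} (hN : Odd N) {x : ℝ} (hx : x ≤ 0) : gb N x = 0 := by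
  unfold gb
  exact expNegInvGlue.zero_of_nonpos (hN.pow_nonpos_iff.2 hx)

def gc (N : ℕ) (z : ℂ) : ℂ := Complex.exp (-(z ^ N)⁻¹)

lemma gc_diff (N : ℕ) : DifferentiableOn ℂ (gc N) {0}ᶜ := by
  intro z hz
  have : z ^ N ≠ 0 := pow_ne_zero _ hz
  apply DifferentiableAt.differentiableWithinAt
  unfold gc
  fun_prop (disch := assumption)

lemma gc_iter_diff (N k : ℕ) (z : ℂ) (hz : z ≠ 0) :
    DifferentiableAt ℂ (iteratedDeriv k (gc N)) z := by
  have h1 : AnalyticAt ℂ (gc N) z :=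
    (gc_diff N).analyticAt (isOpen_compl_singleton.mem_nhds hz)
  exact (h1.iterated_deriv k).differentiableAt.congr_of_eventuallyEq (by
    rw [iteratedDeriv_eq_iterate])

lemma gb_iter_eq (N k : ℕ) : ∀ x : ℝ, 0 < x →
    iteratedDeriv k (gb N) x = (iteratedDeriv k (gc N) x).re := by
  induction k with
  | zero =>
    intro x hx
    simp only [iteratedDeriv_zero]
    rw [gb_pos_eq N hx, gc]
    have : -((x:ℂ) ^ N)⁻¹ = ((-(x ^ N)⁻¹ : ℝ) : ℂ) := by push_cast; rfl
    rw [this, ← Complex.ofReal_exp, Complex.ofReal_re]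
  | succ k ih =>
    intro x hx
    rw [iteratedDeriv_succ, iteratedDeriv_succ]
    have hd := (gc_iter_diff N k x (by exact_mod_cast hx.ne')).hasDerivAt
    have := hd.real_of_complex
    rw [← this.deriv]
    apply Filter.EventuallyEq.deriv_eq
    filter_upwards [lt_mem_nhds hx] with t ht
    exact ih t ht

lemma exists_cone (N : ℕ) : ∃ ϑ : ℝ, 0 < ϑ ∧ ϑ ≤ 1 / 2 ∧ ∀ ζ : ℂ, ‖ζ‖ ≤ ϑ →
    1 / 2 ≤ (((1 + ζ) ^ N)⁻¹).re := by
  have hc : ContinuousAt (fun ζ : ℂ => (((1 + ζ) ^ N)⁻¹).re) 0 := by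
    apply Complex.continuous_re.continuousAt.comp
    apply ContinuousAt.inv₀
    · fun_prop
    · simp
  have h0 : (1/2 : ℝ) < (fun ζ : ℂ => (((1 + ζ) ^ N)⁻¹).re) 0 := by simp; norm_num
  have := hc.eventually (lt_mem_nhds h0)
  obtain ⟨ε, hε, h⟩ := Metric.eventually_nhds_iff.1 this
  refine ⟨min (ε / 2) (1 / 2), by positivity, min_le_right _ _, fun ζ hζ => ?_⟩
  have : ‖ζ‖ < ε := by
    have := min_le_left (ε / 2) (1 / 2); linarith
  exact (h (by simpa using this)).le

lemma gb_bound_pos {N : ℕ} (hN : 1 ≤ N) {ϑ : ℝ} (h0 : 0 < ϑ) (h1 : ϑ ≤ 1 / 2)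
    (h : ∀ ζ : ℂ, ‖ζ‖ ≤ ϑ → 1 / 2 ≤ (((1 + ζ) ^ N)⁻¹).re) (k : ℕ) {x : ℝ} (hx : 0 < x) :
    |iteratedDeriv k (gb N) x| ≤ cw (1 + 1 / N) (2 / ϑ) k := by
  rw [gb_iter_eq N k x hx]
  refine (Complex.abs_re_le_norm _).trans ?_
  have hN' : (1:ℝ) ≤ N := by exact_mod_cast hN
  have hxc : (x:ℂ) ≠ 0 := by exact_mod_cast hx.ne'
  have hr : 0 < ϑ * x := by positivity
  have hz0 : ∀ z : ℂ, z ∈ Metric.closedBall (x:ℂ) (ϑ * x) → z ≠ 0 := by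
    rintro z hz rfl
    simp [abs_of_pos hx] at hz
    nlinarith
  have hdc : DiffContOnCl ℂ (gc N) (Metric.ball (x:ℂ) (ϑ * x)) := by
    apply DifferentiableOn.diffContOnCl
    rw [closure_ball _ hr.ne']
    exact (gc_diff N).mono fun z hz => hz0 z hz
  have hs : ∀ z ∈ Metric.sphere (x:ℂ) (ϑ * x), ‖gc N z‖ ≤ Real.exp (-((x ^ N)⁻¹ / 2)) := by
    intro z hz
    unfold gc
    rw [Complex.norm_exp]
    apply Real.exp_le_exp.2
    set ζ := (z - x) / x with hζ
    have hn : ‖ζ‖ ≤ ϑ := by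
      have : ‖z - x‖ = ϑ * x := by simpa [dist_eq_norm] using hz
      rw [hζ, norm_div, this]
      simp [abs_of_pos hx, hx.ne']
    have hzz : z = x * (1 + ζ) := by rw [hζ]; field_simp; ring
    rw [hzz, mul_pow, mul_inv]
    have : (((x:ℂ) ^ N)⁻¹) = (((x ^ N)⁻¹ : ℝ) : ℂ) := by push_cast; rfl
    rw [this, Complex.neg_re, Complex.re_ofReal_mul]
    have := h ζ hn
    have hp : 0 < (x ^ N)⁻¹ := by positivity
    nlinarith
  have hC := Complex.norm_iteratedDeriv_le_of_forall_mem_sphere_norm_le k hr hdc hs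
  refine hC.trans ?_
  set u := (x ^ N)⁻¹ with hu
  have hu0 : 0 < u := by positivity
  have hkf : (0:ℝ) < k.factorial := by positivity
  -- u^k exp(-N u/2)
  have h2 : (N * u / 2) ^ k / k.factorial ≤ Real.exp (N * u / 2) :=
    Real.pow_div_factorial_le_exp _ (by positivity) k
  have h3 : u ^ k * Real.exp (-(N * u / 2)) ≤ 2 ^ k * k.factorial := by
    rw [Real.exp_neg, ← div_eq_mul_inv, div_le_iff₀ (Real.exp_pos _)]
    rw [div_le_iff₀ hkf] at h2
    calc u ^ k ≤ (N * u) ^ k := by gcongr; nlinarith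
      _ = 2 ^ k * (N * u / 2) ^ k := by rw [← mul_pow]; congr 1; ring
      _ ≤ 2 ^ k * (Real.exp (N * u / 2) * k.factorial) := by gcongr
      _ = _ := by ring
  have h4 : (x⁻¹) ^ k * Real.exp (-(u / 2)) ≤ 2 ^ k * (k.factorial : ℝ) ^ (1 / (N:ℝ)) := by
    have h5 : (u ^ k * Real.exp (-(N * u / 2))) ^ (1 / (N:ℝ)) ≤ (2 ^ k * k.factorial) ^ (1 / (N:ℝ)) := by
      gcongr
    rw [Real.mul_rpow (by positivity) (Real.exp_pos _).le, ← Real.exp_mul,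
      Real.mul_rpow (by positivity) hkf.le] at h5
    have e1 : (u ^ k) ^ (1 / (N:ℝ)) = x⁻¹ ^ k := by
      rw [hu, ← inv_pow, ← pow_mul, mul_comm, pow_mul, ← Real.rpow_natCast (x⁻¹ ^ k) N,
        ← Real.rpow_mul (by positivity)]
      rw [mul_one_div_cancel (by positivity), Real.rpow_one]
    have e2 : -(N * u / 2) * (1 / (N:ℝ)) = -(u / 2) := by field_simp
    rw [e1, e2] at h5
    refine h5.trans ?_
    gcongr
    rw [← Real.rpow_natCast, ← Real.rpow_mul (by norm_num)]
    apply Real.rpow_le_rpow_of_exponent_le (by norm_num)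
    have : 1 / (N:ℝ) ≤ 1 := by rw [div_le_one (by positivity)]; exact hN'
    have hk0 : (0:ℝ) ≤ k := by positivity
    nlinarith
  unfold cw
  rw [Real.rpow_add hkf, Real.rpow_one]
  calc (k.factorial : ℝ) * Real.exp (-(u / 2)) / (ϑ * x) ^ k
      = k.factorial * (1 / ϑ) ^ k * ((x⁻¹) ^ k * Real.exp (-(u / 2))) := by
        rw [mul_pow, inv_pow, div_pow, one_pow]; field_simp
    _ ≤ k.factorial * (1 / ϑ) ^ k * (2 ^ k * (k.factorial : ℝ) ^ (1 / (N:ℝ))) := by gcongr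
    _ = _ := by
        have : (2 / ϑ) ^ k = 2 ^ k * (1/ϑ) ^ k := by rw [← mul_pow]; congr 1; ring
        rw [this]; ring

lemma gb_bound {N : ℕ} (hN : Odd N) : ∃ R : ℝ, 0 < R ∧ ∀ y, SB (1 + 1 / N) R (gb N) y 2 := by
  obtain ⟨ϑ, h0, h1, h⟩ := exists_cone N
  have hN1 : 1 ≤ N := hN.pos
  refine ⟨2 / ϑ * 2, by positivity, fun y => ?_⟩
  have key : ∀ k x, |iteratedDeriv k (gb N) x| ≤ cw (1 + 1 / N) (2 / ϑ) k := by
    intro k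
    have hcl : IsClosed {x | |iteratedDeriv k (gb N) x| ≤ cw (1 + 1 / N) (2 / ϑ) k} := by
      apply isClosed_le _ continuous_const
      apply Continuous.abs
      exact (gb_smooth N).continuous_iteratedDeriv k (by exact_mod_cast le_top)
    have hd : Dense {x : ℝ | x ≠ 0} := dense_compl_singleton 0
    have hsub : {x : ℝ | x ≠ 0} ⊆ {x | |iteratedDeriv k (gb N) x| ≤ cw (1 + 1 / N) (2 / ϑ) k} := by
      intro x hx
      rcases lt_or_gt_of_ne hx with hlt | hgt
      · have e : gb N =ᶠ[nhds x] fun _ => 0 := by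
          filter_upwards [gt_mem_nhds hlt] with t ht
          exact gb_neg_eq hN ht.le
        show |iteratedDeriv k (gb N) x| ≤ _
        rw [e.iteratedDeriv_eq, iteratedDeriv_const]
        have := cw_pos (1 + 1 / (N:ℝ)) (R := 2 / ϑ) (by positivity) k
        split_ifs <;> simpa only [abs_zero] using this.le
      · exact gb_bound_pos hN1 h0 h1 h k hgt
    intro x
    have := hcl.closure_subset_iff.2 hsub
    exact this (hd x)
  simpa using SB.of_deriv_le (M := 1) (by positivity) (gb_smooth N) (fun k => by simpa using key k y)

/-- 0-1 transition -/
def tr (N : ℕ) (x : ℝ) : ℝ := gb N x / (gb N x + gb N (1 - x))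

lemma gb_nonneg (N : ℕ) (x : ℝ) : 0 ≤ gb N x := expNegInvGlue.nonneg _

lemma gb_le_one (N : ℕ) (x : ℝ) : gb N x ≤ 1 := by
  unfold gb expNegInvGlue
  split_ifs with h
  · norm_num
  · rw [Real.exp_le_one_iff]
    have : 0 < (x ^ N)⁻¹ := by simp only [not_le] at h; positivity
    linarith

lemma den_lower {N : ℕ} (hN : Odd N) : ∃ δ : ℝ, 0 < δ ∧ δ ≤ 1 ∧ ∀ x, δ ≤ gb N x + gb N (1 - x) := by
  refine ⟨Real.exp (-2 ^ N), Real.exp_pos _, by rw [Real.exp_le_one_iff]; have : (0:ℝ) < 2 ^ N := by positivity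
                                                linarith, fun x => ?_⟩
  have key : ∀ t : ℝ, 1 / 2 ≤ t → Real.exp (-2 ^ N) ≤ gb N t := by
    intro t ht
    have ht0 : 0 < t := by linarith
    rw [gb_pos_eq N ht0, Real.exp_le_exp, neg_le_neg_iff, ← inv_pow]
    gcongr
    rw [inv_le_comm₀ ht0 (by norm_num)]
    linarith
  rcases le_total (1/2) x with h | h
  · have := key x h; have := gb_nonneg N (1 - x); linarith
  · have := key (1 - x) (by linarith); have := gb_nonneg N x; linarith

lemma tr_bound {N : ℕ} (hN : Odd N) : ∃ R M : ℝ, 0 < R ∧ ∀ y, SB (1 + 1 / N) R (tr N) y M := by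
  obtain ⟨R, hR, h⟩ := gb_bound hN
  obtain ⟨δ, hδ, hδ1, hd⟩ := den_lower hN
  have hσ : (1:ℝ) ≤ 1 + 1 / N := by have : (0:ℝ) ≤ 1 / N := by positivity
                                    linarith
  -- v = 1 - den/2
  set v : ℝ → ℝ := fun x => 1 - (1/2) * (gb N x + gb N (1 - x)) with hv
  have hvb : ∀ y, SB (1 + 1 / N) R v y 3 := by
    intro y
    have h1 := ((h y).add hR (SB.reflect 1 (h (1 - y)))).const_mul hR (1/2)
    have h2 := (SB.const (σ := 1 + 1 / (N:ℝ)) hR 1 y).sub hR h1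
    refine h2.mono ?_
    norm_num [abs_of_pos]
  have hA : (1:ℝ) ≤ 3 / (δ / 4) := by rw [le_div_iff₀ (by positivity)]; linarith
  refine ⟨R * (3 / (δ / 4)), 2 * ((1/2) * (1 / (1 - (1 - δ / 4)))), by positivity, fun y => ?_⟩
  have hR' : 0 < R * (3 / (δ / 4)) := by positivity
  have h1 := (hvb y).sharpen hR hA
  have hvy : ∀ x, 0 ≤ v x ∧ v x ≤ 1 - δ / 2 := by
    intro x
    have a1 := gb_le_one N x
    have a2 := gb_le_one N (1 - x)
    have := hd x
    simp only [hv]; constructor <;> linarith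
  have h2 : SB (1 + 1 / N) (R * (3 / (δ / 4))) v y (1 - δ / 4) := by
    refine h1.mono ?_
    rw [abs_of_nonneg (hvy y).1]
    have e : 3 / (3 / (δ / 4)) = δ / 4 := by field_simp
    rw [e]; linarith [(hvy y).2]
  have h3 := h2.recip hσ hR' (by linarith) (fun x => by have := (hvy x).2; intro hh; linarith)
  have h4 := h3.const_mul hR' (1/2)
  have h5 := ((h y).monoR hR (le_mul_of_one_le_right hR.le hA)).mul hσ hR' h4
  have e : (fun x => gb N x * (1 / 2 * (1 / (1 - v x)))) = tr N := by
    funext x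
    have : gb N x + gb N (1 - x) ≠ 0 := by have := hd x; intro hh; linarith
    have e2 : 1 - v x = (1/2) * (gb N x + gb N (1 - x)) := by simp only [hv]; ring
    rw [e2, tr]
    field_simp
  rw [e] at h5
  refine h5.mono (le_of_eq ?_)
  rw [abs_of_pos (by norm_num : (0:ℝ) < 1/2)]

lemma tr_zero {N : ℕ} (hN : Odd N) {x : ℝ} (hx : x ≤ 0) : tr N x = 0 := by
  unfold tr; rw [gb_neg_eq hN hx]; simp

lemma tr_one {N : ℕ} (hN : Odd N) {x : ℝ} (hx : 1 ≤ x) : tr N x = 1 := by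
  unfold tr; rw [gb_neg_eq hN (x := 1 - x) (by linarith), add_zero, div_self]
  rw [gb_pos_eq N (by linarith)]; exact (Real.exp_pos _).ne'

lemma tr_mem {N : ℕ} (hN : Odd N) (x : ℝ) : 0 ≤ tr N x ∧ tr N x ≤ 1 := by
  obtain ⟨δ, hδ, hδ1, hd⟩ := den_lower hN
  have h1 := gb_nonneg N x
  have h2 := gb_nonneg N (1 - x)
  have := hd x
  unfold tr
  exact ⟨by positivity, by rw [div_le_one (by linarith)]; linarith⟩

/-- The bump: `χ = 1` on `|x| ≤ 1/2`, `0` on `|x| ≥ 1`. -/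
theorem exists_bump {N : ℕ} (hN : Odd N) : ∃ (χ : ℝ → ℝ) (R : ℝ), 0 < R ∧
    (∀ x, 0 ≤ χ x ∧ χ x ≤ 1) ∧ (∀ x, |x| ≤ 1 / 2 → χ x = 1) ∧ (∀ x, 1 ≤ |x| → χ x = 0) ∧
    (∀ y, SB (1 + 1 / N) R χ y 2) ∧
    (∀ y, SB (1 + 1 / N) R (fun x => 1 + χ x) y 3) ∧
    (∀ y, SB (1 + 1 / N) R (fun x => 1 / (1 + χ x)) y (5 / 4)) := by
  obtain ⟨R, M, hR, h⟩ := tr_bound hN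
  have hσ : (1:ℝ) ≤ 1 + 1 / N := by have : (0:ℝ) ≤ 1 / N := by positivity
                                    linarith
  set χ : ℝ → ℝ := fun x => tr N (2 - 2 * x) * tr N (2 * x + 2) with hχ
  have hM := (h 0).nonneg
  have h2 : ∀ y, SB (1 + 1 / N) (2 * R) χ y (M * M) := by
    intro y
    refine SB.mul hσ (by positivity) ?_ ?_
    · exact SB.affine (f := fun x => tr N (2 - x)) hR (by norm_num : (0:ℝ) < 2) (SB.reflect 2 (h _))
    · exact SB.affine (f := fun x => tr N (x + 2)) hR (by norm_num : (0:ℝ) < 2) (SB.shift (h _))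
  have hmem : ∀ x, 0 ≤ χ x ∧ χ x ≤ 1 := by
    intro x
    have a := tr_mem hN (2 - 2 * x)
    have b := tr_mem hN (2 * x + 2)
    exact ⟨mul_nonneg a.1 b.1, mul_le_one₀ a.2 b.1 b.2⟩
  set A : ℝ := 1 + 5 * (M * M + 1/2) with hA
  have hA1 : 1 ≤ A := by rw [hA]; nlinarith
  have hR2 : 0 < 2 * R := by positivity
  have hR3 : 0 < 2 * R * A := by positivity
  -- centered
  have h3 : ∀ y, SB (1 + 1 / N) (2 * R * A) (fun x => χ x - 1 / 2) y (1 / 2 + 1 / 5) := by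
    intro y
    have a := ((h2 y).sub hR2 (SB.const (σ := 1 + 1 / (N:ℝ)) hR2 (1/2) y)).sharpen hR2 hA1
    refine a.mono ?_
    apply add_le_add
    · rw [abs_le]; constructor <;> linarith [(hmem y).1, (hmem y).2]
    · rw [div_le_iff₀ (by linarith), abs_of_pos (by norm_num)]
      rw [hA]; linarith
  refine ⟨χ, 2 * R * A, hR3, hmem, ?_, ?_, ?_, ?_, ?_⟩
  · intro x hx
    rw [abs_le] at hx
    simp only [hχ]
    rw [tr_one hN (by linarith), tr_one hN (by linarith), one_mul]
  · intro x hx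
    simp only [hχ]
    rw [le_abs] at hx
    rcases hx with hx | hx
    · rw [tr_zero hN (by linarith), zero_mul]
    · rw [tr_zero hN (x := 2 * x + 2) (by linarith), mul_zero]
  · intro y
    have := (SB.const (σ := 1 + 1 / (N:ℝ)) hR3 (1/2) y).add hR3 (h3 y)
    simp only [add_sub_cancel] at this
    refine this.mono ?_
    rw [abs_of_pos] <;> norm_num
  · intro y
    have := (SB.const (σ := 1 + 1 / (N:ℝ)) hR3 (3/2) y).add hR3 (h3 y)
    have e : (fun x => (3/2 : ℝ) + (χ x - 1 / 2)) = fun x => 1 + χ x := by funext x; ring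
    rw [e] at this
    refine this.mono ?_
    rw [abs_of_pos] <;> norm_num
  · intro y
    have a := (h3 y).const_mul hR3 (-(2/3))
    have b := a.recip hσ hR3 (by rw [abs_neg, abs_of_pos] <;> norm_num) (fun x => by
      have := (hmem x).1
      intro hh; linarith)
    have c := b.const_mul hR3 (2/3)
    have e : (fun x => (2/3 : ℝ) * (1 / (1 - -(2/3) * (χ x - 1 / 2)))) = fun x => 1 / (1 + χ x) := by
      funext x
      have := (hmem x).1
      have e1 : (1 - -(2/3) * (χ x - 1 / 2)) = 2/3 * (1 + χ x) := by ring
      have e2 : 1 + χ x ≠ 0 := by linarith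
      rw [e1]; field_simp
    rw [e] at c
    refine c.mono ?_
    rw [abs_neg, abs_of_pos] <;> norm_num

/-! ### Periodization and the set-up -/

/-- periodization of a function that is constant off `[-1,1]` -/
def perb (F : ℝ → ℝ) (l : ℝ) (x : ℝ) : ℝ := F ((x - round x) / l)

lemma perb_periodic (F : ℝ → ℝ) (l x : ℝ) : perb F l (x + 1) = perb F l x := by
  unfold perb; rw [round_add_one]; push_cast; congr 2; ring

section
variable {F : ℝ → ℝ} {l c : ℝ}

lemma perb_local (hl : 0 < l) (hl4 : l ≤ 1 / 4) (hF : ∀ x, 1 ≤ |x| → F x = c) (y : ℝ) :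
    perb F l =ᶠ[nhds y] fun x => F (1 / l * (x + (-(round y : ℝ)))) := by
  filter_upwards [Metric.ball_mem_nhds y (by norm_num : (0:ℝ) < 1 / 4)] with x hx
  rw [Metric.mem_ball, Real.dist_eq] at hx
  have e : 1 / l * (x + (-(round y : ℝ))) = (x - round y) / l := by ring
  rw [e]
  by_cases h : round x = round y
  · unfold perb; rw [h]
  · have hy := abs_sub_round y
    have hx2 := abs_sub_round x
    have h1 : (1:ℝ) ≤ |(round x : ℝ) - round y| := by
      exact_mod_cast Int.one_le_abs (sub_ne_zero.2 h)
    have h2 : 1 / 4 ≤ |x - round x| := by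
      have a : |(round x : ℝ) - round y| ≤ |x - round x| + |x - y| + |y - round y| := by
        have : (round x : ℝ) - round y = -(x - round x) + (x - y) + (y - round y) := by ring
        rw [this]
        refine (abs_add_three _ _ _).trans ?_
        rw [abs_neg]
      linarith
    have h3 : 1 / 2 ≤ |x - round y| := by
      have a : |(round x : ℝ) - round y| ≤ |x - round x| + |x - round y| := by
        have : (round x : ℝ) - round y = -(x - round x) + (x - round y) := by ring
        rw [this]
        refine (abs_add_le _ _).trans ?_
        rw [abs_neg]
      linarith
    unfold perb
    rw [hF, hF]
    · rw [abs_div, abs_of_pos hl, le_div_iff₀ hl]; linarith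
    · rw [abs_div, abs_of_pos hl, le_div_iff₀ hl]; linarith

lemma perb_smooth (hl : 0 < l) (hl4 : l ≤ 1 / 4) (hF : ∀ x, 1 ≤ |x| → F x = c) (hs : Sm F) :
    Sm (perb F l) := by
  rw [Sm, contDiff_iff_contDiffAt]
  intro y
  refine ContDiffAt.congr_of_eventuallyEq ?_ (perb_local hl hl4 hF y)
  exact (hs.comp (contDiff_const.mul (contDiff_id.add contDiff_const))).contDiffAt

lemma perb_sb {σ R M : ℝ} (hR : 0 < R) (hl : 0 < l) (hl4 : l ≤ 1 / 4)
    (hF : ∀ x, 1 ≤ |x| → F x = c)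
    (h : ∀ y, SB σ R F y M) (y : ℝ) : SB σ (R / l) (perb F l) y M := by
  have h1 : SB σ (1 / l * R) (fun x => F (1 / l * x)) (y + (-(round y : ℝ))) M :=
    SB.affine hR (by positivity) (h _)
  have h2 := h1.shift
  have e : 1 / l * R = R / l := by ring
  rw [e] at h2
  exact h2.congr (perb_smooth hl hl4 hF (h 0).1) (perb_local hl hl4 hF y)

lemma perb_out (hl : 0 < l) (hF : ∀ x, 1 ≤ |x| → F x = c) {y : ℝ} (hy : l ≤ nd y) :
    perb F l y = c := by
  unfold perb
  rw [hF]
  rw [abs_div, abs_of_pos hl, le_div_iff₀ hl]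
  unfold nd at hy; linarith

lemma perb_in (hl : 0 < l) (hF : ∀ x, |x| ≤ 1 / 2 → F x = c) {y : ℝ} (hy : nd y ≤ l / 2) :
    perb F l y = c := by
  unfold perb
  rw [hF]
  rw [abs_div, abs_of_pos hl, div_le_iff₀ hl]
  unfold nd at hy; linarith

lemma nd_continuous : Continuous nd := by
  have : ∀ x y, |nd x - nd y| ≤ |x - y| := by
    intro x y
    have key : ∀ x y : ℝ, nd x ≤ nd y + |x - y| := by
      intro x y
      calc nd x ≤ |x - round y| := nd_le _ _
        _ = |(y - round y) + (x - y)| := by congr 1; ring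
        _ ≤ _ := abs_add_le _ _
    rw [abs_le]
    have h1 := key x y
    have h2 := key y x
    rw [abs_sub_comm] at h2
    constructor <;> linarith
  exact LipschitzWith.continuous (K := 1) (LipschitzWith.of_dist_le_mul fun x y => by
    simpa [Real.dist_eq] using this x y)

lemma perb_sb_out {σ R : ℝ} (hR : 0 < R) (hl : 0 < l) (hl4 : l ≤ 1 / 4)
    (hF : ∀ x, 1 ≤ |x| → F x = c) (hs : Sm F)
    {y : ℝ} (hy : l < nd y) : SB σ (R / l) (perb F l) y |c| := by
  refine (SB.const (by positivity) c y).congr (perb_smooth hl hl4 hF hs) ?_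
  filter_upwards [nd_continuous.continuousAt.eventually (lt_mem_nhds hy)] with x hx
  exact perb_out hl hF hx.le

end

def lam : ℝ := 2 ^ 2000

lemma lam_pos : 0 < lam := by unfold lam; positivity
lemma one_le_lam : 1 ≤ lam := by unfold lam; exact one_le_pow₀ (by norm_num)
lemma lam_ne : lam ≠ 0 := lam_pos.ne'

structure Setup where
  α : ℝ
  σ : ℝ
  θ : ℝ
  R0 : ℝ
  χ : ℝ → ℝ
  l : ℕ → ℝ
  P : ℕ
  r : ℕ → ℕ
  hσ : 1 ≤ σ
  hθ : 0 < θ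
  hR0 : 0 < R0
  hχ01 : ∀ x, 0 ≤ χ x ∧ χ x ≤ 1
  hχ1 : ∀ x, |x| ≤ 1 / 2 → χ x = 1
  hχ0 : ∀ x, 1 ≤ |x| → χ x = 0
  hχs : ∀ y, SB σ R0 χ y 2
  hψs : ∀ y, SB σ R0 (fun x => 1 + χ x) y 3
  hφs : ∀ y, SB σ R0 (fun x => 1 / (1 + χ x)) y (5 / 4)
  hl0 : ∀ n, 0 < l n
  hl1 : ∀ n, l n ≤ 1 / 8
  hl2 : ∀ n, l (n + 1) ≤ l n / 2
  hP : 1 ≤ P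
  hr : ∀ n, 2 * (P * 2 ^ n) < r n
  hret : ∀ n d : ℕ, 1 ≤ d → d < r n → 2 * l n < nd (d * α)
  hsum : ∀ n, ∑ j ∈ Finset.range n, ((P * 2 ^ j : ℕ) : ℝ) / r (j + 1) ≤ 1
  hconv : ∀ n, Real.exp (θ * (2 * (128 * (R0 / l n))) ^ (1 / θ)) ≤ Real.exp ((P * 2 ^ n : ℕ) / 32)
  hXl : Tendsto (fun n => ((P * 2 ^ n : ℕ) : ℝ) * l n) atTop (nhds 0)

namespace Setup
variable (Z : Setup)

def X (n : ℕ) : ℕ := Z.P * 2 ^ n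

lemma X_succ (n : ℕ) : Z.X (n + 1) = 2 * Z.X n := by unfold X; ring

lemma X_pos (n : ℕ) : 1 ≤ Z.X n := by
  unfold X; exact Nat.mul_pos Z.hP (by positivity)

lemma X_sum (n : ℕ) : ∑ j ∈ Finset.range n, Z.X j + Z.P = Z.X n := by
  induction n with
  | zero => simp [X]
  | succ n ih => rw [Finset.sum_range_succ, X_succ]; omega

lemma X_ge (n : ℕ) : n ≤ Z.X n := by
  unfold X
  have := Nat.lt_two_pow_self (n := n)
  have := Z.hP
  nlinarith

def Rn (n : ℕ) : ℝ := Z.R0 / Z.l n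

lemma Rn_pos (n : ℕ) : 0 < Z.Rn n := div_pos Z.hR0 (Z.hl0 n)

lemma l_anti (n : ℕ) : Z.l (n + 1) ≤ Z.l n := by
  have := Z.hl2 n; have := Z.hl0 n; linarith

lemma Rn_mono (n : ℕ) : Z.Rn n ≤ Z.Rn (n + 1) := by
  unfold Rn
  have := Z.hR0.le; have := Z.hl0 (n+1); have := Z.l_anti n
  gcongr

lemma l_quarter (n : ℕ) : Z.l n ≤ 1 / 4 := by have := Z.hl1 n; linarith

/-- periodized factors -/
def ψ (n : ℕ) : ℝ → ℝ := perb (fun x => 1 + Z.χ x) (Z.l n)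
def φ (n : ℕ) : ℝ → ℝ := perb (fun x => 1 / (1 + Z.χ x)) (Z.l n)

lemma hψo : ∀ x, 1 ≤ |x| → (fun x => 1 + Z.χ x) x = 1 := fun x hx => by simp [Z.hχ0 x hx]
lemma hφo : ∀ x, 1 ≤ |x| → (fun x => 1 / (1 + Z.χ x)) x = 1 := fun x hx => by simp [Z.hχ0 x hx]

lemma ψφ (n : ℕ) (x : ℝ) : Z.ψ n x * Z.φ n x = 1 := by
  unfold ψ φ perb
  have := (Z.hχ01 ((x - round x) / Z.l n)).1
  have : 1 + Z.χ ((x - round x) / Z.l n) ≠ 0 := by linarith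
  field_simp

lemma ψ_mem (n : ℕ) (x : ℝ) : 1 ≤ Z.ψ n x ∧ Z.ψ n x ≤ 2 := by
  unfold ψ perb
  have := (Z.hχ01 ((x - round x) / Z.l n))
  constructor <;> linarith

lemma ψ_core (n : ℕ) {x : ℝ} (hx : nd x ≤ Z.l n / 2) : Z.ψ n x = 2 :=
  perb_in (Z.hl0 n) (fun x hx => by rw [Z.hχ1 x hx]; norm_num) hx

lemma φ_core (n : ℕ) {x : ℝ} (hx : nd x ≤ Z.l n / 2) : Z.φ n x = 1 / 2 :=
  perb_in (Z.hl0 n) (fun x hx => by rw [Z.hχ1 x hx]; norm_num) hx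

lemma ψ_out (n : ℕ) {x : ℝ} (hx : Z.l n < nd x) : Z.ψ n x = 1 :=
  perb_out (Z.hl0 n) Z.hψo hx.le

lemma φ_out (n : ℕ) {x : ℝ} (hx : Z.l n < nd x) : Z.φ n x = 1 :=
  perb_out (Z.hl0 n) Z.hφo hx.le

lemma ψ_sb (n : ℕ) (y : ℝ) : SB Z.σ (Z.Rn n) (Z.ψ n) y 3 :=
  perb_sb Z.hR0 (Z.hl0 n) (Z.l_quarter n) Z.hψo Z.hψs y

lemma φ_sb (n : ℕ) (y : ℝ) : SB Z.σ (Z.Rn n) (Z.φ n) y (5 / 4) :=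
  perb_sb Z.hR0 (Z.hl0 n) (Z.l_quarter n) Z.hφo Z.hφs y

lemma ψ_sb_out (n : ℕ) {y : ℝ} (hy : Z.l n < nd y) : SB Z.σ (Z.Rn n) (Z.ψ n) y 1 := by
  rw [← abs_one]
  exact perb_sb_out (σ := Z.σ) Z.hR0 (Z.hl0 n) (Z.l_quarter n) Z.hψo (Z.hψs 0).1 hy

lemma φ_sb_out (n : ℕ) {y : ℝ} (hy : Z.l n < nd y) : SB Z.σ (Z.Rn n) (Z.φ n) y 1 := by
  rw [← abs_one]
  exact perb_sb_out (σ := Z.σ) Z.hR0 (Z.hl0 n) (Z.l_quarter n) Z.hφo (Z.hφs 0).1 hy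

def w : ℕ → ℝ → ℝ
  | 0, _ => 1
  | n + 1, x => w n x * Z.φ (n + 1) x ^ Z.X n

def wi : ℕ → ℝ → ℝ
  | 0, _ => 1
  | n + 1, x => wi n x * Z.ψ (n + 1) x ^ Z.X n

open Classical in
def V : ℕ → ℝ → ℕ
  | 0, _ => 0
  | n + 1, x => V n x + if nd x ≤ Z.l (n + 1) then Z.X n else 0

lemma w_wi (n : ℕ) (x : ℝ) : Z.w n x * Z.wi n x = 1 := by
  induction n with
  | zero => simp [w, wi]
  | succ n ih =>
    calc _ = (Z.w n x * Z.wi n x) * (Z.ψ (n+1) x * Z.φ (n + 1) x) ^ Z.X n := by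
          simp only [w, wi]; rw [mul_pow]; ring
      _ = 1 := by rw [ih, ψφ]; simp

lemma wi_bd (n : ℕ) (x : ℝ) : 1 ≤ Z.wi n x ∧ Z.wi n x ≤ 2 ^ Z.V n x := by
  induction n with
  | zero => simp [V, wi]
  | succ n ih =>
    have h := Z.ψ_mem (n+1) x
    simp only [wi, V]
    constructor
    · exact one_le_mul_of_one_le_of_one_le ih.1 (one_le_pow₀ h.1)
    · rw [pow_add]
      have h0 : (0:ℝ) ≤ Z.ψ (n+1) x := by linarith
      refine mul_le_mul ih.2 ?_ (by positivity) (by positivity)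
      split_ifs with hx
      · gcongr; exact h.2
      · rw [Z.ψ_out _ (not_le.1 hx)]; simp

lemma wi_pos (n : ℕ) (x : ℝ) : 0 < Z.wi n x := by have := (Z.wi_bd n x).1; linarith

lemma w_eq (n : ℕ) (x : ℝ) : Z.w n x = (Z.wi n x)⁻¹ :=
  eq_inv_of_mul_eq_one_left (Z.w_wi n x)

lemma w_pos (n : ℕ) (x : ℝ) : 0 < Z.w n x := by rw [w_eq]; exact inv_pos.2 (Z.wi_pos n x)

lemma w_le_one (n : ℕ) (x : ℝ) : Z.w n x ≤ 1 := by
  rw [w_eq]; exact inv_le_one_of_one_le₀ (Z.wi_bd n x).1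

lemma w_sb (n : ℕ) (y : ℝ) : SB Z.σ (Z.Rn n) (Z.w n) y (3 ^ Z.V n y) := by
  induction n with
  | zero => simpa [V, w] using SB.const (σ := Z.σ) (Z.Rn_pos 0) 1 y
  | succ n ih =>
    have h1 := ih.monoR (Z.Rn_pos n) (Z.Rn_mono n)
    simp only [V, w]
    rw [pow_add]
    refine h1.mul Z.hσ (Z.Rn_pos _) ?_
    split_ifs with hx
    · exact ((Z.φ_sb (n+1) y).mono (by norm_num)).pow Z.hσ (Z.Rn_pos _) _
    · have := (Z.φ_sb_out (n+1) (not_le.1 hx)).pow Z.hσ (Z.Rn_pos _) (Z.X n)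
      simpa using this

lemma wi_sb (n : ℕ) (y : ℝ) : SB Z.σ (Z.Rn n) (Z.wi n) y (3 ^ Z.V n y) := by
  induction n with
  | zero => simpa [V, wi] using SB.const (σ := Z.σ) (Z.Rn_pos 0) 1 y
  | succ n ih =>
    have h1 := ih.monoR (Z.Rn_pos n) (Z.Rn_mono n)
    simp only [V, wi]
    rw [pow_add]
    refine h1.mul Z.hσ (Z.Rn_pos _) ?_
    split_ifs with hx
    · exact (Z.ψ_sb (n+1) y).pow Z.hσ (Z.Rn_pos _) _
    · have := (Z.ψ_sb_out (n+1) (not_le.1 hx)).pow Z.hσ (Z.Rn_pos _) (Z.X n)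
      simpa using this

lemma V_le (n : ℕ) (y : ℝ) : Z.V n y ≤ Z.X n := by
  have : Z.V n y ≤ ∑ j ∈ Finset.range n, Z.X j := by
    induction n with
    | zero => simp [V]
    | succ n ih =>
      rw [Finset.sum_range_succ]; simp only [V]
      split_ifs <;> omega
  have := Z.X_sum n
  omega

lemma card_sep (S : Finset ℕ) (k r : ℕ) (hr : 0 < r) (hS : ∀ i ∈ S, i < k)
    (hsep : ∀ i ∈ S, ∀ j ∈ S, i < j → r ≤ j - i) : S.card ≤ k / r + 1 := by
  have : S.card ≤ (Finset.range (k / r + 1)).card := by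
    apply Finset.card_le_card_of_injOn (fun i => i / r)
    · intro i hi
      simp only [Finset.coe_range, Set.mem_Iio]
      have := Nat.div_le_div_right (c := r) (hS i hi).le
      omega
    · intro i hi j hj hij
      simp only at hij
      by_contra hne
      have key : ∀ a ∈ S, ∀ b ∈ S, a < b → a / r = b / r → False := by
        intro a ha b hb hab he
        have h1 := hsep a ha b hb hab
        have h2 : a + r ≤ b := by omega
        have h3 := Nat.div_le_div_right (c := r) h2
        rw [Nat.add_div_right _ hr] at h3
        omega
      rcases lt_or_gt_of_ne hne with h | h
      · exact key i hi j hj h hij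
      · exact key j hj i hi h hij.symm
  simpa using this

/-- no two points of `I_n` at small time difference -/
lemma no_return (n : ℕ) {x y : ℝ} (d : ℕ) (hd : 1 ≤ d) (hdr : d < Z.r n) (hxy : y = x + d * Z.α)
    (hx : nd x ≤ Z.l n) (hy : nd y ≤ Z.l n) : False := by
  have h := Z.hret n d hd hdr
  have : (d:ℝ) * Z.α = y - x := by rw [hxy]; ring
  rw [this] at h
  have := nd_sub y x
  linarith

open Classical in
lemma visits (n k : ℕ) (y : ℝ) :
    ((Finset.range k).filter (fun i : ℕ => nd (y + i * Z.α) ≤ Z.l n)).card ≤ k / Z.r n + 1 := by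
  have hr0 : 0 < Z.r n := by have := Z.hr n; omega
  apply card_sep _ _ _ hr0
  · intro i hi; simp at hi; exact hi.1
  · intro i hi j hj hij
    simp only [Finset.mem_filter, Finset.mem_range] at hi hj
    by_contra hlt
    refine Z.no_return n (j - i) (by omega) (by omega) ?_ hi.2 hj.2
    rw [Nat.cast_sub hij.le]; ring

lemma star_aux (n k : ℕ) (y : ℝ) :
    (∑ i ∈ Finset.range k, (Z.V n (y + i * Z.α) : ℝ)) ≤
      k * (∑ j ∈ Finset.range n, (Z.X j : ℝ) / Z.r (j + 1)) + ∑ j ∈ Finset.range n, (Z.X j : ℝ) := by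
  classical
  induction n with
  | zero => simp [V]
  | succ n ih =>
    have e : (∑ i ∈ Finset.range k, (Z.V (n + 1) (y + i * Z.α) : ℝ)) =
        (∑ i ∈ Finset.range k, (Z.V n (y + i * Z.α) : ℝ)) +
        ((Finset.range k).filter (fun i : ℕ => nd (y + i * Z.α) ≤ Z.l (n+1))).card * (Z.X n : ℝ) := by
      simp only [V]
      push_cast
      rw [Finset.sum_add_distrib]
      congr 1
      rw [← nsmul_eq_mul, ← Finset.sum_const, Finset.sum_filter]
    rw [e, Finset.sum_range_succ, Finset.sum_range_succ]
    have hv : (((Finset.range k).filter (fun i : ℕ => nd (y + i * Z.α) ≤ Z.l (n+1))).card : ℝ)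
        ≤ k / Z.r (n + 1) + 1 := by
      have := Z.visits (n + 1) k y
      calc _ ≤ ((k / Z.r (n+1) + 1 : ℕ) : ℝ) := by exact_mod_cast this
        _ ≤ _ := by push_cast; gcongr; exact Nat.cast_div_le
    have hX : (0:ℝ) ≤ Z.X n := by positivity
    have := mul_le_mul_of_nonneg_right hv hX
    calc _ ≤ _ := add_le_add ih this
      _ = _ := by ring

lemma star (n k : ℕ) (y : ℝ) :
    (∑ i ∈ Finset.range k, Z.V n (y + i * Z.α)) ≤ k + Z.X n := by
  have h := Z.star_aux n k y
  have h1 : (k:ℝ) * (∑ j ∈ Finset.range n, (Z.X j : ℝ) / Z.r (j + 1)) ≤ k * 1 := by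
    gcongr; exact Z.hsum n
  have h2 : (∑ j ∈ Finset.range n, (Z.X j : ℝ)) ≤ Z.X n := by
    have := Z.X_sum n
    have : ∑ j ∈ Finset.range n, Z.X j ≤ Z.X n := by omega
    exact_mod_cast this
  have : (∑ i ∈ Finset.range k, (Z.V n (y + i * Z.α) : ℝ)) ≤ k + Z.X n := by linarith
  exact_mod_cast this

/-- value on the core -/
lemma w_core (n : ℕ) {x : ℝ} (hx : nd x ≤ Z.l n / 2) : Z.wi n x * 2 ^ Z.P = 2 ^ Z.X n := by
  have : ∀ m ≤ n, Z.wi m x * 2 ^ Z.P = 2 ^ Z.X m := by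
    intro m hm
    induction m with
    | zero => simp [wi, X]
    | succ m ih =>
      have h := ih (by omega)
      have hx' : nd x ≤ Z.l (m + 1) / 2 := by
        have hanti : Antitone Z.l := antitone_nat_of_succ_le Z.l_anti
        have := hanti hm
        linarith
      simp only [wi]
      rw [Z.ψ_core _ hx', X_succ, two_mul, pow_add, ← h]; ring
  exact this n le_rfl

/-- `w_n - w_{n+1}` -/
lemma y_eq (n : ℕ) (x : ℝ) :
    Z.w n x - Z.w (n + 1) x = (2 ^ Z.P / 2 ^ Z.X n) * (1 - Z.φ (n + 1) x ^ Z.X n) := by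
  by_cases hx : nd x ≤ Z.l (n + 1)
  · have h := Z.w_core n (x := x) (by have := Z.hl2 n; linarith)
    have hw : Z.w n x = 2 ^ Z.P / 2 ^ Z.X n := by
      rw [← h, w_eq]; have := (Z.wi_pos n x).ne'; field_simp
    simp only [w]; rw [hw]; ring
  · simp only [w]; rw [Z.φ_out _ (not_le.1 hx)]; simp

lemma periodic_w (n : ℕ) (x : ℝ) : Z.w n (x + 1) = Z.w n x := by
  induction n with
  | zero => rfl
  | succ n ih => simp only [w]; rw [ih]; unfold φ; rw [perb_periodic]

lemma periodic_wi (n : ℕ) (x : ℝ) : Z.wi n (x + 1) = Z.wi n x := by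
  induction n with
  | zero => rfl
  | succ n ih => simp only [wi]; rw [ih]; unfold ψ; rw [perb_periodic]

end Setup

/-! ### The conjugacies and the approximating cocycles -/

abbrev Mat2 := Matrix (Fin 2) (Fin 2) ℝ

namespace Setup
variable (Z : Setup)

def ρ (n : ℕ) (x : ℝ) : ℝ := Z.wi (n + 1) x - Z.wi n x

lemma ρ_out (n : ℕ) {x : ℝ} (hx : Z.l (n + 1) < nd x) : Z.ρ n x = 0 := by
  unfold ρ; simp only [wi]; rw [Z.ψ_out _ hx]; simp

def tk (n : ℕ) : ℕ → ℝ → ℝ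
  | 0, x => lam⁻¹ ^ 2 * Z.ρ n (x - Z.α)
  | k + 1, x => lam⁻¹ ^ 2 * (Z.wi n (x - Z.α) ^ 2 * tk n k (x - Z.α))

def sk (n : ℕ) : ℕ → ℝ → ℝ
  | 0, x => Z.ρ n x
  | k + 1, x => lam⁻¹ ^ 2 * (Z.wi n x ^ 2 * sk n k (x + Z.α))

lemma tk_supp (n k : ℕ) (x : ℝ) (h : Z.tk n k x ≠ 0) : nd (x - ((k + 1 : ℕ) : ℝ) * Z.α) ≤ Z.l (n + 1) := by
  induction k generalizing x with
  | zero =>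
    by_contra hc
    apply h
    simp only [tk]
    rw [Z.ρ_out n (by simpa using hc)]; simp
  | succ k ih =>
    simp only [tk] at h
    have := ih (x - Z.α) (by intro h0; apply h; rw [h0]; simp)
    convert this using 2; push_cast; ring

lemma sk_supp (n k : ℕ) (x : ℝ) (h : Z.sk n k x ≠ 0) : nd (x + (k : ℝ) * Z.α) ≤ Z.l (n + 1) := by
  induction k generalizing x with
  | zero =>
    by_contra hc
    apply h
    simp only [sk]
    rw [Z.ρ_out n (by simpa using hc)]
  | succ k ih =>
    simp only [sk] at h
    have := ih (x + Z.α) (by intro h0; apply h; rw [h0]; simp)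
    convert this using 2; push_cast; ring

def t (n : ℕ) (x : ℝ) : ℝ := ∑ k ∈ Finset.range (Z.X (n + 1)), Z.tk n k x
def t' (n : ℕ) (x : ℝ) : ℝ := ∑ k ∈ Finset.range (Z.X (n + 1)), Z.sk n k x

lemma t_ne (n : ℕ) {x : ℝ} (h : Z.t n x ≠ 0) :
    ∃ k < Z.X (n + 1), nd (x - ((k + 1 : ℕ) : ℝ) * Z.α) ≤ Z.l (n + 1) := by
  obtain ⟨k, hk, hk2⟩ := Finset.exists_ne_zero_of_sum_ne_zero h
  exact ⟨k, Finset.mem_range.1 hk, Z.tk_supp n k x hk2⟩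

lemma t'_ne (n : ℕ) {x : ℝ} (h : Z.t' n x ≠ 0) :
    ∃ k < Z.X (n + 1), nd (x + (k : ℝ) * Z.α) ≤ Z.l (n + 1) := by
  obtain ⟨k, hk, hk2⟩ := Finset.exists_ne_zero_of_sum_ne_zero h
  exact ⟨k, Finset.mem_range.1 hk, Z.sk_supp n k x hk2⟩

lemma hr' (n : ℕ) : 2 * Z.X n < Z.r n := Z.hr n

lemma tt' (n : ℕ) (x : ℝ) : Z.t n x * Z.t' n x = 0 := by
  by_contra hc
  obtain ⟨k, hk, h1⟩ := Z.t_ne n (left_ne_zero_of_mul hc)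
  obtain ⟨k', hk', h2⟩ := Z.t'_ne n (right_ne_zero_of_mul hc)
  refine Z.no_return (n + 1) (k + 1 + k') (by omega) (by have := Z.hr' (n+1); omega) ?_ h1 h2
  push_cast; ring

/-- recursion identity -/
lemma t'_rec (n : ℕ) (x : ℝ) :
    lam⁻¹ ^ 2 * Z.wi n x ^ 2 * Z.t' n (x + Z.α) = Z.t' n x - Z.ρ n x + Z.sk n (Z.X (n + 1)) x := by
  unfold t'
  have h := Finset.sum_range_succ (fun k => Z.sk n k x) (Z.X (n + 1))
  rw [Finset.sum_range_succ'] at h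
  simp only [sk] at h
  rw [Finset.mul_sum]
  have e : ∑ i ∈ Finset.range (Z.X (n + 1)), lam⁻¹ ^ 2 * Z.wi n x ^ 2 * Z.sk n i (x + Z.α)
      = ∑ i ∈ Finset.range (Z.X (n + 1)), lam⁻¹ ^ 2 * (Z.wi n x ^ 2 * Z.sk n i (x + Z.α)) :=
    Finset.sum_congr rfl fun _ _ => by ring
  rw [e]; linarith

lemma t_rec (n : ℕ) (x : ℝ) :
    Z.t n (x + Z.α) = lam⁻¹ ^ 2 * Z.ρ n x + lam⁻¹ ^ 2 * Z.wi n x ^ 2 * Z.t n x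
      - Z.tk n (Z.X (n + 1)) (x + Z.α) := by
  unfold t
  have h := Finset.sum_range_succ (fun k => Z.tk n k (x + Z.α)) (Z.X (n + 1))
  rw [Finset.sum_range_succ'] at h
  simp only [tk, add_sub_cancel_right] at h
  rw [Finset.mul_sum]
  have e : ∑ i ∈ Finset.range (Z.X (n + 1)), lam⁻¹ ^ 2 * Z.wi n x ^ 2 * Z.tk n i x
      = ∑ i ∈ Finset.range (Z.X (n + 1)), lam⁻¹ ^ 2 * (Z.wi n x ^ 2 * Z.tk n i x) :=
    Finset.sum_congr rfl fun _ _ => by ring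
  rw [e]; linarith


lemma t_in {Z : Setup} {n : ℕ} {x : ℝ} (hx : nd x ≤ Z.l (n + 1)) : Z.t n x = 0 := by
  by_contra hc
  obtain ⟨k, hk, h1⟩ := Z.t_ne n hc
  refine Z.no_return (n + 1) (k + 1) (by omega) (by have := Z.hr' (n+1); omega) ?_ h1 hx
  ring

lemma t'_plus_in {Z : Setup} {n : ℕ} {x : ℝ} (hx : nd x ≤ Z.l (n + 1)) : Z.t' n (x + Z.α) = 0 := by
  by_contra hc
  obtain ⟨k, hk, h1⟩ := Z.t'_ne n hc
  refine Z.no_return (n + 1) (k + 1) (by omega) (by have := Z.hr' (n+1); omega) ?_ hx h1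
  push_cast; ring

lemma sk_in {Z : Setup} {n : ℕ} {x : ℝ} (hx : nd x ≤ Z.l (n + 1)) : Z.sk n (Z.X (n + 1)) x = 0 := by
  by_contra hc
  have h1 := Z.sk_supp n _ _ hc
  have := Z.X_pos (n+1)
  refine Z.no_return (n + 1) (Z.X (n+1)) (by omega) (by have := Z.hr' (n+1); omega) ?_ hx h1
  ring

lemma tk_in {Z : Setup} {n : ℕ} {x : ℝ} (hx : nd x ≤ Z.l (n + 1)) : Z.tk n (Z.X (n + 1)) (x + Z.α) = 0 := by
  by_contra hc
  have h1 := Z.tk_supp n _ _ hc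
  have := Z.X_pos (n+1)
  refine Z.no_return (n + 1) (Z.X (n+1)) (by omega) (by have := Z.hr' (n+1); omega) ?_ h1 hx
  push_cast; ring

lemma t'_in {Z : Setup} {n : ℕ} {x : ℝ} (hx : nd x ≤ Z.l (n + 1)) : Z.t' n x = Z.ρ n x := by
  have := Z.t'_rec n x
  rw [t'_plus_in hx, sk_in hx] at this
  linarith

lemma t_plus_in {Z : Setup} {n : ℕ} {x : ℝ} (hx : nd x ≤ Z.l (n + 1)) : Z.t n (x + Z.α) = lam⁻¹ ^ 2 * Z.ρ n x := by
  have := Z.t_rec n x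
  rw [t_in hx, tk_in hx] at this
  linarith


lemma tt1_out {Z : Setup} {n : ℕ} {x : ℝ} (hx : Z.l (n + 1) < nd x) : Z.t n (x + Z.α) * Z.t' n x = 0 := by
  by_contra hc
  obtain ⟨k, hk, h1⟩ := Z.t_ne n (left_ne_zero_of_mul hc)
  obtain ⟨k', hk', h2⟩ := Z.t'_ne n (right_ne_zero_of_mul hc)
  rcases Nat.eq_zero_or_pos (k + k') with h | h
  · have hk0 : k' = 0 := by omega
    rw [hk0] at h2; simp at h2; linarith
  · refine Z.no_return (n + 1) (k + k') h (by have := Z.hr' (n+1); omega) ?_ h1 h2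
    push_cast; ring

lemma tt2_out {Z : Setup} {n : ℕ} {x : ℝ} : Z.t' n (x + Z.α) * Z.t n x = 0 := by
  by_contra hc
  obtain ⟨k, hk, h1⟩ := Z.t_ne n (right_ne_zero_of_mul hc)
  obtain ⟨k', hk', h2⟩ := Z.t'_ne n (left_ne_zero_of_mul hc)
  refine Z.no_return (n + 1) (k + k' + 2) (by omega) ?_ ?_ h1 h2
  · have := Z.hr' (n+1); omega
  · push_cast; ring

def H (n : ℕ) (x : ℝ) : Mat2 := !![1, Z.t' n x; Z.t n x, 1]
def Hi (n : ℕ) (x : ℝ) : Mat2 := !![1, -Z.t' n x; -Z.t n x, 1]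

lemma H_Hi (n : ℕ) (x : ℝ) : Z.H n x * Z.Hi n x = 1 := by
  have := Z.tt' n x
  unfold H Hi
  ext i j; fin_cases i <;> fin_cases j <;> simp [Matrix.mul_apply, Fin.sum_univ_two] <;>
    rcases mul_eq_zero.1 this with h | h <;> simp [h]

def B : ℕ → ℝ → Mat2
  | 0, _ => !![1, 1; 0, 1]
  | n + 1, x => B n x * Z.H n x

def BI : ℕ → ℝ → Mat2
  | 0, _ => !![1, -1; 0, 1]
  | n + 1, x => Z.Hi n x * BI n x

lemma B_BI (n : ℕ) (x : ℝ) : Z.B n x * Z.BI n x = 1 := by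
  induction n with
  | zero =>
    simp only [B, BI]
    ext i j; fin_cases i <;> fin_cases j <;> simp [Matrix.mul_apply, Fin.sum_univ_two]
  | succ n ih =>
    simp only [B, BI]
    calc _ = Z.B n x * (Z.H n x * Z.Hi n x) * Z.BI n x := by simp only [mul_assoc]
      _ = 1 := by rw [H_Hi, mul_one, ih]

lemma BI_B (n : ℕ) (x : ℝ) : Z.BI n x * Z.B n x = 1 := mul_eq_one_comm.1 (Z.B_BI n x)

lemma H_det (n : ℕ) (x : ℝ) : (Z.H n x).det = 1 := by
  unfold H; rw [Matrix.det_fin_two_of]; have := Z.tt' n x; linarith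

lemma B_det (n : ℕ) (x : ℝ) : (Z.B n x).det = 1 := by
  induction n with
  | zero => simp [B, Matrix.det_fin_two_of]
  | succ n ih => simp only [B]; rw [Matrix.det_mul, ih, H_det, one_mul]

lemma BI_det (n : ℕ) (x : ℝ) : (Z.BI n x).det = 1 := by
  have := congrArg Matrix.det (Z.B_BI n x)
  rwa [Matrix.det_mul, B_det, one_mul, Matrix.det_one] at this

def Lm (n : ℕ) (x : ℝ) : Mat2 := !![lam * Z.w n x, 0; 0, lam⁻¹ * Z.wi n x]

def D (n : ℕ) (x : ℝ) : Mat2 := Z.B n (x + Z.α) * Z.Lm n x * Z.BI n x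

lemma D_det (n : ℕ) (x : ℝ) : (Z.D n x).det = 1 := by
  unfold D
  rw [Matrix.det_mul, Matrix.det_mul, B_det, BI_det, Lm, Matrix.det_fin_two_of]
  have := Z.w_wi n x
  have h := lam_ne
  field_simp; linarith

/-- `B_n` on `I_n` -/
lemma B_in (n : ℕ) {x : ℝ} (hx : nd x ≤ Z.l n) : Z.B n x = !![1, Z.wi n x; 0, 1] := by
  induction n with
  | zero => simp [B, wi]
  | succ n ih =>
    simp only [B]
    rw [ih (hx.trans (Z.l_anti n)), H, t_in hx, t'_in hx]
    unfold ρ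
    ext i j; fin_cases i <;> fin_cases j <;> simp [Matrix.mul_apply, Fin.sum_univ_two]

lemma BI_in (n : ℕ) {x : ℝ} (hx : nd x ≤ Z.l n) : Z.BI n x = !![1, -Z.wi n x; 0, 1] := by
  have h1 := Z.BI_B n x
  rw [Z.B_in n hx] at h1
  have h2 : (!![1, Z.wi n x; 0, 1] : Mat2) * !![1, -Z.wi n x; 0, 1] = 1 := by
    ext i j; fin_cases i <;> fin_cases j <;> simp [Matrix.mul_apply, Fin.sum_univ_two]
  exact left_inv_eq_right_inv h1 h2

def E21 : Mat2 := !![0, 0; 1, 0]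

def Er (n : ℕ) (x : ℝ) : Mat2 :=
  !![0, lam * Z.w n x * Z.sk n (Z.X (n + 1)) x;
    -(lam * Z.w n x * Z.tk n (Z.X (n + 1)) (x + Z.α)), 0]

lemma mid_in (n : ℕ) {x : ℝ} (hx : nd x ≤ Z.l (n + 1)) :
    Z.H n (x + Z.α) * Z.Lm (n + 1) x * Z.Hi n x = Z.Lm n x
      + (Z.w n x - Z.w (n + 1) x) • (Z.Lm n x * (Z.BI n x * E21 * Z.B n x)) + Z.Er n x := by
  rw [Z.B_in n (hx.trans (Z.l_anti n)), Z.BI_in n (hx.trans (Z.l_anti n))]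
  unfold H Hi Er Lm E21
  rw [t_in hx, t'_in hx, t'_plus_in hx, t_plus_in hx, sk_in hx, tk_in hx]
  have hw := Z.w_eq n x
  have hw' := Z.w_eq (n + 1) x
  have h1 := (Z.wi_pos n x).ne'
  have h2 := (Z.wi_pos (n + 1) x).ne'
  have h3 := lam_ne
  unfold ρ
  rw [hw, hw']
  ext i j; fin_cases i <;> fin_cases j <;> simp [Matrix.mul_apply, Fin.sum_univ_two] <;> field_simp <;> ring

lemma mid_out (n : ℕ) {x : ℝ} (hx : Z.l (n + 1) < nd x) :
    Z.H n (x + Z.α) * Z.Lm (n + 1) x * Z.Hi n x = Z.Lm n x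
      + (Z.w n x - Z.w (n + 1) x) • (Z.Lm n x * (Z.BI n x * E21 * Z.B n x)) + Z.Er n x := by
  have ew : Z.w (n + 1) x = Z.w n x := by simp only [w]; rw [Z.φ_out _ hx]; simp
  have ewi : Z.wi (n + 1) x = Z.wi n x := by simp only [wi]; rw [Z.ψ_out _ hx]; simp
  have a1 := tt1_out hx
  have a2 := tt2_out (Z := Z) (n := n) (x := x)
  have b1 := Z.t'_rec n x
  have b2 := Z.t_rec n x
  rw [Z.ρ_out n hx] at b1 b2
  rw [ew, sub_self, zero_smul, add_zero]
  unfold H Hi Er Lm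
  rw [ew, ewi]
  have hw := Z.w_eq n x
  have h1 := (Z.wi_pos n x).ne'
  have h3 := lam_ne
  have hww := Z.w_wi n x
  have hl : lam⁻¹ * lam = 1 := inv_mul_cancel₀ h3
  set a := Z.t n (x + Z.α)
  set a' := Z.t' n (x + Z.α)
  set b := Z.t n x
  set b' := Z.t' n x
  set W := Z.w n x
  set Wi := Z.wi n x
  set p := Z.sk n (Z.X (n + 1)) x
  set q := Z.tk n (Z.X (n + 1)) (x + Z.α)
  set μ := lam⁻¹
  ext i j; fin_cases i <;> fin_cases j <;> simp [Matrix.mul_apply, Fin.sum_univ_two]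
  · rcases mul_eq_zero.1 a2 with h | h <;> simp [h]
  · have : a' * (μ * Wi) = lam * W * (μ ^ 2 * Wi ^ 2 * a') := by
      linear_combination (-(a' * μ * Wi)) * hww + (-(W * Wi) * a' * μ * Wi) * hl
    rw [this, b1]; ring
  · have : μ * Wi * b = lam * W * (μ ^ 2 * Wi ^ 2 * b) := by
      linear_combination (-(b * μ * Wi)) * hww + (-(W * Wi) * b * μ * Wi) * hl
    rw [this, b2]; ring
  · rcases mul_eq_zero.1 a1 with h | h <;> simp [h]

lemma mid (n : ℕ) (x : ℝ) :
    Z.H n (x + Z.α) * Z.Lm (n + 1) x * Z.Hi n x = Z.Lm n x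
      + (Z.w n x - Z.w (n + 1) x) • (Z.Lm n x * (Z.BI n x * E21 * Z.B n x)) + Z.Er n x := by
  rcases le_or_gt (nd x) (Z.l (n + 1)) with h | h
  · exact Z.mid_in n h
  · exact Z.mid_out n h

/-- The key identity. -/
lemma D_succ (n : ℕ) (x : ℝ) : Z.D (n + 1) x = Z.D n x
    + (Z.w n x - Z.w (n + 1) x) • (Z.D n x * E21)
    + Z.B n (x + Z.α) * Z.Er n x * Z.BI n x := by
  have : Z.D (n + 1) x = Z.B n (x + Z.α) *
      (Z.H n (x + Z.α) * Z.Lm (n + 1) x * Z.Hi n x) * Z.BI n x := by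
    unfold D; simp only [B, BI, mul_assoc]
  rw [this, mid]
  have e : Z.B n (x + Z.α) * (Z.Lm n x * (Z.BI n x * E21 * Z.B n x)) * Z.BI n x
      = Z.D n x * E21 := by
    unfold D
    calc _ = Z.B n (x + Z.α) * Z.Lm n x * Z.BI n x * E21 * (Z.B n x * Z.BI n x) := by
          simp only [mul_assoc]
      _ = _ := by rw [B_BI, mul_one]
  rw [← e]
  unfold D
  simp only [mul_add, add_mul, Matrix.mul_smul, Matrix.smul_mul]

lemma periodic_ρ (n : ℕ) (x : ℝ) : Z.ρ n (x + 1) = Z.ρ n x := by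
  unfold ρ; rw [periodic_wi, periodic_wi]

lemma periodic_tk (n k : ℕ) (x : ℝ) : Z.tk n k (x + 1) = Z.tk n k x := by
  induction k generalizing x with
  | zero => simp only [tk]; rw [show x + 1 - Z.α = (x - Z.α) + 1 by ring, periodic_ρ]
  | succ k ih => simp only [tk]; rw [show x + 1 - Z.α = (x - Z.α) + 1 by ring, periodic_wi, ih]

lemma periodic_sk (n k : ℕ) (x : ℝ) : Z.sk n k (x + 1) = Z.sk n k x := by
  induction k generalizing x with
  | zero => simp only [sk]; rw [periodic_ρ]
  | succ k ih => simp only [sk]; rw [show x + 1 + Z.α = (x + Z.α) + 1 by ring, periodic_wi, ih]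

lemma periodic_H (n : ℕ) (x : ℝ) : Z.H n (x + 1) = Z.H n x ∧ Z.Hi n (x + 1) = Z.Hi n x := by
  simp only [H, Hi, t, t', periodic_tk, periodic_sk, and_self]

lemma periodic_B (n : ℕ) (x : ℝ) : Z.B n (x + 1) = Z.B n x ∧ Z.BI n (x + 1) = Z.BI n x := by
  induction n with
  | zero => exact ⟨rfl, rfl⟩
  | succ n ih => simp only [B, BI]; rw [ih.1, ih.2, (Z.periodic_H n x).1, (Z.periodic_H n x).2]; simp

lemma periodic_D (n : ℕ) (x : ℝ) : Z.D n (x + 1) = Z.D n x := by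
  unfold D Lm
  rw [show x + 1 + Z.α = (x + Z.α) + 1 by ring, (Z.periodic_B n _).1, (Z.periodic_B n _).2,
    periodic_w, periodic_wi]

end Setup

/-! ### Norm estimates -/

lemma SB.of_eq {σ R y M : ℝ} {f g : ℝ → ℝ} (h : SB σ R f y M) (e : ∀ x, g x = f x) : SB σ R g y M := by
  have : g = f := funext e
  rw [this]; exact h

namespace Setup
variable (Z : Setup)

lemma ρ_sb (n : ℕ) (y : ℝ) : SB Z.σ (Z.Rn (n + 1)) (Z.ρ n) y (2 * 3 ^ Z.X (n + 1)) := by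
  have h1 := Z.wi_sb (n + 1) y
  have h2 := (Z.wi_sb n y).monoR (Z.Rn_pos n) (Z.Rn_mono n)
  refine (h1.sub (Z.Rn_pos _) h2).mono ?_
  have a1 : (3:ℝ) ^ Z.V (n + 1) y ≤ 3 ^ Z.X (n + 1) :=
    pow_le_pow_right₀ (by norm_num) (Z.V_le _ _)
  have a2 : (3:ℝ) ^ Z.V n y ≤ 3 ^ Z.X (n + 1) :=
    pow_le_pow_right₀ (by norm_num) ((Z.V_le _ _).trans (by rw [X_succ]; omega))
  linarith

lemma wi2_sb (n : ℕ) (y : ℝ) :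
    SB Z.σ (Z.Rn (n + 1)) (fun x => Z.wi n x ^ 2) y (9 ^ Z.V n y) := by
  have h2 := ((Z.wi_sb n y).monoR (Z.Rn_pos n) (Z.Rn_mono n)).pow Z.hσ (Z.Rn_pos _) 2
  refine h2.mono (le_of_eq ?_)
  rw [← pow_mul, mul_comm, pow_mul]; norm_num

lemma sk_sb0 (n k : ℕ) (y : ℝ) : SB Z.σ (Z.Rn (n + 1)) (Z.sk n k) y
    (2 * 3 ^ Z.X (n + 1) * (lam⁻¹ ^ 2) ^ k * 9 ^ (∑ i ∈ Finset.range k, Z.V n (y + i * Z.α))) := by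
  induction k generalizing y with
  | zero =>
    have e : Z.sk n 0 = Z.ρ n := by funext x; rfl
    rw [e]; simpa using Z.ρ_sb n y
  | succ k ih =>
    have h1 := (ih (y + Z.α)).shift
    have h2 := ((Z.wi2_sb n y).mul Z.hσ (Z.Rn_pos _) h1).const_mul (Z.Rn_pos _) (lam⁻¹ ^ 2)
    refine h2.mono (le_of_eq ?_)
    rw [abs_of_nonneg (by positivity), Finset.sum_range_succ']
    have e : ∀ i : ℕ, y + ((i + 1 : ℕ) : ℝ) * Z.α = y + Z.α + i * Z.α := by
      intro i; push_cast; ring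
    simp only [e]
    rw [pow_add 9, pow_succ (lam⁻¹ ^ 2)]
    simp only [Nat.cast_zero, zero_mul, add_zero]
    ring

lemma tk_sb0 (n k : ℕ) (y : ℝ) : SB Z.σ (Z.Rn (n + 1)) (Z.tk n k) y
    (2 * 3 ^ Z.X (n + 1) * (lam⁻¹ ^ 2) ^ (k + 1) *
      9 ^ (∑ i ∈ Finset.range k, Z.V n ((y - (k + 1 : ℕ) * Z.α + Z.α) + i * Z.α))) := by
  induction k generalizing y with
  | zero =>
    have h1 : SB Z.σ (Z.Rn (n + 1)) (fun x => Z.ρ n (x + (-Z.α))) y _ := (Z.ρ_sb n _).shift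
    have h2 := h1.const_mul (Z.Rn_pos _) (lam⁻¹ ^ 2)
    have e : (fun x => lam⁻¹ ^ 2 * Z.ρ n (x + (-Z.α))) = Z.tk n 0 := by
      funext x; simp only [tk, sub_eq_add_neg]
    rw [e] at h2
    refine h2.mono (le_of_eq ?_)
    rw [abs_of_nonneg (by positivity)]; simp; ring
  | succ k ih =>
    have h1 : SB Z.σ (Z.Rn (n + 1)) (fun x => Z.tk n k (x + (-Z.α))) y _ := (ih _).shift
    have h3 : SB Z.σ (Z.Rn (n + 1)) (fun x => Z.wi n (x + (-Z.α)) ^ 2) y _ :=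
      SB.shift (f := fun x => Z.wi n x ^ 2) (Z.wi2_sb n _)
    have h2 := (h3.mul Z.hσ (Z.Rn_pos _) h1).const_mul (Z.Rn_pos _) (lam⁻¹ ^ 2)
    have e : (fun x => lam⁻¹ ^ 2 * (Z.wi n (x + (-Z.α)) ^ 2 * Z.tk n k (x + (-Z.α)))) = Z.tk n (k + 1) := by
      funext x; simp only [tk, sub_eq_add_neg]
    rw [e] at h2
    refine h2.mono (le_of_eq ?_)
    rw [abs_of_nonneg (by positivity), Finset.sum_range_succ]
    have e1 : ∀ i : ℕ, y - ((k + 1 + 1 : ℕ) : ℝ) * Z.α + Z.α + i * Z.α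
        = y + -Z.α - ((k + 1 : ℕ) : ℝ) * Z.α + Z.α + i * Z.α := by
      intro i; push_cast; ring
    have e2 : y + -Z.α - ((k + 1 : ℕ) : ℝ) * Z.α + Z.α + k * Z.α = y + -Z.α := by push_cast; ring
    simp only [e1, e2]
    rw [pow_add 9, pow_succ (lam⁻¹ ^ 2) (k + 1)]
    ring

def κ : ℝ := 9 * lam⁻¹ ^ 2

lemma κ_pos : 0 < κ := by unfold κ; have := lam_pos; positivity

lemma lam_big : (2:ℝ) ^ 100 ≤ lam := by
  have h : ∀ n : ℕ, 100 ≤ n → (2:ℝ) ^ 100 ≤ 2 ^ n := fun n hn => pow_le_pow_right₀ (by norm_num) hn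
  have h2 := h 2000 (by norm_num)
  unfold lam
  exact h2

lemma κ_le : κ ≤ 1 / 2 := by
  unfold κ
  have h : lam⁻¹ ≤ (2 ^ 100)⁻¹ := inv_anti₀ (by positivity) lam_big
  have h0 : 0 ≤ lam⁻¹ := (inv_pos.2 lam_pos).le
  calc 9 * lam⁻¹ ^ 2 ≤ 9 * ((2 ^ 100)⁻¹) ^ 2 :=
        mul_le_mul_of_nonneg_left (pow_le_pow_left₀ h0 h 2) (by norm_num)
    _ ≤ 1 / 2 := by norm_num

lemma pow_aux (n k j : ℕ) (h : j ≤ k + Z.X n) :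
    (2 * 3 ^ Z.X (n + 1) * (lam⁻¹ ^ 2) ^ k * 9 ^ j : ℝ) ≤ 2 * 27 ^ Z.X (n + 1) * κ ^ k := by
  have hl : 0 < lam⁻¹ := inv_pos.2 lam_pos
  have h1 : (9:ℝ) ^ j ≤ 9 ^ k * 9 ^ Z.X (n + 1) := by
    rw [← pow_add]
    exact pow_le_pow_right₀ (by norm_num) (by rw [X_succ]; omega)
  have e : (27:ℝ) ^ Z.X (n + 1) = 3 ^ Z.X (n + 1) * 9 ^ Z.X (n + 1) := by rw [← mul_pow]; norm_num
  unfold κ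
  rw [mul_pow 9, e]
  calc _ ≤ (2 * 3 ^ Z.X (n + 1) * (lam⁻¹ ^ 2) ^ k * (9 ^ k * 9 ^ Z.X (n + 1)) : ℝ) := by gcongr
    _ = _ := by ring

lemma sk_sb (n k : ℕ) (y : ℝ) :
    SB Z.σ (Z.Rn (n + 1)) (Z.sk n k) y (2 * 27 ^ Z.X (n + 1) * κ ^ k) :=
  (Z.sk_sb0 n k y).mono (Z.pow_aux n k _ (Z.star n k y))

lemma tk_sb (n k : ℕ) (y : ℝ) :
    SB Z.σ (Z.Rn (n + 1)) (Z.tk n k) y (2 * 27 ^ Z.X (n + 1) * κ ^ k) := by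
  refine (Z.tk_sb0 n k y).mono (le_trans ?_ (Z.pow_aux n k _ (Z.star n k (y - (k + 1 : ℕ) * Z.α + Z.α))))
  have hl : 0 < lam⁻¹ := inv_pos.2 lam_pos
  have hl1 : lam⁻¹ ≤ 1 := inv_le_one_of_one_le₀ one_le_lam
  rw [pow_succ (lam⁻¹ ^ 2)]
  have : lam⁻¹ ^ 2 ≤ 1 := pow_le_one₀ hl.le hl1
  have h0 : (0:ℝ) < (lam⁻¹ ^ 2) ^ k := by positivity
  gcongr
  nlinarith

lemma geo_κ (m : ℕ) : ∑ k ∈ Finset.range m, κ ^ k ≤ 2 := by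
  calc _ ≤ ∑ k ∈ Finset.range m, (1 / 2 : ℝ) ^ k :=
        Finset.sum_le_sum fun k _ => pow_le_pow_left₀ κ_pos.le κ_le k
    _ ≤ 2 := sum_geometric_two_le m

lemma t_sb (n : ℕ) (y : ℝ) : SB Z.σ (Z.Rn (n + 1)) (Z.t n) y (4 * 27 ^ Z.X (n + 1)) := by
  have := SB.sum (Z.Rn_pos (n + 1)) (Z.X (n + 1)) (fun k _ => Z.tk_sb n k y)
  refine this.mono ?_
  rw [← Finset.mul_sum]
  have := geo_κ (Z.X (n+1))
  have h : (0:ℝ) < 27 ^ Z.X (n+1) := by positivity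
  nlinarith

lemma t'_sb (n : ℕ) (y : ℝ) : SB Z.σ (Z.Rn (n + 1)) (Z.t' n) y (4 * 27 ^ Z.X (n + 1)) := by
  have := SB.sum (Z.Rn_pos (n + 1)) (Z.X (n + 1)) (fun k _ => Z.sk_sb n k y)
  refine this.mono ?_
  rw [← Finset.mul_sum]
  have := geo_κ (Z.X (n+1))
  have h : (0:ℝ) < 27 ^ Z.X (n+1) := by positivity
  nlinarith

lemma pow_step (n : ℕ) : (27:ℝ) ^ (4 * Z.X n) * 1 + 27 ^ (4 * Z.X n) * (4 * 27 ^ Z.X (n + 1))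
    ≤ 27 ^ (4 * Z.X (n + 1)) := by
  have e : 4 * Z.X (n + 1) = 4 * Z.X n + (Z.X (n + 1) + Z.X (n + 1)) := by rw [X_succ]; ring
  rw [e, pow_add, ← mul_add]
  gcongr
  rw [pow_add]
  have h : (27:ℝ) ^ 1 ≤ 27 ^ Z.X (n + 1) := pow_le_pow_right₀ (by norm_num) (Z.X_pos _)
  rw [pow_one] at h
  nlinarith

lemma B_sb (n : ℕ) (y : ℝ) (i j : Fin 2) :
    SB Z.σ (Z.Rn n) (fun x => Z.B n x i j) y (27 ^ (4 * Z.X n)) := by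
  induction n generalizing i j with
  | zero =>
    simp only [B]
    refine (SB.const (Z.Rn_pos 0) _ y).mono ?_
    have : (1:ℝ) ≤ 27 ^ (4 * Z.X 0) := one_le_pow₀ (by norm_num)
    fin_cases i <;> fin_cases j <;> simp [this]
  | succ n ih =>
    have hB := fun i j => (ih i j).monoR (Z.Rn_pos n) (Z.Rn_mono n)
    have h1 := fun i => (hB i 0).mul Z.hσ (Z.Rn_pos _) (SB.const (Z.Rn_pos _) 1 y)
    have h2 := fun i => (hB i 1).mul Z.hσ (Z.Rn_pos _) (SB.const (Z.Rn_pos _) 1 y)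
    have h3 := fun i => (hB i 1).mul Z.hσ (Z.Rn_pos _) (Z.t_sb n y)
    have h4 := fun i => (hB i 0).mul Z.hσ (Z.Rn_pos _) (Z.t'_sb n y)
    have hj : j = 0 ∨ j = 1 := by fin_cases j <;> simp
    rcases hj with rfl | rfl
    · have := ((h1 i).add (Z.Rn_pos _) (h3 i)).mono (by simpa using Z.pow_step n)
      exact this.of_eq fun x => by simp [B, H, Matrix.mul_apply, Fin.sum_univ_two]
    · have := ((h2 i).add (Z.Rn_pos _) (h4 i)).mono (by simpa using Z.pow_step n)
      exact this.of_eq fun x => by simp [B, H, Matrix.mul_apply, Fin.sum_univ_two]; ring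

lemma BI_sb (n : ℕ) (y : ℝ) (i j : Fin 2) :
    SB Z.σ (Z.Rn n) (fun x => Z.BI n x i j) y (27 ^ (4 * Z.X n)) := by
  induction n generalizing i j with
  | zero =>
    simp only [BI]
    refine (SB.const (Z.Rn_pos 0) _ y).mono ?_
    have : (1:ℝ) ≤ 27 ^ (4 * Z.X 0) := one_le_pow₀ (by norm_num)
    fin_cases i <;> fin_cases j <;> simp [this]
  | succ n ih =>
    have hB := fun i j => (ih i j).monoR (Z.Rn_pos n) (Z.Rn_mono n)
    have h1 := fun j => (hB 0 j).mul Z.hσ (Z.Rn_pos _) (SB.const (Z.Rn_pos _) 1 y)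
    have h2 := fun j => (hB 1 j).mul Z.hσ (Z.Rn_pos _) (SB.const (Z.Rn_pos _) 1 y)
    have h3 := fun j => (hB 0 j).mul Z.hσ (Z.Rn_pos _) ((Z.t_sb n y).neg (Z.Rn_pos _))
    have h4 := fun j => (hB 1 j).mul Z.hσ (Z.Rn_pos _) ((Z.t'_sb n y).neg (Z.Rn_pos _))
    have hi : i = 0 ∨ i = 1 := by fin_cases i <;> simp
    rcases hi with rfl | rfl
    · have := ((h1 j).add (Z.Rn_pos _) (h4 j)).mono (by simpa using Z.pow_step n)
      exact this.of_eq fun x => by simp [BI, Hi, Matrix.mul_apply, Fin.sum_univ_two]; ring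
    · have := ((h2 j).add (Z.Rn_pos _) (h3 j)).mono (by simpa using Z.pow_step n)
      exact this.of_eq fun x => by simp [BI, Hi, Matrix.mul_apply, Fin.sum_univ_two]; ring

lemma er_aux (n : ℕ) :
    2 * (27 ^ (4 * Z.X n) * (lam * 3 ^ Z.X n * (2 * 27 ^ Z.X (n + 1) * κ ^ Z.X (n + 1)))
      * 27 ^ (4 * Z.X n)) ≤ (1 / 4 : ℝ) ^ Z.X (n + 1) := by
  set X := Z.X (n + 1) with hX
  have hXn : Z.X n ≤ X := by rw [hX, X_succ]; omega
  have h4 : 4 * Z.X n = 2 * X := by rw [hX, X_succ]; ring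
  have hX1 : 1 ≤ X := Z.X_pos _
  have hl := lam_pos
  have a3 : (3:ℝ) ^ Z.X n ≤ 27 ^ X :=
    (pow_le_pow_right₀ (by norm_num) hXn).trans (pow_le_pow_left₀ (by norm_num) (by norm_num) _)
  have al : lam * κ ^ X ≤ (9 * lam⁻¹) ^ X := by
    have : lam ≤ lam ^ X := le_self_pow₀ one_le_lam (by omega)
    calc lam * κ ^ X ≤ lam ^ X * κ ^ X := by have := κ_pos; gcongr
      _ = _ := by rw [← mul_pow]; unfold κ; congr 1; field_simp
  have a4 : (4:ℝ) ≤ 4 ^ X := le_self_pow₀ (by norm_num) (by omega)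
  rw [h4]
  have hk := κ_pos
  calc _ = 4 * (27 ^ (2 * X) * 27 ^ (2 * X) * 27 ^ X) * 3 ^ Z.X n * (lam * κ ^ X) := by ring
    _ ≤ 4 ^ X * (27 ^ (2 * X) * 27 ^ (2 * X) * 27 ^ X) * 27 ^ X * (9 * lam⁻¹) ^ X := by gcongr
    _ = (4 * 27 ^ 6 * (9 * lam⁻¹)) ^ X := by
        simp only [pow_mul, ← mul_pow]; congr 1; ring
    _ ≤ _ := by
        have : lam⁻¹ ≤ (2 ^ 100)⁻¹ := inv_anti₀ (by positivity) lam_big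
        apply pow_le_pow_left₀ (by positivity)
        calc _ ≤ 4 * 27 ^ 6 * (9 * (2 ^ 100 : ℝ)⁻¹) := by gcongr
          _ ≤ 1 / 4 := by norm_num

lemma Er_sb (n : ℕ) (y : ℝ) (i j : Fin 2) :
    SB Z.σ (Z.Rn (n + 1)) (fun x => (Z.B n (x + Z.α) * Z.Er n x * Z.BI n x) i j) y
      ((1 / 4) ^ Z.X (n + 1)) := by
  have hR := Z.Rn_pos (n + 1)
  have hB : ∀ i j, SB Z.σ (Z.Rn (n + 1)) (fun x => Z.B n (x + Z.α) i j) y _ := fun i j =>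
    SB.shift (f := fun x => Z.B n x i j) ((Z.B_sb n (y + Z.α) i j).monoR (Z.Rn_pos n) (Z.Rn_mono n))
  have hBI := fun i j => (Z.BI_sb n y i j).monoR (Z.Rn_pos n) (Z.Rn_mono n)
  have hw0 : SB Z.σ (Z.Rn (n + 1)) (fun x => lam * Z.w n x) y (lam * 3 ^ Z.X n) := by
    have := ((Z.w_sb n y).monoR (Z.Rn_pos n) (Z.Rn_mono n)).const_mul hR lam
    refine this.mono ?_
    rw [abs_of_pos lam_pos]
    have := lam_pos
    gcongr
    · norm_num
    · exact Z.V_le n y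
  have e1 := hw0.mul Z.hσ hR (Z.sk_sb n (Z.X (n + 1)) y)
  have e2 := (hw0.mul Z.hσ hR (SB.shift (Z.tk_sb n (Z.X (n + 1)) (y + Z.α)))).neg hR
  have a1 := ((hB i 0).mul Z.hσ hR e1).mul Z.hσ hR (hBI 1 j)
  have a2 := ((hB i 1).mul Z.hσ hR e2).mul Z.hσ hR (hBI 0 j)
  have := (a1.add hR a2).mono (le_trans (le_of_eq (by ring)) (Z.er_aux n))
  exact this.of_eq fun x => by simp [Er, Matrix.mul_apply, Fin.sum_univ_two]; ring

/-- conversion to the final norm -/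
lemma conv128 (n : ℕ) {f : ℝ → ℝ} {y M : ℝ} (h : SB Z.σ (128 * Z.Rn n) f y M) :
    SB (Z.σ + Z.θ) (1 / 2) f y (Real.exp (Z.X n / 32) * M) := by
  have hR : 0 < 128 * Z.Rn n := by have := Z.Rn_pos n; positivity
  have := h.convert hR (by norm_num : (0:ℝ) < 1 / 2) Z.hθ
  refine this.mono ?_
  have h0 := h.nonneg
  gcongr
  have e := Z.hconv n
  have e2 : 128 * Z.Rn n / (1 / 2) = 2 * (128 * (Z.R0 / Z.l n)) := by unfold Rn; ring
  rw [e2]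
  exact Real.exp_le_exp.1 e

lemma conv (n : ℕ) {f : ℝ → ℝ} {y M : ℝ} (h : SB Z.σ (Z.Rn n) f y M) :
    SB (Z.σ + Z.θ) (1 / 2) f y (Real.exp (Z.X n / 32) * M) :=
  Z.conv128 n (h.monoR (Z.Rn_pos n) (by have := Z.Rn_pos n; linarith))

lemma exp_16 : Real.exp (1 / 16) ≤ 6 / 5 := by
  have h := Real.add_one_le_exp (-(1/16 : ℝ))
  rw [Real.exp_neg] at h
  have h0 := Real.exp_pos (1/16)
  rw [le_inv_comm₀ (by norm_num) h0] at h
  exact h.trans (by norm_num)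

lemma exp_X (n : ℕ) : Real.exp (Z.X (n + 1) / 32) ≤ (6 / 5) ^ Z.X n := by
  have : ((Z.X (n + 1) : ℕ) : ℝ) / 32 = Z.X n * (1 / 16) := by rw [X_succ]; push_cast; ring
  rw [this, Real.exp_nat_mul]
  exact pow_le_pow_left₀ (Real.exp_pos _).le exp_16 _

lemma yv_sb (n : ℕ) (y : ℝ) : SB (Z.σ + Z.θ) (1 / 2) (fun x => Z.w n x - Z.w (n + 1) x) y
    (2 ^ (Z.P + 1) * (3 / 4) ^ n) := by
  have hR := Z.Rn_pos (n + 1)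
  have h1 := (((SB.const hR 1 y).sub hR ((Z.φ_sb (n + 1) y).pow Z.hσ hR (Z.X n))).const_mul hR
    (2 ^ Z.P / 2 ^ Z.X n))
  have h2 := Z.conv (n + 1) h1
  have e : (fun x => (2 ^ Z.P / 2 ^ Z.X n : ℝ) * (1 - Z.φ (n + 1) x ^ Z.X n)) = fun x => Z.w n x - Z.w (n + 1) x := by
    funext x; rw [y_eq]
  rw [e] at h2
  refine h2.mono ?_
  rw [abs_one, abs_of_pos (by positivity)]
  have h54 : (1:ℝ) ≤ (5 / 4) ^ Z.X n := one_le_pow₀ (by norm_num)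
  calc _ ≤ (6 / 5 : ℝ) ^ Z.X n * (2 ^ Z.P / 2 ^ Z.X n * ((5 / 4) ^ Z.X n + (5 / 4) ^ Z.X n)) := by
        gcongr; exact Z.exp_X n
    _ = 2 ^ (Z.P + 1) * (3 / 4 : ℝ) ^ Z.X n := by
        have : (3 / 4 : ℝ) ^ Z.X n = (6/5) ^ Z.X n * (5/4) ^ Z.X n / 2 ^ Z.X n := by
          rw [← mul_pow, ← div_pow]; norm_num
        rw [this]; ring
    _ ≤ _ := by
        gcongr ?_ * ?_
        exact pow_le_pow_of_le_one (by norm_num) (by norm_num) (Z.X_ge n)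

lemma Er_sb' (n : ℕ) (y : ℝ) (i j : Fin 2) :
    SB (Z.σ + Z.θ) (1 / 2) (fun x => (Z.B n (x + Z.α) * Z.Er n x * Z.BI n x) i j) y
      ((3 / 4) ^ n) := by
  refine (Z.conv (n + 1) (Z.Er_sb n y i j)).mono ?_
  calc _ ≤ (6 / 5 : ℝ) ^ Z.X n * (1 / 4) ^ Z.X n := by
        gcongr ?_ * ?_
        · exact Z.exp_X n
        · exact pow_le_pow_of_le_one (by norm_num) (by norm_num) (by rw [X_succ]; omega)
    _ = (3 / 10) ^ Z.X n := by rw [← mul_pow]; norm_num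
    _ ≤ (3 / 4) ^ Z.X n := by gcongr; norm_num
    _ ≤ _ := pow_le_pow_of_le_one (by norm_num) (by norm_num) (Z.X_ge n)

def u (n : ℕ) : ℝ := 2 ^ (Z.P + 2) * (3 / 4) ^ n

lemma u_pos (n : ℕ) : 0 < Z.u n := by unfold u; positivity

lemma u_ge (n : ℕ) : 2 ^ (Z.P + 1) * (3 / 4) ^ n + (3 / 4) ^ n ≤ Z.u n := by
  unfold u
  have h : (1:ℝ) ≤ 2 ^ (Z.P + 1) := one_le_pow₀ (by norm_num)
  have h2 : (0:ℝ) < (3/4) ^ n := by positivity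
  rw [pow_succ 2 (Z.P + 1)]
  nlinarith

lemma u_summable : Summable Z.u := by
  unfold u
  exact (summable_geometric_of_lt_one (by norm_num) (by norm_num)).mul_left _

lemma step_sb {n : ℕ} {y d : ℝ} (hd : 1 ≤ d)
    (h : ∀ i j, SB (Z.σ + Z.θ) (1 / 2) (fun x => Z.D n x i j) y d) (i j : Fin 2) :
    SB (Z.σ + Z.θ) (1 / 2) (fun x => Z.D (n + 1) x i j - Z.D n x i j) y (d * Z.u n) := by
  have hR : (0:ℝ) < 1 / 2 := by norm_num
  have hσ : 1 ≤ Z.σ + Z.θ := by have := Z.hσ; have := Z.hθ; linarith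
  have hE : SB (Z.σ + Z.θ) (1 / 2) (fun x => (Z.D n x * E21) i j) y d := by
    have hj : j = 0 ∨ j = 1 := by fin_cases j <;> simp
    rcases hj with rfl | rfl
    · exact (h i 1).of_eq fun x => by simp [E21, Matrix.mul_apply, Fin.sum_univ_two]
    · have := (SB.const (σ := Z.σ + Z.θ) hR 0 y).mono (M' := d) (by simp; linarith)
      exact this.of_eq fun x => by simp [E21, Matrix.mul_apply, Fin.sum_univ_two]
  have h1 := ((Z.yv_sb n y).mul hσ hR hE).add hR (Z.Er_sb' n y i j)
  have e : (fun x => (Z.w n x - Z.w (n + 1) x) * (Z.D n x * E21) i j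
      + (Z.B n (x + Z.α) * Z.Er n x * Z.BI n x) i j) = fun x => Z.D (n + 1) x i j - Z.D n x i j := by
    funext x
    rw [D_succ]
    simp only [Matrix.add_apply, Matrix.smul_apply, smul_eq_mul]; ring
  rw [e] at h1
  refine h1.mono ?_
  have := Z.u_ge n
  have h2 : (0:ℝ) < (3/4) ^ n := by positivity
  nlinarith

lemma D_sb0 (n : ℕ) (y : ℝ) (i j : Fin 2) :
    SB (Z.σ + Z.θ) (1 / 2) (fun x => Z.D n x i j) y
      (2 * lam * Real.exp (∑ k ∈ Finset.range n, Z.u k)) := by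
  have hl := one_le_lam
  induction n generalizing i j with
  | zero =>
    have e : (fun x => Z.D 0 x i j) = fun _ => Z.D 0 0 i j := by
      funext x; simp [D, B, BI, Lm, w, wi]
    rw [e]
    refine (SB.const (by norm_num) _ y).mono ?_
    have h1 : lam⁻¹ ≤ 1 := inv_le_one_of_one_le₀ one_le_lam
    have h2 : 0 < lam⁻¹ := inv_pos.2 lam_pos
    fin_cases i <;> fin_cases j <;>
      simp [D, B, BI, Lm, w, wi, Matrix.mul_apply, Fin.sum_univ_two, abs_of_pos lam_pos] <;>
      (first | linarith | (rw [abs_le]; constructor <;> linarith))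
  | succ n ih =>
    set d := 2 * lam * Real.exp (∑ k ∈ Finset.range n, Z.u k) with hd
    have hs : 0 ≤ ∑ k ∈ Finset.range n, Z.u k := Finset.sum_nonneg fun k _ => (Z.u_pos k).le
    have hd1 : 1 ≤ d := by
      have := Real.one_le_exp hs
      rw [hd]; nlinarith
    have h := (ih i j).add (by norm_num) (Z.step_sb hd1 ih i j)
    simp only [add_sub_cancel] at h
    refine h.mono ?_
    rw [Finset.sum_range_succ, Real.exp_add, ← mul_assoc, ← hd]
    have := Real.add_one_le_exp (Z.u n)
    nlinarith

def dmax : ℝ := 2 * lam * Real.exp (∑' k, Z.u k)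

lemma dmax_ge : 1 ≤ Z.dmax := by
  have h : 0 ≤ ∑' k, Z.u k := tsum_nonneg fun k => (Z.u_pos k).le
  have := Real.one_le_exp h
  have hl := one_le_lam
  unfold dmax; nlinarith

lemma D_sb (n : ℕ) (y : ℝ) (i j : Fin 2) :
    SB (Z.σ + Z.θ) (1 / 2) (fun x => Z.D n x i j) y Z.dmax := by
  refine (Z.D_sb0 n y i j).mono ?_
  unfold dmax
  have hl := lam_pos
  gcongr
  exact Z.u_summable.sum_le_tsum _ (fun k _ => (Z.u_pos k).le)

lemma DD_sb (n : ℕ) (y : ℝ) (i j : Fin 2) :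
    SB (Z.σ + Z.θ) (1 / 2) (fun x => Z.D (n + 1) x i j - Z.D n x i j) y (Z.dmax * Z.u n) :=
  Z.step_sb Z.dmax_ge (Z.D_sb n y) i j

end Setup

/-! ### Limits and Gevrey membership -/

lemma SB.tsum {σ R : ℝ} (hR : 0 < R) {f : ℕ → ℝ → ℝ} {c : ℕ → ℝ} (hc : Summable c)
    (h : ∀ i y, SB σ R (f i) y (c i)) (y : ℝ) : SB σ R (fun x => ∑' i, f i x) y (∑' i, c i) := by
  have hb : ∀ (k : ℕ) (i : ℕ) (x : ℝ), ‖iteratedFDeriv ℝ k (f i) x‖ ≤ c i * cw σ R k := by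
    intro k i x
    rw [norm_iteratedFDeriv_eq_norm_iteratedDeriv]
    exact (h i x).deriv_le hR k
  have hv : ∀ k : ℕ, (k : ℕ∞) ≤ ⊤ → Summable (fun i => c i * cw σ R k) := fun k _ => hc.mul_right _
  have hsm : ContDiff ℝ ((⊤ : ℕ∞)) (fun x => ∑' i, f i x) :=
    contDiff_tsum (N := ⊤) (fun i => (h i 0).1) hv (fun k i x _ => hb k i x)
  have hd : ∀ (k : ℕ), iteratedDeriv k (fun x => ∑' i, f i x) y = ∑' i, iteratedDeriv k (f i) y := by
    intro k
    rw [iteratedDeriv_eq_iteratedFDeriv]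
    rw [iteratedFDeriv_tsum_apply (N := ⊤) (fun i => (h i 0).1) hv (fun k i x _ => hb k i x) le_top]
    have hs : Summable fun i => iteratedFDeriv ℝ k (f i) y :=
      Summable.of_norm_bounded (hv k le_top) (fun i => hb k i y)
    have := ((ContinuousMultilinearMap.apply ℝ (fun _ : Fin k => ℝ) ℝ (fun _ => (1:ℝ))).hasSum hs.hasSum).tsum_eq
    simp only [ContinuousMultilinearMap.apply_apply] at this
    rw [← this]
    simp only [iteratedDeriv_eq_iteratedFDeriv]
  have hs : ∀ k, Summable fun i => |iteratedDeriv k (f i) y| := fun k =>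
    Summable.of_nonneg_of_le (fun _ => abs_nonneg _) (fun i => (h i y).deriv_le hR k) (hv k le_top)
  refine ⟨hsm, fun N => ?_⟩
  unfold SS
  calc ∑ k ∈ Finset.range N, |iteratedDeriv k (fun x => ∑' i, f i x) y| / cw σ R k
      ≤ ∑ k ∈ Finset.range N, ∑' i, |iteratedDeriv k (f i) y| / cw σ R k := by
        refine Finset.sum_le_sum fun k _ => ?_
        rw [hd, tsum_div_const]
        have hp := cw_pos σ hR k
        gcongr
        have := norm_tsum_le_tsum_norm (f := fun i => iteratedDeriv k (f i) y) (hs k)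
        exact this
    _ = ∑' i, ∑ k ∈ Finset.range N, |iteratedDeriv k (f i) y| / cw σ R k := by
        rw [Summable.tsum_finsetSum]
        intro k _
        exact (hs k).div_const _
    _ ≤ ∑' i, c i := by
        refine Summable.tsum_le_tsum (fun i => (h i y).2 N) ?_ hc
        exact summable_sum fun k _ => (hs k).div_const _

lemma iteratedDeriv_entry {A : ℝ → Fin 2 → Fin 2 → ℝ} (hA : ContDiff ℝ (⊤ : ℕ∞) A) (k : ℕ) (x : ℝ)
    (i j : Fin 2) : iteratedDeriv k A x i j = iteratedDeriv k (fun x => A x i j) x := by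
  let e : (Fin 2 → Fin 2 → ℝ) →L[ℝ] ℝ :=
    (ContinuousLinearMap.proj (R := ℝ) (φ := fun _ : Fin 2 => ℝ) j).comp
      (ContinuousLinearMap.proj (R := ℝ) (φ := fun _ : Fin 2 => Fin 2 → ℝ) i)
  have := e.iteratedFDeriv_comp_left (f := A) (x := x) (i := k) (n := k)
    ((hA.of_le (by exact_mod_cast le_top)).contDiffAt) le_rfl
  rw [iteratedDeriv_eq_iteratedFDeriv, iteratedDeriv_eq_iteratedFDeriv]
  have h2 := congrArg (fun m => m (fun _ => (1:ℝ))) this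
  exact h2.symm

lemma entries_smooth {A : ℝ → Mat2} (h : ∀ i j, Sm (fun x => A x i j)) :
    ContDiff ℝ (⊤ : ℕ∞) A := by
  have : ContDiff ℝ (⊤ : ℕ∞) (fun x => (A x : Fin 2 → Fin 2 → ℝ)) :=
    contDiff_pi.2 fun i => contDiff_pi.2 fun j => h i j
  exact this

lemma entries_norm {A : ℝ → Mat2} (h : ∀ i j, Sm (fun x => A x i j)) (k : ℕ) (x c : ℝ) (hc : 0 ≤ c)
    (hb : ∀ i j, |iteratedDeriv k (fun x => A x i j) x| ≤ c) : ‖iteratedDeriv k A x‖ ≤ c := by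
  rw [Matrix.norm_le_iff hc]
  intro i j
  have := iteratedDeriv_entry (A := A) (entries_smooth h) k x i j
  have e : iteratedDeriv k A x i j = iteratedDeriv k (fun x => A x i j) x := this
  rw [e]
  exact hb i j

lemma k_aux (k : ℕ) : (1 + (k:ℝ) ^ 2) ≤ 2 * 2 ^ k := by
  have h : ∀ k : ℕ, 1 + (k:ℝ) ^ 2 ≤ 2 * 2 ^ k ∧ (k:ℝ) + 1 ≤ 2 ^ k := by
    intro k
    induction k with
    | zero => norm_num
    | succ k ih =>
      obtain ⟨h1, h3⟩ := ih
      push_cast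
      have hk : (0:ℝ) ≤ k := Nat.cast_nonneg k
      rw [pow_succ (2:ℝ)]
      refine ⟨?_, ?_⟩ <;> nlinarith
  exact (h k).1

lemma gevrey_of_sb {s M : ℝ} {A : ℝ → Mat2} (h : ∀ i j y, SB s (1 / 2) (fun x => A x i j) y M) :
    MemGevrey s 1 A ∧ 0 ≤ gevreyNorm s 1 A ∧ gevreyNorm s 1 A ≤ (4 * Real.pi ^ 2 / 3) * (2 * M) := by
  have hM : 0 ≤ M := (h 0 0 0).nonneg
  have hs : ∀ i j, Sm (fun x => A x i j) := fun i j => (h i j 0).1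
  have hR : (0:ℝ) < 1 / 2 := by norm_num
  have hb : ∀ k x, ‖iteratedDeriv k A x‖ ≤ M * cw s (1/2) k := by
    intro k x
    refine entries_norm hs k x _ (mul_nonneg hM (cw_pos s hR k).le) fun i j => ?_
    exact (h i j x).deriv_le hR k
  have hsd : ∀ k, supDeriv k A ≤ M * cw s (1/2) k := fun k => ciSup_le (hb k)
  have hsd0 : ∀ k, 0 ≤ supDeriv k A := fun k => Real.iSup_nonneg fun x => norm_nonneg _
  have hg0 : ∀ k, 0 ≤ gevreySeq s 1 A k := by
    intro k
    unfold gevreySeq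
    have := hsd0 k
    positivity
  have hg : ∀ k, gevreySeq s 1 A k ≤ 2 * M := by
    intro k
    unfold gevreySeq
    rw [div_le_iff₀ (by positivity)]
    have h1 := k_aux k
    calc (1 + (k:ℝ) ^ 2) * supDeriv k A ≤ (2 * 2 ^ k) * (M * cw s (1/2) k) := by
          gcongr
          · exact hsd0 k
          · exact hsd k
      _ = _ := by
          unfold cw
          rw [one_pow, one_div, inv_pow]
          have : (2:ℝ) ^ k ≠ 0 := by positivity
          field_simp
  refine ⟨⟨entries_smooth hs, fun k => ⟨_, by rintro _ ⟨x, rfl⟩; exact hb k x⟩,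
    ⟨_, by rintro _ ⟨k, rfl⟩; exact hg k⟩⟩, ?_, ?_⟩
  · unfold gevreyNorm
    have : 0 ≤ ⨆ k, gevreySeq s 1 A k := Real.iSup_nonneg hg0
    positivity
  · unfold gevreyNorm
    have : ⨆ k, gevreySeq s 1 A k ≤ 2 * M := ciSup_le hg
    gcongr

namespace Setup
variable (Z : Setup)

def Dinf (x : ℝ) : Mat2 := Matrix.of fun i j => Z.D 0 x i j + ∑' k, (Z.D (k + 1) x i j - Z.D k x i j)

def tail (n : ℕ) : ℝ := Z.dmax * ∑' k, Z.u (k + n)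

lemma tail_tendsto : Tendsto Z.tail atTop (nhds 0) := by
  have := (tendsto_sum_nat_add Z.u).const_mul Z.dmax
  rw [mul_zero] at this
  exact this

lemma DD_summable (x : ℝ) (i j : Fin 2) : Summable fun k => Z.D (k + 1) x i j - Z.D k x i j :=
  Summable.of_norm_bounded (Z.u_summable.mul_left Z.dmax) fun k => (Z.DD_sb k x i j).abs_le

lemma Dinf_sub (n : ℕ) (x : ℝ) (i j : Fin 2) :
    Z.Dinf x i j - Z.D n x i j = ∑' k, (Z.D (k + n + 1) x i j - Z.D (k + n) x i j) := by
  have h := (Z.DD_summable x i j).sum_add_tsum_nat_add n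
  rw [Finset.sum_range_sub (fun k => Z.D k x i j)] at h
  simp only [Dinf, Matrix.of_apply]
  linarith

lemma Dinf_sub_sb (n : ℕ) (y : ℝ) (i j : Fin 2) :
    SB (Z.σ + Z.θ) (1 / 2) (fun x => Z.Dinf x i j - Z.D n x i j) y (Z.tail n) := by
  have h := SB.tsum (σ := Z.σ + Z.θ) (R := 1 / 2) (by norm_num)
    (c := fun k => Z.dmax * Z.u (k + n)) (((summable_nat_add_iff n).2 Z.u_summable).mul_left _)
    (fun k y => Z.DD_sb (k + n) y i j) y
  refine (h.of_eq fun x => Z.Dinf_sub n x i j).mono (le_of_eq ?_)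
  rw [tsum_mul_left]; rfl

lemma Dinf_sb (y : ℝ) (i j : Fin 2) :
    SB (Z.σ + Z.θ) (1 / 2) (fun x => Z.Dinf x i j) y (Z.tail 0 + Z.dmax) := by
  have := (Z.Dinf_sub_sb 0 y i j).add (by norm_num) (Z.D_sb 0 y i j)
  exact this.of_eq fun x => by ring

lemma D_tendsto (x : ℝ) : Tendsto (fun n => Z.D n x) atTop (nhds (Z.Dinf x)) := by
  refine tendsto_pi_nhds.2 fun i => tendsto_pi_nhds.2 fun j => ?_
  rw [tendsto_iff_norm_sub_tendsto_zero]
  refine squeeze_zero (fun _ => norm_nonneg _) (fun n => ?_) Z.tail_tendsto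
  rw [norm_sub_rev]
  exact (Z.Dinf_sub_sb n x i j).abs_le

lemma Dinf_det (x : ℝ) : (Z.Dinf x).det = 1 := by
  have h : Tendsto (fun n => (Z.D n x).det) atTop (nhds (Z.Dinf x).det) :=
    ((Continuous.matrix_det continuous_id).tendsto _).comp (Z.D_tendsto x)
  simp only [D_det] at h
  exact tendsto_nhds_unique h tendsto_const_nhds

lemma periodic_Dinf (x : ℝ) : Z.Dinf (x + 1) = Z.Dinf x := by
  unfold Dinf; simp only [periodic_D]

end Setup

/-! ### Lyapunov exponents -/

lemma opNorm_mul (M N : Mat2) : opNorm (M * N) ≤ opNorm M * opNorm N := by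
  unfold opNorm
  rw [map_mul]; exact norm_mul_le _ _

lemma opNorm_nonneg (M : Mat2) : 0 ≤ opNorm M := norm_nonneg _

lemma opNorm_entry (M : Mat2) (i j : Fin 2) : |M i j| ≤ opNorm M := by
  have h := (Matrix.toEuclideanCLM (𝕜 := ℝ) M).le_opNorm (EuclideanSpace.single j 1)
  rw [EuclideanSpace.norm_single, norm_one, mul_one] at h
  refine le_trans ?_ h
  have h2 := PiLp.norm_apply_le (Matrix.toEuclideanCLM (𝕜 := ℝ) M (EuclideanSpace.single j 1)) i
  refine le_trans (le_of_eq ?_) h2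
  rw [Matrix.ofLp_toEuclideanCLM]
  simp

lemma opNorm_le {M : Mat2} {c : ℝ} (h : ∀ i j, |M i j| ≤ c) : opNorm M ≤ 2 * c := by
  have hc : 0 ≤ c := (abs_nonneg _).trans (h 0 0)
  refine ContinuousLinearMap.opNorm_le_bound _ (by positivity) fun v => ?_
  rw [EuclideanSpace.norm_eq, EuclideanSpace.norm_eq]
  rw [Real.sqrt_le_left (by positivity)]
  rw [mul_pow, Real.sq_sqrt (by positivity)]
  rw [Matrix.ofLp_toEuclideanCLM]
  simp only [Fin.sum_univ_two, Matrix.mulVec, dotProduct, Real.norm_eq_abs, sq_abs]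
  have key : ∀ i, (M i 0 * v.ofLp 0 + M i 1 * v.ofLp 1) ^ 2 ≤ 2 * c ^ 2 * (v.ofLp 0 ^ 2 + v.ofLp 1 ^ 2) := by
    intro i
    have h0 : M i 0 ^ 2 ≤ c ^ 2 := sq_le_sq.2 (by rw [abs_of_nonneg hc]; exact h i 0)
    have h1 : M i 1 ^ 2 ≤ c ^ 2 := sq_le_sq.2 (by rw [abs_of_nonneg hc]; exact h i 1)
    nlinarith [sq_nonneg (M i 0 * v.ofLp 0 - M i 1 * v.ofLp 1), mul_le_mul_of_nonneg_right h0 (sq_nonneg (v.ofLp 0)), mul_le_mul_of_nonneg_right h1 (sq_nonneg (v.ofLp 1))]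
  have := key 0
  have := key 1
  linarith

lemma opNorm_continuous : Continuous opNorm := by
  unfold opNorm
  refine continuous_norm.comp ?_
  exact LinearMap.continuous_of_finiteDimensional
    ((Matrix.toEuclideanCLM (n := Fin 2) (𝕜 := ℝ)).toAlgEquiv.toLinearEquiv.toLinearMap)

lemma opNorm_ge {M : Mat2} (h : M.det = 1) : 1 / 2 ≤ opNorm M := by
  rw [Matrix.det_fin_two] at h
  have h0 := opNorm_nonneg M
  have a := mul_le_mul (opNorm_entry M 0 0) (opNorm_entry M 1 1) (abs_nonneg _) h0
  have b := mul_le_mul (opNorm_entry M 0 1) (opNorm_entry M 1 0) (abs_nonneg _) h0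
  rw [← abs_mul] at a b
  have a' := (le_abs_self _).trans a
  have b' := (neg_abs_le _).trans' (neg_le_neg b)
  nlinarith

lemma opNorm_pos {M : Mat2} (h : M.det = 1) : 0 < opNorm M := by have := opNorm_ge h; linarith

/-- `SL(2,R)` cocycles -/
structure Coc (A : ℝ → Mat2) : Prop where
  cont : Continuous A
  per : ∀ x, A (x + 1) = A x
  det : ∀ x, (A x).det = 1

lemma cocIter_continuous {α : ℝ} {A : ℝ → Mat2} (h : Continuous A) (n : ℕ) : Continuous (cocIter α A n) := by
  induction n with
  | zero => exact continuous_const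
  | succ n ih =>
    have : Continuous fun x => A (x + n * α) * cocIter α A n x :=
      (h.comp (continuous_id.add continuous_const)).matrix_mul ih
    exact this

namespace Coc
variable {α : ℝ} {A : ℝ → Mat2} (hA : Coc A)

lemma iter_per (h : Coc A) (n : ℕ) (x : ℝ) : cocIter α A n (x + 1) = cocIter α A n x := by
  induction n with
  | zero => rfl
  | succ n ih => simp only [cocIter]; rw [ih, add_right_comm, h.per]

lemma iter_det (h : Coc A) (n : ℕ) (x : ℝ) : (cocIter α A n x).det = 1 := by
  induction n with
  | zero => simp [cocIter]
  | succ n ih => simp only [cocIter]; rw [Matrix.det_mul, ih, h.det, one_mul]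

end Coc

lemma cocIter_add (α : ℝ) (A : ℝ → Mat2) (m n : ℕ) (x : ℝ) :
    cocIter α A (m + n) x = cocIter α A m (x + n * α) * cocIter α A n x := by
  induction m with
  | zero => simp [cocIter]
  | succ m ih =>
    rw [show m + 1 + n = (m + n) + 1 by ring]
    simp only [cocIter]
    rw [ih, ← Matrix.mul_assoc]
    congr 3; push_cast; ring

def uI (α : ℝ) (A : ℝ → Mat2) (n : ℕ) : ℝ := ∫ x in (0 : ℝ)..1, Real.log (opNorm (cocIter α A n x))

lemma integral_shift {f : ℝ → ℝ} (hf : ∀ x, f (x + 1) = f x) (c : ℝ) :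
    ∫ x in (0:ℝ)..1, f (x + c) = ∫ x in (0:ℝ)..1, f x := by
  rw [intervalIntegral.integral_comp_add_right]
  have hp : Function.Periodic f 1 := hf
  have := hp.intervalIntegral_add_eq (0 + c) 0
  rw [show (1:ℝ) + c = 0 + c + 1 by ring, this, zero_add]

namespace Coc
variable {α : ℝ} {A : ℝ → Mat2}

lemma log_cont (h : Coc A) (n : ℕ) : Continuous fun x => Real.log (opNorm (cocIter α A n x)) :=
  (opNorm_continuous.comp (cocIter_continuous h.cont n)).log fun x => (opNorm_pos (h.iter_det n x)).ne'

lemma subadd (h : Coc A) : Subadditive (uI α A) := by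
  intro m n
  unfold uI
  have hs := integral_shift (f := fun x => Real.log (opNorm (cocIter α A m x)))
    (fun x => by simp only [h.iter_per]) (n * α)
  rw [← hs, ← intervalIntegral.integral_add]
  · refine intervalIntegral.integral_mono_on zero_le_one ((h.log_cont _).intervalIntegrable _ _) ?_ ?_
    · exact Continuous.intervalIntegrable (((h.log_cont (α := α) m).comp (continuous_id.add continuous_const)).add (h.log_cont n)) _ _
    · intro x _
      rw [cocIter_add, ← Real.log_mul (opNorm_pos (h.iter_det _ _)).ne' (opNorm_pos (h.iter_det _ _)).ne']
      refine Real.log_le_log ?_ (opNorm_mul _ _)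
      exact opNorm_pos (by rw [Matrix.det_mul, h.iter_det, h.iter_det, one_mul])
  · exact Continuous.intervalIntegrable ((h.log_cont (α := α) m).comp (continuous_id.add continuous_const)) _ _
  · exact (h.log_cont _).intervalIntegrable _ _

lemma uI_ge_of (h : Coc A) (n : ℕ) {c : ℝ} (hc : ∀ x, c ≤ Real.log (opNorm (cocIter α A n x))) : c ≤ uI α A n := by
  have : ∫ x in (0:ℝ)..1, c ≤ uI α A n :=
    intervalIntegral.integral_mono_on zero_le_one (continuous_const.intervalIntegrable _ _)
      ((h.log_cont _).intervalIntegrable _ _) fun x _ => hc x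
  simpa using this

lemma log_ge (h : Coc A) (n : ℕ) (x : ℝ) : -Real.log 2 ≤ Real.log (opNorm (cocIter α A n x)) := by
  rw [← Real.log_inv]
  refine Real.log_le_log (by norm_num) ?_
  have := opNorm_ge (h.iter_det (α := α) n x)
  rwa [one_div] at this

lemma bdd (h : Coc A) : BddBelow (Set.range fun n : ℕ => uI α A n / n) := by
  refine ⟨-Real.log 2, ?_⟩
  rintro _ ⟨n, rfl⟩
  have hl : 0 < Real.log 2 := Real.log_pos (by norm_num)
  have := h.uI_ge_of n (h.log_ge (α := α) n)
  rcases Nat.eq_zero_or_pos n with rfl | hn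
  · simp [hl.le]
  · have hn' : (1:ℝ) ≤ n := by exact_mod_cast hn
    show _ ≤ uI α A n / n
    rw [le_div_iff₀ (by linarith)]
    nlinarith

lemma tendsto_lyap (h : Coc A) : Tendsto (fun n : ℕ => uI α A n / n) atTop (nhds (lyap α A)) := by
  have h1 := h.subadd.tendsto_lim h.bdd (u := uI α A)
  have e : lyap α A = (h.subadd (α := α)).lim := by
    unfold lyap
    refine Tendsto.limsup_eq ?_
    refine h1.congr fun n => ?_
    unfold uI; rw [div_eq_inv_mul]
  rw [e]; exact h1

lemma lyap_le (h : Coc A) {n : ℕ} (hn : n ≠ 0) : lyap α A ≤ uI α A n / n := by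
  have e := tendsto_nhds_unique (h.tendsto_lyap (α := α)) (h.subadd.tendsto_lim h.bdd)
  rw [e]
  exact h.subadd.lim_le_div h.bdd hn

lemma lyap_ge (h : Coc A) : -Real.log 2 ≤ lyap α A := by
  refine ge_of_tendsto (h.tendsto_lyap (α := α)) ?_
  filter_upwards [eventually_ge_atTop 1] with n hn
  have hn' : (1:ℝ) ≤ n := by exact_mod_cast hn
  have hl : 0 < Real.log 2 := Real.log_pos (by norm_num)
  have := h.uI_ge_of n (h.log_ge (α := α) n)
  rw [le_div_iff₀ (by linarith)]
  nlinarith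

end Coc

lemma cocIter_conj {α : ℝ} {A L B BI : ℝ → Mat2} (h : ∀ x, A x = B (x + α) * L x * BI x)
    (hB : ∀ x, BI x * B x = 1) (n : ℕ) (x : ℝ) :
    cocIter α A n x * B x = B (x + n * α) * cocIter α L n x := by
  induction n with
  | zero => simp [cocIter]
  | succ n ih =>
    simp only [cocIter]
    rw [Matrix.mul_assoc, ih, h, Matrix.mul_assoc _ (BI _), ← Matrix.mul_assoc (BI _), hB, one_mul,
      Matrix.mul_assoc]
    congr 2; push_cast; ring

namespace Setup
variable (Z : Setup)

def pa (n k : ℕ) (x : ℝ) : ℝ := ∏ i ∈ Finset.range k, lam * Z.w n (x + i * Z.α)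
def pd (n k : ℕ) (x : ℝ) : ℝ := ∏ i ∈ Finset.range k, lam⁻¹ * Z.wi n (x + i * Z.α)

lemma cocIter_Lm (n k : ℕ) (x : ℝ) : cocIter Z.α (Z.Lm n) k x = !![Z.pa n k x, 0; 0, Z.pd n k x] := by
  induction k with
  | zero => simp [cocIter, pa, pd, Matrix.one_fin_two]
  | succ k ih =>
    simp only [cocIter, Lm]
    rw [ih]
    unfold pa pd
    rw [Finset.prod_range_succ, Finset.prod_range_succ]
    ext i j; fin_cases i <;> fin_cases j <;> simp [Matrix.mul_apply, Fin.sum_univ_two] <;> ring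

lemma pa_nonneg (n k : ℕ) (x : ℝ) : 0 ≤ Z.pa n k x :=
  Finset.prod_nonneg fun i _ => mul_nonneg lam_pos.le (Z.w_pos n _).le

lemma pd_nonneg (n k : ℕ) (x : ℝ) : 0 ≤ Z.pd n k x :=
  Finset.prod_nonneg fun i _ => mul_nonneg (inv_pos.2 lam_pos).le (Z.wi_pos n _).le

lemma pa_le (n k : ℕ) (x : ℝ) : Z.pa n k x ≤ lam ^ k := by
  calc Z.pa n k x ≤ ∏ i ∈ Finset.range k, lam := by
        refine Finset.prod_le_prod (fun i _ => mul_nonneg lam_pos.le (Z.w_pos n _).le) fun i _ => ?_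
        have := Z.w_le_one n (x + i * Z.α)
        have := lam_pos
        nlinarith
    _ = _ := by simp

lemma pd_le (n k : ℕ) (x : ℝ) : Z.pd n k x ≤ lam⁻¹ ^ k * 2 ^ (k + Z.X n) := by
  have hl := inv_pos.2 lam_pos
  calc Z.pd n k x ≤ ∏ i ∈ Finset.range k, lam⁻¹ * 2 ^ Z.V n (x + i * Z.α) := by
        refine Finset.prod_le_prod (fun i _ => mul_nonneg hl.le (Z.wi_pos n _).le) fun i _ => ?_
        exact mul_le_mul_of_nonneg_left (Z.wi_bd n _).2 hl.le
    _ = lam⁻¹ ^ k * 2 ^ (∑ i ∈ Finset.range k, Z.V n (x + i * Z.α)) := by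
        rw [Finset.prod_mul_distrib, Finset.prod_pow_eq_pow_sum]; simp
    _ ≤ _ := by
        have := Z.star n k x
        gcongr
        norm_num

lemma pa_pd (n k : ℕ) (x : ℝ) : Z.pa n k x * Z.pd n k x = 1 := by
  unfold pa pd
  rw [← Finset.prod_mul_distrib]
  refine Finset.prod_eq_one fun i _ => ?_
  have := Z.w_wi n (x + i * Z.α)
  have h := lam_ne
  field_simp
  linarith

lemma pa_ge (n k : ℕ) (x : ℝ) : lam ^ k / 2 ^ (k + Z.X n) ≤ Z.pa n k x := by
  have h1 := Z.pa_pd n k x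
  have h2 := Z.pd_le n k x
  have h3 := Z.pa_nonneg n k x
  have h4 : 1 ≤ Z.pa n k x * (lam⁻¹ ^ k * 2 ^ (k + Z.X n)) := by
    rw [← h1]; exact mul_le_mul_of_nonneg_left h2 h3
  have hl := lam_pos
  rw [div_le_iff₀ (by positivity)]
  rw [inv_pow, inv_mul_eq_div, ← mul_div_assoc, le_div_iff₀ (by positivity)] at h4
  linarith

/-- frame size -/
def cB (n : ℕ) : ℝ := 2 * 27 ^ (4 * Z.X n)

lemma cB_pos (n : ℕ) : 0 < Z.cB n := by unfold cB; positivity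

lemma B_op (n : ℕ) (x : ℝ) : opNorm (Z.B n x) ≤ Z.cB n := opNorm_le fun i j => (Z.B_sb n x i j).abs_le
lemma BI_op (n : ℕ) (x : ℝ) : opNorm (Z.BI n x) ≤ Z.cB n := opNorm_le fun i j => (Z.BI_sb n x i j).abs_le

lemma D_smooth (n : ℕ) : ContDiff ℝ (⊤ : ℕ∞) (Z.D n) := entries_smooth fun i j => (Z.D_sb n 0 i j).1

lemma D_coc (n : ℕ) : Coc (Z.D n) := ⟨(Z.D_smooth n).continuous, Z.periodic_D n, Z.D_det n⟩

lemma Dinf_coc : Coc Z.Dinf :=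
  ⟨(entries_smooth fun i j => (Z.Dinf_sb 0 i j).1).continuous, Z.periodic_Dinf, Z.Dinf_det⟩

lemma log_D_ge (n k : ℕ) (x : ℝ) : k * (Real.log lam - Real.log 2) - (Z.X n * Real.log 2 + 2 * Real.log (Z.cB n))
    ≤ Real.log (opNorm (cocIter Z.α (Z.D n) k x)) := by
  have h1 := cocIter_conj (α := Z.α) (A := Z.D n) (L := Z.Lm n) (B := Z.B n) (BI := Z.BI n)
    (fun x => rfl) (Z.BI_B n) k x
  have h2 : cocIter Z.α (Z.Lm n) k x = Z.BI n (x + k * Z.α) * (cocIter Z.α (Z.D n) k x * Z.B n x) := by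
    rw [h1, ← Matrix.mul_assoc, BI_B, one_mul]
  have h3 : Z.pa n k x ≤ Z.cB n * (opNorm (cocIter Z.α (Z.D n) k x) * Z.cB n) := by
    have e := opNorm_entry (cocIter Z.α (Z.Lm n) k x) 0 0
    rw [cocIter_Lm] at e
    simp only [Matrix.of_apply, Matrix.cons_val', Matrix.cons_val_zero] at e
    refine (le_abs_self _).trans (e.trans ?_)
    rw [← cocIter_Lm, h2]
    refine (opNorm_mul _ _).trans ?_
    refine mul_le_mul (Z.BI_op n _) ((opNorm_mul _ _).trans ?_) (opNorm_nonneg _) (Z.cB_pos n).le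
    exact mul_le_mul_of_nonneg_left (Z.B_op n x) (opNorm_nonneg _)
  have h4 := (Z.pa_ge n k x).trans h3
  have hl := lam_pos
  have hp := opNorm_pos ((Z.D_coc n).iter_det (α := Z.α) k x)
  have hc := Z.cB_pos n
  have h5 := Real.log_le_log (by positivity) h4
  rw [Real.log_div (by positivity) (by positivity), Real.log_mul hc.ne' (by positivity),
    Real.log_mul hp.ne' hc.ne', Real.log_pow, Real.log_pow] at h5
  push_cast at h5
  linarith

lemma lyap_D_ge (n : ℕ) : Real.log lam - Real.log 2 ≤ lyap Z.α (Z.D n) := by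
  have h1 := (Z.D_coc n).tendsto_lyap (α := Z.α)
  set C := Z.X n * Real.log 2 + 2 * Real.log (Z.cB n) with hC
  have h2 : Tendsto (fun k : ℕ => (Real.log lam - Real.log 2) - C / k) atTop
      (nhds (Real.log lam - Real.log 2 - 0)) :=
    tendsto_const_nhds.sub (tendsto_const_div_atTop_nhds_zero_nat C)
  rw [sub_zero] at h2
  refine le_of_tendsto_of_tendsto h2 h1 ?_
  filter_upwards [eventually_ge_atTop 1] with k hk
  have hk' : (1:ℝ) ≤ k := by exact_mod_cast hk
  have := (Z.D_coc n).uI_ge_of (α := Z.α) k (Z.log_D_ge n k)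
  rw [le_div_iff₀ (by linarith), sub_mul, div_mul_cancel₀ _ (by linarith)]
  linarith

lemma iter_tendsto (k : ℕ) (x : ℝ) : Tendsto (fun n => cocIter Z.α (Z.D n) k x) atTop
    (nhds (cocIter Z.α Z.Dinf k x)) := by
  induction k with
  | zero => exact tendsto_const_nhds
  | succ k ih =>
    simp only [cocIter]
    have hc : Continuous fun p : Mat2 × Mat2 => p.1 * p.2 := continuous_fst.matrix_mul continuous_snd
    exact (hc.tendsto _).comp ((Z.D_tendsto (x + k * Z.α)).prodMk_nhds ih)

lemma iter_op_le (n k : ℕ) (x : ℝ) : opNorm (cocIter Z.α (Z.D n) k x) ≤ 2 * (2 * Z.dmax) ^ k := by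
  have hd := Z.dmax_ge
  induction k with
  | zero =>
    have : opNorm (1 : Mat2) ≤ 2 * 1 := opNorm_le fun i j => by
      fin_cases i <;> fin_cases j <;> simp
    simpa [cocIter] using this
  | succ k ih =>
    simp only [cocIter]
    refine (opNorm_mul _ _).trans ?_
    have := mul_le_mul (opNorm_le fun i j => (Z.D_sb n (x + k * Z.α) i j).abs_le) ih (opNorm_nonneg _) (by linarith)
    refine this.trans (le_of_eq ?_)
    ring

lemma uI_tendsto (k : ℕ) : Tendsto (fun n => uI Z.α (Z.D n) k) atTop (nhds (uI Z.α Z.Dinf k)) := by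
  unfold uI
  have hd := Z.dmax_ge
  set b := max (Real.log 2) (Real.log (2 * (2 * Z.dmax) ^ k))
  refine intervalIntegral.tendsto_integral_filter_of_dominated_convergence (fun _ => b) ?_ ?_ ?_ ?_
  · exact Eventually.of_forall fun n => ((Z.D_coc n).log_cont k).aestronglyMeasurable
  · refine Eventually.of_forall fun n => Eventually.of_forall fun x _ => ?_
    rw [Real.norm_eq_abs, abs_le]
    constructor
    · have := (Z.D_coc n).log_ge (α := Z.α) k x
      have := le_max_left (Real.log 2) (Real.log (2 * (2 * Z.dmax) ^ k))
      linarith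
    · exact (Real.log_le_log (opNorm_pos ((Z.D_coc n).iter_det k x)) (Z.iter_op_le n k x)).trans (le_max_right _ _)
  · exact intervalIntegrable_const
  · refine Eventually.of_forall fun x _ => ?_
    have h := (opNorm_continuous.tendsto _).comp (Z.iter_tendsto k x)
    exact h.log (opNorm_pos (Z.Dinf_coc.iter_det k x)).ne'

lemma lyap_Dinf_ge : Real.log lam - Real.log 2 ≤ lyap Z.α Z.Dinf := by
  refine ge_of_tendsto (Z.Dinf_coc.tendsto_lyap (α := Z.α)) ?_
  filter_upwards [eventually_ge_atTop 1] with k hk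
  refine ge_of_tendsto ((Z.uI_tendsto k).div_const _) ?_
  exact Eventually.of_forall fun n => (Z.lyap_D_ge n).trans ((Z.D_coc n).lyap_le (by omega))

lemma log_lam : Real.log lam = 2000 * Real.log 2 := by
  unfold lam; rw [Real.log_pow]; norm_num

end Setup

/-! ### The perturbations -/

namespace Setup
variable (Z : Setup)

def lq (q : ℕ) : ℝ := 1 / (8 * q)

structure Good (n q : ℕ) : Prop where
  lo : 8 / Z.l n ≤ q
  hi : (q : ℝ) < 8 / Z.l (n + 1)
  ret : ∀ k : ℕ, 0 < k → k < q → 1 / (2 * (q : ℝ)) ≤ nd (k * Z.α)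

def χq (q : ℕ) (x : ℝ) : ℝ := perb Z.χ (lq q) x

def eps (n : ℕ) : ℝ := 2 ^ Z.P / 2 ^ Z.X n

def Aq (n q : ℕ) (x : ℝ) : Mat2 := Z.D n x * (1 + (Z.eps n * Z.χq q x) • E21)

def Gm (n q : ℕ) (x : ℝ) : Mat2 := Z.BI n x * (1 + (Z.eps n * Z.χq q x) • E21) * Z.B n x

lemma Aq_conj (n q : ℕ) (x : ℝ) : Z.Aq n q x = Z.B n (x + Z.α) * (Z.Lm n x * Z.Gm n q x) * Z.BI n x := by
  unfold Aq Gm D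
  have := Z.B_BI n x
  simp only [Matrix.mul_assoc]
  rw [this, Matrix.mul_one]

lemma Gm_out {n q : ℕ} {x : ℝ} (h : Z.χq q x = 0) : Z.Gm n q x = 1 := by
  unfold Gm; rw [h, mul_zero, zero_smul, add_zero, Matrix.mul_one, BI_B]

def bb (n : ℕ) : ℝ := 2 ^ Z.X n / 2 ^ Z.P

lemma P_le_X (n : ℕ) : Z.P ≤ Z.X n := by
  unfold X; exact Nat.le_mul_of_pos_right _ (by positivity)

lemma bb_ge (n : ℕ) : 1 ≤ Z.bb n := by
  unfold bb
  rw [le_div_iff₀ (by positivity), one_mul]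
  exact pow_le_pow_right₀ (by norm_num) (Z.P_le_X n)

lemma bb_le (n : ℕ) : Z.bb n ≤ 2 ^ Z.X n := by
  unfold bb
  exact div_le_self (by positivity) (one_le_pow₀ (by norm_num))

lemma Gm_in {n q : ℕ} {x : ℝ} (h : nd x ≤ Z.l n / 2) :
    Z.Gm n q x = !![1 - Z.χq q x, -(Z.bb n * Z.χq q x); Z.χq q x / Z.bb n, 1 + Z.χq q x] := by
  have hl := Z.hl0 n
  have hw : Z.wi n x = Z.bb n := by
    unfold bb
    rw [eq_div_iff (by positivity)]; exact Z.w_core n h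
  have he : Z.eps n = (Z.bb n)⁻¹ := by unfold eps bb; rw [inv_div]
  have hb : Z.bb n ≠ 0 := by have := Z.bb_ge n; linarith
  unfold Gm
  rw [Z.B_in n (by linarith), Z.BI_in n (by linarith), hw, he]
  have h1 : (1 + ((Z.bb n)⁻¹ * Z.χq q x) • E21) = !![1, 0; (Z.bb n)⁻¹ * Z.χq q x, 1] := by
    unfold E21
    ext i j; fin_cases i <;> fin_cases j <;> simp [Matrix.one_apply]
  rw [h1]
  have hi : Z.bb n * (Z.bb n)⁻¹ = 1 := mul_inv_cancel₀ hb
  ext i j; fin_cases i <;> fin_cases j <;>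
    simp [Matrix.mul_apply, Fin.sum_univ_two, div_eq_mul_inv] <;> grind

lemma χq01 (q : ℕ) (x : ℝ) : 0 ≤ Z.χq q x ∧ Z.χq q x ≤ 1 := Z.hχ01 _

lemma tri {a d a0 d0 c b S : ℝ} (ha : 0 ≤ a) (hd : 0 ≤ d) (ha0 : 0 ≤ a0) (hd0 : 0 ≤ d0)
    (hc : 0 ≤ c) (hc1 : c ≤ 1) (hb : 1 ≤ b) (h1 : (1 - c) * (a * a0) ≤ S) (h2 : b * (a * d0) ≤ S)
    (h3 : d * a0 ≤ S) (h4 : 2 * (d * d0) ≤ S) (i j : Fin 2) :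
    |(!![a, 0; 0, d] * !![1 - c, -(b * c); c / b, 1 + c] * !![a0, 0; 0, d0] : Mat2) i j| ≤ S := by
  have hb0 : 0 < b := by linarith
  have p1 := mul_nonneg ha ha0
  have p2 := mul_nonneg ha hd0
  have p3 := mul_nonneg hd ha0
  have p4 := mul_nonneg hd hd0
  have hcb : 0 ≤ c / b := by positivity
  have hcb1 : c / b ≤ 1 := by rw [div_le_one hb0]; linarith
  fin_cases i <;> fin_cases j <;> simp [Matrix.mul_apply, Fin.sum_univ_two]
  · rw [abs_of_nonneg ha, abs_of_nonneg (by linarith : 0 ≤ 1 - c), abs_of_nonneg ha0]; linarith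
  · rw [abs_of_nonneg ha, abs_of_nonneg hb0.le, abs_of_nonneg hc, abs_of_nonneg hd0]
    have : 0 ≤ b * (a * d0) := by positivity
    nlinarith
  · rw [abs_of_nonneg hd, abs_of_nonneg hcb, abs_of_nonneg ha0]
    nlinarith
  · rw [abs_of_nonneg hd, abs_of_nonneg (by linarith : 0 ≤ 1 + c), abs_of_nonneg hd0]; nlinarith

def Mq (n q : ℕ) (x : ℝ) : Mat2 := Z.Lm n x * Z.Gm n q x

lemma iter_novisit {n q k : ℕ} {x : ℝ} (h : ∀ i < k, Z.χq q (x + i * Z.α) = 0) :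
    cocIter Z.α (Z.Mq n q) k x = cocIter Z.α (Z.Lm n) k x := by
  induction k with
  | zero => rfl
  | succ k ih =>
    simp only [cocIter]
    rw [ih fun i hi => h i (by omega), Mq, Z.Gm_out (h k (by omega)), Matrix.mul_one]

lemma iter_visit {n q i0 k : ℕ} {x : ℝ} (h : ∀ i < i0 + (k + 1), i ≠ i0 → Z.χq q (x + i * Z.α) = 0) :
    cocIter Z.α (Z.Mq n q) (i0 + (k + 1)) x =
      cocIter Z.α (Z.Lm n) (k + 1) (x + i0 * Z.α) * Z.Gm n q (x + i0 * Z.α) * cocIter Z.α (Z.Lm n) i0 x := by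
  rw [show i0 + (k + 1) = (k + 1) + i0 by ring, cocIter_add, cocIter_add, cocIter_add]
  rw [Z.iter_novisit (k := i0) fun i hi => h i (by omega) (by omega)]
  rw [Z.iter_novisit (k := k)]
  · simp only [cocIter, Mq, Nat.cast_zero, zero_mul, add_zero, Matrix.mul_one, Matrix.mul_assoc]
  · intro i hi
    have := h (i0 + 1 + i) (by omega) (by omega)
    rw [← this]; congr 1; push_cast; ring

lemma powcmp {p e q : ℕ} (h : p ≤ e + q) : lam ^ p * lam⁻¹ ^ q ≤ lam ^ e := by
  have hl := lam_pos
  rw [inv_pow, mul_inv_le_iff₀ (by positivity), ← pow_add]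
  exact pow_le_pow_right₀ one_le_lam h

lemma visit_bound {n q i0 k e : ℕ} {x : ℝ} (hx : nd (x + i0 * Z.α) ≤ Z.l n / 2)
    (h : ∀ i < i0 + (k + 1), i ≠ i0 → Z.χq q (x + i * Z.α) = 0)
    (h1 : k + 1 ≤ e + i0) (h2 : i0 ≤ e + (k + 1))
    (h3 : Z.χq q (x + i0 * Z.α) = 1 ∨ i0 + (k + 1) ≤ e) (i j : Fin 2) :
    |cocIter Z.α (Z.Mq n q) (i0 + (k + 1)) x i j| ≤ 2 * 2 ^ (i0 + (k + 1) + 2 * Z.X n) * lam ^ e := by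
  rw [Z.iter_visit h, Z.Gm_in hx, cocIter_Lm, cocIter_Lm]
  have hl := lam_pos
  have hli := inv_pos.2 lam_pos
  have hl1 : lam⁻¹ ≤ 1 := inv_le_one_of_one_le₀ one_le_lam
  have A1 := Z.pa_le n (k + 1) (x + i0 * Z.α)
  have A2 := Z.pa_le n i0 x
  have D1 := Z.pd_le n (k + 1) (x + i0 * Z.α)
  have D2 := Z.pd_le n i0 x
  have a1 := Z.pa_nonneg n (k + 1) (x + i0 * Z.α)
  have a2 := Z.pa_nonneg n i0 x
  have d1 := Z.pd_nonneg n (k + 1) (x + i0 * Z.α)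
  have d2 := Z.pd_nonneg n i0 x
  have hb := Z.bb_ge n
  have hb2 := Z.bb_le n
  set a := Z.pa n (k + 1) (x + i0 * Z.α)
  set a0 := Z.pa n i0 x
  set d := Z.pd n (k + 1) (x + i0 * Z.α)
  set d0 := Z.pd n i0 x
  set X := Z.X n
  have hc := Z.χq01 q (x + i0 * Z.α)
  set c := Z.χq q (x + i0 * Z.α)
  have hS : (1:ℝ) ≤ 2 * 2 ^ (i0 + (k + 1) + 2 * X) := by
    have : (1:ℝ) ≤ 2 ^ (i0 + (k + 1) + 2 * X) := one_le_pow₀ (by norm_num)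
    linarith
  have hle : 1 ≤ lam ^ e := one_le_pow₀ one_le_lam
  refine tri a1 d1 a2 d2 hc.1 hc.2 hb ?_ ?_ ?_ ?_ i j
  · rcases h3 with h3 | h3
    · rw [h3]; simp; positivity
    · have : a * a0 ≤ lam ^ e := by
        calc a * a0 ≤ lam ^ (k + 1) * lam ^ i0 := by gcongr
          _ = lam ^ (i0 + (k + 1)) := by rw [← pow_add]; congr 1; ring
          _ ≤ _ := pow_le_pow_right₀ one_le_lam h3
      have h0 := mul_nonneg a1 a2
      nlinarith
  · calc Z.bb n * (a * d0) ≤ 2 ^ X * (lam ^ (k + 1) * (lam⁻¹ ^ i0 * 2 ^ (i0 + X))) := by gcongr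
      _ = 2 ^ (i0 + 2 * X) * (lam ^ (k + 1) * lam⁻¹ ^ i0) := by ring
      _ ≤ 2 * 2 ^ (i0 + (k + 1) + 2 * X) * lam ^ e := by
          have := powcmp h1
          have h5 : (2:ℝ) ^ (i0 + 2 * X) ≤ 2 ^ (i0 + (k + 1) + 2 * X) := pow_le_pow_right₀ (by norm_num) (by omega)
          have h6 : (0:ℝ) < 2 ^ (i0 + 2 * X) := by positivity
          refine mul_le_mul (by linarith) this (by positivity) (by positivity)
  · calc d * a0 ≤ (lam⁻¹ ^ (k + 1) * 2 ^ (k + 1 + X)) * lam ^ i0 := by gcongr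
      _ = 2 ^ (k + 1 + X) * (lam ^ i0 * lam⁻¹ ^ (k + 1)) := by ring
      _ ≤ 2 * 2 ^ (i0 + (k + 1) + 2 * X) * lam ^ e := by
          have := powcmp h2
          have h5 : (2:ℝ) ^ (k + 1 + X) ≤ 2 ^ (i0 + (k + 1) + 2 * X) := pow_le_pow_right₀ (by norm_num) (by omega)
          have h6 : (0:ℝ) < 2 ^ (k + 1 + X) := by positivity
          refine mul_le_mul (by linarith) this (by positivity) (by positivity)
  · calc 2 * (d * d0) ≤ 2 * ((1 * 2 ^ (k + 1 + X)) * (1 * 2 ^ (i0 + X))) := by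
          have e1 : lam⁻¹ ^ (k + 1) ≤ 1 := pow_le_one₀ hli.le hl1
          have e2 : lam⁻¹ ^ i0 ≤ 1 := pow_le_one₀ hli.le hl1
          have f1 : d ≤ 1 * 2 ^ (k + 1 + X) := D1.trans (by gcongr)
          have f2 : d0 ≤ 1 * 2 ^ (i0 + X) := D2.trans (by gcongr)
          gcongr
      _ = 2 * 2 ^ (i0 + (k + 1) + 2 * X) * 1 := by ring
      _ ≤ _ := by gcongr

lemma novisit_bound {n q N : ℕ} {x : ℝ} (h : ∀ i < N, Z.χq q (x + i * Z.α) = 0) (i j : Fin 2) :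
    |cocIter Z.α (Z.Mq n q) N x i j| ≤ 2 * 2 ^ (N + 2 * Z.X n) * lam ^ N := by
  rw [Z.iter_novisit h, cocIter_Lm]
  have hl := lam_pos
  have hli := inv_pos.2 lam_pos
  have hl1 : lam⁻¹ ≤ 1 := inv_le_one_of_one_le₀ one_le_lam
  have A2 := Z.pa_le n N x
  have D2 := Z.pd_le n N x
  have a2 := Z.pa_nonneg n N x
  have d2 := Z.pd_nonneg n N x
  have hS : (1:ℝ) ≤ 2 ^ (N + 2 * Z.X n) := one_le_pow₀ (by norm_num)
  have hle : 1 ≤ lam ^ N := one_le_pow₀ one_le_lam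
  have h0 : 0 ≤ 2 * 2 ^ (N + 2 * Z.X n) * lam ^ N := by positivity
  fin_cases i <;> fin_cases j <;> simp <;> try exact h0
  · rw [abs_of_nonneg a2]; nlinarith
  · positivity
  · positivity
  · rw [abs_of_nonneg d2]
    calc _ ≤ _ := D2
      _ ≤ 1 * 2 ^ (N + 2 * Z.X n) := by
          gcongr
          · exact pow_le_one₀ hli.le hl1
          · norm_num
          · omega
      _ ≤ _ := by nlinarith

section
variable {Z}
variable {n q : ℕ} (hg : Z.Good n q)

lemma Good.q64 (hg : Z.Good n q) : (64:ℝ) ≤ q := by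
  refine le_trans ?_ hg.lo
  rw [le_div_iff₀ (Z.hl0 n)]
  have := Z.hl1 n
  linarith

lemma Good.lq_pos (hg : Z.Good n q) : 0 < lq q := by
  have := hg.q64
  unfold lq; positivity

lemma Good.lq_le (hg : Z.Good n q) : lq q ≤ Z.l n / 64 := by
  have h := hg.lo
  have hl := Z.hl0 n
  have hq := hg.q64
  rw [div_le_iff₀ hl] at h
  unfold lq
  rw [div_le_div_iff₀ (by positivity) (by norm_num)]
  nlinarith

lemma Good.lq_small (hg : Z.Good n q) : lq q ≤ 1 / 4 := by
  have := hg.lq_le; have := Z.hl1 n; linarith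

lemma Good.supp (hg : Z.Good n q) {x : ℝ} (h : Z.χq q x ≠ 0) : nd x < lq q := by
  by_contra hc
  exact h (perb_out hg.lq_pos Z.hχ0 (not_lt.1 hc))

lemma Good.uniq (hg : Z.Good n q) {x : ℝ} {i i' : ℕ} (hi : i < q) (hi' : i' < q)
    (h : Z.χq q (x + i * Z.α) ≠ 0) (h' : Z.χq q (x + i' * Z.α) ≠ 0) : i = i' := by
  have key : ∀ i i' : ℕ, i < i' → i' < q → Z.χq q (x + i * Z.α) ≠ 0 → Z.χq q (x + i' * Z.α) ≠ 0 → False := by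
    intro i i' hlt hi' h h'
    have a := hg.supp h
    have b := hg.supp h'
    have c := hg.ret (i' - i) (by omega) (by omega)
    have e : ((i' - i : ℕ) : ℝ) * Z.α = (x + i' * Z.α) - (x + i * Z.α) := by
      rw [Nat.cast_sub hlt.le]; ring
    rw [e] at c
    have d := nd_sub (x + i' * Z.α) (x + i * Z.α)
    have hq := hg.q64
    have : 1 / (2 * (q:ℝ)) = 4 * lq q := by unfold lq; field_simp; norm_num
    have := hg.lq_pos
    linarith
  rcases lt_trichotomy i i' with hh | hh | hh
  · exact (key i i' hh hi' h h').elim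
  · exact hh
  · exact (key i' i hh hi h' h).elim
end

/-- inner bump -/
def gq (q : ℕ) (x : ℝ) : ℝ := perb Z.χ (lq q / 2) x

def fq (q m : ℕ) (x : ℝ) : ℝ := ∑ i ∈ Finset.range (2 * m), Z.gq q (x + ((m + i : ℕ) : ℝ) * Z.α)

lemma Good.g_supp {Z : Setup} {n q : ℕ} (hg : Z.Good n q) {x : ℝ} (h : Z.gq q x ≠ 0) : Z.χq q x = 1 := by
  have hp := hg.lq_pos
  have : nd x < lq q / 2 := by
    by_contra hc
    exact h (perb_out (by linarith) Z.hχ0 (not_lt.1 hc))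
  exact perb_in hp Z.hχ1 this.le

lemma g01 (q : ℕ) (x : ℝ) : 0 ≤ Z.gq q x ∧ Z.gq q x ≤ 1 := Z.hχ01 _

lemma Good.entry {Z : Setup} {n q : ℕ} (hg : Z.Good n q) {m : ℕ} (hm : 4 * m ≤ q) (x : ℝ) :
    ∃ e : ℕ, (∀ i j, |cocIter Z.α (Z.Mq n q) (4 * m) x i j| ≤ 2 * 2 ^ (4 * m + 2 * Z.X n) * lam ^ e) ∧
      (e : ℝ) ≤ 4 * m - 2 * m * Z.fq q m x := by
  have zero_of : (∀ i : ℕ, m ≤ i → i < 3 * m → Z.χq q (x + i * Z.α) ≠ 1) → Z.fq q m x = 0 := by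
    intro h
    refine Finset.sum_eq_zero fun i hi => ?_
    rw [Finset.mem_range] at hi
    by_contra hc
    exact h (m + i) (by omega) (by omega) (hg.g_supp hc)
  by_cases hv : ∀ i < 4 * m, Z.χq q (x + i * Z.α) = 0
  · refine ⟨4 * m, Z.novisit_bound hv, ?_⟩
    rw [zero_of]
    · push_cast; linarith
    · intro i _ hi
      rw [hv i (by omega)]; norm_num
  · push Not at hv
    obtain ⟨i0, hi0, hne⟩ := hv
    obtain ⟨k, hk⟩ : ∃ k, 4 * m = i0 + (k + 1) := ⟨4 * m - i0 - 1, by omega⟩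
    have hx : nd (x + i0 * Z.α) ≤ Z.l n / 2 := by
      have := hg.supp hne; have := hg.lq_le; have := Z.hl0 n; linarith
    have hz : ∀ i < i0 + (k + 1), i ≠ i0 → Z.χq q (x + i * Z.α) = 0 := by
      intro i hi hii
      by_contra hc
      exact hii (hg.uniq (by omega) (by omega) hc hne)
    by_cases hs : Z.χq q (x + i0 * Z.α) = 1 ∧ m ≤ i0 ∧ i0 < 3 * m
    · refine ⟨2 * m, ?_, ?_⟩
      · rw [hk]; exact Z.visit_bound hx hz (by omega) (by omega) (Or.inl hs.1)
      · have : Z.fq q m x ≤ 1 := by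
          unfold fq
          rw [Finset.sum_eq_single_of_mem (i0 - m) (Finset.mem_range.2 (by omega))]
          · exact (Z.g01 q _).2
          · intro i hi hne'
            rw [Finset.mem_range] at hi
            by_contra hc
            have h1 := hg.g_supp hc
            have := hz (m + i) (by omega) (by omega)
            rw [this] at h1; norm_num at h1
        push_cast
        have hm0 : (0:ℝ) ≤ m := Nat.cast_nonneg m
        nlinarith
    · refine ⟨4 * m, ?_, ?_⟩
      · rw [hk]; exact Z.visit_bound hx hz (by omega) (by omega) (Or.inr (by omega))
      · rw [zero_of]
        · push_cast; linarith
        · intro i h1 h2 hc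
          by_cases hii : i = i0
          · subst hii; exact hs ⟨hc, h1, h2⟩
          · rw [hz i (by omega) hii] at hc; norm_num at hc

lemma Good.Aq_coc {Z : Setup} {n q : ℕ} (hg : Z.Good n q) : Coc (Z.Aq n q) := by
  have hs : Sm (perb Z.χ (lq q)) := perb_smooth hg.lq_pos hg.lq_small Z.hχ0 (Z.hχs 0).1
  refine ⟨?_, ?_, ?_⟩
  · have hc : Continuous (Z.χq q) := hs.continuous
    have : Continuous fun x => Z.D n x * (1 + (Z.eps n * Z.χq q x) • E21) :=
      (Z.D_coc n).cont.matrix_mul (continuous_const.add ((continuous_const.mul hc).smul continuous_const))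
    exact this
  · intro x
    unfold Aq χq; rw [periodic_D, perb_periodic]
  · intro x
    unfold Aq
    rw [Matrix.det_mul, D_det, one_mul, Matrix.det_fin_two]
    simp [E21]

lemma Good.log_le {Z : Setup} {n q : ℕ} (hg : Z.Good n q) {m : ℕ} (hm : 4 * m ≤ q) (x : ℝ) :
    Real.log (opNorm (cocIter Z.α (Z.Aq n q) (4 * m) x)) ≤
      (2 * Real.log (Z.cB n) + (2 + 4 * m + 2 * Z.X n) * Real.log 2)
        + Real.log lam * (4 * m - 2 * m * Z.fq q m x) := by
  obtain ⟨e, he1, he2⟩ := hg.entry hm x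
  have hl := lam_pos
  have hc := Z.cB_pos n
  have h1 := cocIter_conj (α := Z.α) (A := Z.Aq n q) (L := Z.Mq n q) (B := Z.B n) (BI := Z.BI n)
    (Z.Aq_conj n q) (Z.BI_B n) (4 * m) x
  have h2 : cocIter Z.α (Z.Aq n q) (4 * m) x =
      Z.B n (x + (4 * m : ℕ) * Z.α) * cocIter Z.α (Z.Mq n q) (4 * m) x * Z.BI n x := by
    rw [← h1, Matrix.mul_assoc, B_BI, Matrix.mul_one]
  have h3 := opNorm_le he1
  have h4 : opNorm (cocIter Z.α (Z.Aq n q) (4 * m) x) ≤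
      Z.cB n * (2 * (2 * 2 ^ (4 * m + 2 * Z.X n) * lam ^ e)) * Z.cB n := by
    rw [h2]
    refine (opNorm_mul _ _).trans ?_
    refine mul_le_mul ((opNorm_mul _ _).trans ?_) (Z.BI_op n x) (opNorm_nonneg _) (by positivity)
    exact mul_le_mul (Z.B_op n _) h3 (opNorm_nonneg _) hc.le
  have h5 := Real.log_le_log (opNorm_pos (hg.Aq_coc.iter_det (α := Z.α) (4 * m) x)) h4
  rw [Real.log_mul (by positivity) hc.ne', Real.log_mul hc.ne' (by positivity),
    Real.log_mul (by norm_num) (by positivity), Real.log_mul (by positivity) (by positivity),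
    Real.log_mul (by norm_num) (by positivity), Real.log_pow, Real.log_pow] at h5
  have h6 : 0 ≤ Real.log lam := Real.log_nonneg one_le_lam
  have h7 := mul_le_mul_of_nonneg_left he2 h6
  push_cast at h5
  linarith

lemma Good.g_cont {Z : Setup} {n q : ℕ} (hg : Z.Good n q) : Continuous (Z.gq q) := by
  have h1 := hg.lq_pos
  have h2 := hg.lq_small
  have : Sm (perb Z.χ (lq q / 2)) := perb_smooth (by linarith) (by linarith) Z.hχ0 (Z.hχs 0).1
  exact this.continuous

lemma Good.g_int {Z : Setup} {n q : ℕ} (hg : Z.Good n q) : lq q / 2 ≤ ∫ x in (0:ℝ)..1, Z.gq q x := by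
  have h1 := hg.lq_pos
  have h2 := hg.lq_small
  have hp : Function.Periodic (Z.gq q) 1 := fun x => perb_periodic _ _ x
  have e := hp.intervalIntegral_add_eq 0 (-(1/2))
  rw [zero_add] at e
  rw [e]
  have h3 : ∫ x in (-(lq q / 4))..(lq q / 4), Z.gq q x = lq q / 2 := by
    rw [intervalIntegral.integral_congr (g := fun _ => (1:ℝ))]
    · simp; ring
    · intro x hx
      rw [Set.uIcc_of_le (by linarith)] at hx
      refine perb_in (by linarith) Z.hχ1 ?_
      have := nd_le x 0
      simp only [Int.cast_zero, sub_zero] at this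
      have hx2 := abs_le.2 hx
      linarith
  rw [← h3]
  refine intervalIntegral.integral_mono_interval (by linarith) (by linarith) (by linarith) ?_
    (hg.g_cont.intervalIntegrable _ _)
  exact Eventually.of_forall fun x => (Z.g01 q x).1

lemma Good.f_int {Z : Setup} {n q : ℕ} (hg : Z.Good n q) (m : ℕ) : m * lq q ≤ ∫ x in (0:ℝ)..1, Z.fq q m x := by
  unfold fq
  have hc : ∀ i : ℕ, Continuous fun x => Z.gq q (x + ((m + i : ℕ) : ℝ) * Z.α) := fun i =>
    hg.g_cont.comp (continuous_id.add continuous_const)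
  rw [intervalIntegral.integral_finsetSum fun i _ => (hc i).intervalIntegrable _ _]
  have : ∀ i : ℕ, ∫ x in (0:ℝ)..1, Z.gq q (x + ((m + i : ℕ) : ℝ) * Z.α) = ∫ x in (0:ℝ)..1, Z.gq q x :=
    fun i => integral_shift (fun x => perb_periodic _ _ x) _
  simp only [this, Finset.sum_const, Finset.card_range, nsmul_eq_mul]
  have := hg.g_int
  push_cast
  have hm0 : (0:ℝ) ≤ m := Nat.cast_nonneg m
  nlinarith

lemma Good.lyap_le {Z : Setup} {n q : ℕ} (hg : Z.Good n q) (hX : Z.X n * Z.l n ≤ 1 / 2) :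
    lyap Z.α (Z.Aq n q) ≤ 1992 * Real.log 2 := by
  have hq := hg.q64
  have hqn : 64 ≤ q := by exact_mod_cast hq
  obtain ⟨m, hm1, hm2⟩ : ∃ m, 4 * m ≤ q ∧ q ≤ 8 * m := ⟨q / 4, by omega, by omega⟩
  have hm0 : 8 ≤ m := by omega
  have hm0' : (8:ℝ) ≤ m := by exact_mod_cast hm0
  have hm2' : (q:ℝ) ≤ 8 * m := by exact_mod_cast hm2
  have hl2 : 0 < Real.log 2 := Real.log_pos (by norm_num)
  have hu : uI Z.α (Z.Aq n q) (4 * m) ≤ (2 * Real.log (Z.cB n) + (2 + 4 * m + 2 * Z.X n) * Real.log 2)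
        + Real.log lam * (4 * m - 2 * m * (m * lq q)) := by
    have hfc : Continuous (Z.fq q m) := by
      unfold fq
      exact continuous_finsetSum _ fun i _ => hg.g_cont.comp (continuous_id.add continuous_const)
    have h1 : uI Z.α (Z.Aq n q) (4 * m) ≤ ∫ x in (0:ℝ)..1, ((2 * Real.log (Z.cB n) + (2 + 4 * m + 2 * Z.X n) * Real.log 2)
        + Real.log lam * (4 * m - 2 * m * Z.fq q m x)) := by
      refine intervalIntegral.integral_mono_on zero_le_one ((hg.Aq_coc.log_cont _).intervalIntegrable _ _) ?_
        fun x _ => hg.log_le hm1 x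
      exact Continuous.intervalIntegrable (by fun_prop) _ _
    refine h1.trans ?_
    rw [intervalIntegral.integral_add (by simp) (Continuous.intervalIntegrable (by fun_prop) _ _),
      intervalIntegral.integral_const_mul,
      intervalIntegral.integral_sub (by simp) (Continuous.intervalIntegrable (by fun_prop) _ _),
      intervalIntegral.integral_const_mul]
    simp only [intervalIntegral.integral_const, intervalIntegral.integral_const_mul, sub_zero, one_smul]
    have := hg.f_int m
    have h6 : 0 ≤ Real.log lam := Real.log_nonneg one_le_lam
    gcongr
  have hX1 : (1:ℝ) ≤ Z.X n := by exact_mod_cast Z.X_pos n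
  have hXm : (Z.X n : ℝ) ≤ m / 2 := by
    have h := hg.lo
    have hl := Z.hl0 n
    rw [div_le_iff₀ hl] at h
    have h8 : 1 ≤ m * Z.l n := by nlinarith
    by_contra hc
    push Not at hc
    nlinarith
  have hcB : Real.log (Z.cB n) ≤ Real.log 2 + 20 * Z.X n * Real.log 2 := by
    unfold cB
    rw [Real.log_mul (by norm_num) (by positivity), Real.log_pow]
    have : Real.log 27 ≤ 5 * Real.log 2 := by
      have h : Real.log 27 ≤ Real.log (2 ^ 5) := Real.log_le_log (by norm_num) (by norm_num)
      rwa [Real.log_pow] at h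
    push_cast
    nlinarith
  have hml : 1 / 64 ≤ m * lq q := by
    unfold lq
    rw [mul_one_div, div_le_div_iff₀ (by norm_num) (by positivity)]
    linarith
  refine (hg.Aq_coc.lyap_le (α := Z.α) (n := 4 * m) (by omega)).trans ?_
  push_cast
  rw [div_le_iff₀ (by positivity)]
  refine hu.trans ?_
  rw [log_lam]
  have k1 : 2 * (m:ℝ) * (1 / 64) ≤ 2 * m * (m * lq q) := by gcongr
  have k2 : 2 * (Real.log 2 + 20 * Z.X n * Real.log 2) + (2 + 4 * m + 2 * Z.X n) * Real.log 2
      + 2000 * Real.log 2 * (4 * m - 2 * m * (1 / 64)) ≤ 1992 * Real.log 2 * (4 * m) := by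
    have : (2 * (1 + 20 * Z.X n) + (2 + 4 * m + 2 * Z.X n)
      + 2000 * (4 * m - 2 * m * (1 / 64)) : ℝ) ≤ 1992 * (4 * m) := by nlinarith
    nlinarith
  have k3 := mul_le_mul_of_nonneg_left k1 (by positivity : 0 ≤ 2000 * Real.log 2)
  linarith

lemma Good.sb {Z : Setup} {n q : ℕ} (hg : Z.Good n q) (y : ℝ) (i j : Fin 2) :
    SB (Z.σ + Z.θ) (1 / 2) (fun x => Z.Aq n q x i j - Z.D n x i j) y (Z.dmax * Z.u n) := by
  have hR : (0:ℝ) < 1 / 2 := by norm_num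
  have hσ : 1 ≤ Z.σ + Z.θ := by have := Z.hσ; have := Z.hθ; linarith
  have hd := Z.dmax_ge
  have hq := hg.q64
  have h0 : SB Z.σ (Z.R0 / lq q) (Z.χq q) y 2 := perb_sb Z.hR0 hg.lq_pos hg.lq_small Z.hχ0 Z.hχs y
  have h1 : SB Z.σ (128 * Z.Rn (n + 1)) (Z.χq q) y 2 := by
    refine h0.monoR (div_pos Z.hR0 hg.lq_pos) ?_
    have hh := hg.hi
    have hl := Z.hl0 (n + 1)
    have e1 : Z.R0 / lq q = Z.R0 * (8 * q) := by unfold lq; field_simp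
    have e2 : 128 * Z.Rn (n + 1) = Z.R0 * (16 * (8 / Z.l (n + 1))) := by unfold Rn; field_simp; ring
    rw [e1, e2]
    refine mul_le_mul_of_nonneg_left ?_ Z.hR0.le
    linarith
  have h2 := (Z.conv128 (n + 1) h1).const_mul hR (Z.eps n)
  have hE : SB (Z.σ + Z.θ) (1 / 2) (fun x => (Z.D n x * E21) i j) y Z.dmax := by
    have hj : j = 0 ∨ j = 1 := by fin_cases j <;> simp
    rcases hj with rfl | rfl
    · exact (Z.D_sb n y i 1).of_eq fun x => by simp [E21, Matrix.mul_apply, Fin.sum_univ_two]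
    · have := (SB.const (σ := Z.σ + Z.θ) hR 0 y).mono (M' := Z.dmax) (by simp; linarith)
      exact this.of_eq fun x => by simp [E21, Matrix.mul_apply, Fin.sum_univ_two]
  have h3 := hE.mul hσ hR h2
  refine (h3.of_eq fun x => ?_).mono ?_
  · unfold Aq
    rw [Matrix.mul_add, Matrix.mul_one, Matrix.mul_smul]
    simp only [Matrix.add_apply, Matrix.smul_apply, smul_eq_mul]; ring
  · refine mul_le_mul_of_nonneg_left ?_ (by linarith)
    have he : 0 < Z.eps n := by unfold eps; positivity
    rw [abs_of_pos he]
    calc Z.eps n * (Real.exp (Z.X (n + 1) / 32) * 2) ≤ Z.eps n * ((6 / 5) ^ Z.X n * 2) := by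
          gcongr; exact Z.exp_X n
      _ = 2 ^ (Z.P + 1) * (3 / 5) ^ Z.X n := by
          have : (3 / 5 : ℝ) ^ Z.X n = (6 / 5) ^ Z.X n / 2 ^ Z.X n := by
            rw [← div_pow]; norm_num
          unfold eps; rw [this]; ring
      _ ≤ 2 ^ (Z.P + 2) * (3 / 4) ^ n := by
          gcongr ?_ * ?_
          · exact pow_le_pow_right₀ (by norm_num) (by omega)
          · calc (3 / 5 : ℝ) ^ Z.X n ≤ (3 / 4) ^ Z.X n := by gcongr; norm_num
              _ ≤ _ := pow_le_pow_of_le_one (by norm_num) (by norm_num) (Z.X_ge n)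
      _ = Z.u n := rfl

end Setup

/-! ### Conclusion from a set-up -/

namespace Setup
variable (Z : Setup)

lemma l_decay (n : ℕ) : Z.l n * n < 8 := by
  have h : Z.l n * 2 ^ n ≤ 1 / 8 := by
    induction n with
    | zero => simpa using Z.hl1 0
    | succ n ih =>
      have h1 := Z.hl2 n
      have h2 : (0:ℝ) < 2 ^ n := by positivity
      rw [pow_succ]; nlinarith
  have h3 : (n:ℝ) < 2 ^ n := by exact_mod_cast Nat.lt_two_pow_self (n := n)
  have := Z.hl0 n
  nlinarith

lemma exists_good (hα : Irrational Z.α) (j : ℕ) : ∃ n q : ℕ, j ≤ n ∧ Z.Good n q := by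
  classical
  obtain ⟨m, hm⟩ := exists_nat_ge (8 / Z.l j)
  set q := cfq Z.α (m + 1) with hq
  have hmq : 8 / Z.l j ≤ (q:ℝ) := by
    have h1 := cfq_ge Z.α hα (m + 1)
    have h2 : ((m + 1 : ℕ) : ℝ) ≤ q := by exact_mod_cast h1
    push_cast at h2; linarith
  have hle : ∀ n : ℕ, 8 / Z.l n ≤ (q:ℝ) → n ≤ q := by
    intro n hn
    have h0 := Z.hl0 n
    have h1 := Z.l_decay n
    have h2 : (n:ℝ) < 8 / Z.l n := by rw [lt_div_iff₀ h0]; linarith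
    have : (n:ℝ) ≤ q := by linarith
    exact_mod_cast this
  set n := Nat.findGreatest (fun n => 8 / Z.l n ≤ (q:ℝ)) q with hn
  refine ⟨n, q, Nat.le_findGreatest (hle j hmq) hmq, ?_, ?_, ?_⟩
  · exact Nat.findGreatest_spec (P := fun n => 8 / Z.l n ≤ (q:ℝ)) (hle j hmq) hmq
  · by_contra hc
    push Not at hc
    have := Nat.le_findGreatest (P := fun n => 8 / Z.l n ≤ (q:ℝ)) (hle _ hc) hc
    omega
  · intro k hk hk2
    exact arith2 Z.α hα m k hk hk2

theorem main (hα : Irrational Z.α) :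
    ∃ D : ℝ → Matrix (Fin 2) (Fin 2) ℝ, ∃ K : ℝ, 0 < K ∧
      ∃ A : ℕ → ℝ → Matrix (Fin 2) (Fin 2) ℝ,
        Function.Periodic D 1 ∧ (∀ x, (D x).det = 1) ∧ MemGevrey (Z.σ + Z.θ) K D ∧
        (∀ j, Function.Periodic (A j) 1 ∧ (∀ x, ((A j) x).det = 1) ∧ MemGevrey (Z.σ + Z.θ) K (A j)) ∧
        0 < lyap Z.α D ∧
        Tendsto (fun j : ℕ => gevreyNorm (Z.σ + Z.θ) K (fun x => A j x - D x)) atTop (nhds 0) ∧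
        limsup (fun j : ℕ => lyap Z.α (A j)) atTop < lyap Z.α D := by
  have hR : (0:ℝ) < 1 / 2 := by norm_num
  choose n q hnj hg using Z.exists_good hα
  have hnt : Tendsto n atTop atTop := tendsto_atTop_mono hnj tendsto_id
  have hl2 : 0 < Real.log 2 := Real.log_pos (by norm_num)
  have hD := Z.lyap_Dinf_ge
  rw [log_lam] at hD
  refine ⟨Z.Dinf, 1, one_pos, fun j => Z.Aq (n j) (q j), Z.periodic_Dinf, Z.Dinf_det,
    (gevrey_of_sb fun i j y => Z.Dinf_sb y i j).1, fun j => ⟨(hg j).Aq_coc.per, (hg j).Aq_coc.det, ?_⟩,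
    by linarith, ?_, ?_⟩
  · refine (gevrey_of_sb (M := Z.dmax * Z.u (n j) + Z.dmax) fun i k y => ?_).1
    exact (((hg j).sb y i k).add hR (Z.D_sb (n j) y i k)).of_eq fun x => by ring
  · have key : ∀ j, 0 ≤ gevreyNorm (Z.σ + Z.θ) 1 (fun x => Z.Aq (n j) (q j) x - Z.Dinf x) ∧
        gevreyNorm (Z.σ + Z.θ) 1 (fun x => Z.Aq (n j) (q j) x - Z.Dinf x) ≤
          (4 * Real.pi ^ 2 / 3) * (2 * (Z.dmax * Z.u (n j) + Z.tail (n j))) := by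
      intro j
      refine (gevrey_of_sb fun i k y => ?_).2
      exact (((hg j).sb y i k).sub hR (Z.Dinf_sub_sb (n j) y i k)).of_eq fun x => by
        simp only [Matrix.sub_apply]; ring
    refine squeeze_zero (fun j => (key j).1) (fun j => (key j).2) ?_
    have hu := Z.u_summable.tendsto_atTop_zero
    have h := ((((hu.const_mul Z.dmax).add Z.tail_tendsto).const_mul 2).const_mul
      (4 * Real.pi ^ 2 / 3)).comp hnt
    simpa [Function.comp_def] using h
  · have hev : ∀ᶠ j in atTop, lyap Z.α (Z.Aq (n j) (q j)) ≤ 1992 * Real.log 2 := by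
      have h1 := (Z.hXl.comp hnt).eventually (gt_mem_nhds (show (0:ℝ) < 1 / 2 by norm_num))
      filter_upwards [h1] with j hj
      exact (hg j).lyap_le (le_of_lt hj)
    have : limsup (fun j : ℕ => lyap Z.α (Z.Aq (n j) (q j))) atTop ≤ 1992 * Real.log 2 := by
      refine limsup_le_of_le ?_ hev
      exact (isBoundedUnder_of ⟨-Real.log 2, fun j => (hg j).Aq_coc.lyap_ge⟩ :
        IsBoundedUnder (· ≥ ·) atTop _).isCoboundedUnder_le
    linarith

end Setup

/-! ### Existence of a set-up -/

lemma scale_choice {c κ C η A B : ℝ} (hc : 0 < c) (hκ : 1 < κ) (hη : η < 1) (hB : 0 < B) :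
    ∃ P : ℕ, 8 ≤ P ∧ A * (P:ℝ) ^ (1 - κ) ≤ B ∧
      ∀ x : ℝ, (P:ℝ) ≤ x → 2 * x + 2 ≤ c * x ^ κ ∧ C * x ^ η ≤ x := by
  have t1 := tendsto_rpow_atTop (show 0 < κ - 1 by linarith)
  have t2 := tendsto_rpow_atTop (show 0 < 1 - η by linarith)
  obtain ⟨x0, h0⟩ := eventually_atTop.1 ((t1.eventually_ge_atTop (4 / c)).and
    ((t1.eventually_ge_atTop (A / B)).and ((t2.eventually_ge_atTop C).and (eventually_ge_atTop (1:ℝ)))))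
  obtain ⟨P0, hP0⟩ := exists_nat_ge x0
  have hP : x0 ≤ ((P0 + 8 : ℕ) : ℝ) := by push_cast; linarith
  refine ⟨P0 + 8, by omega, ?_, fun x hx => ?_⟩
  · obtain ⟨-, h2, -, h4⟩ := h0 _ hP
    have hpos : 0 < ((P0 + 8 : ℕ) : ℝ) := by linarith
    have e : ((P0 + 8 : ℕ) : ℝ) ^ (1 - κ) = (((P0 + 8 : ℕ) : ℝ) ^ (κ - 1))⁻¹ := by
      rw [← Real.rpow_neg hpos.le]; congr 1; ring
    rw [e, ← div_eq_mul_inv, div_le_iff₀ (Real.rpow_pos_of_pos hpos _)]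
    rw [div_le_iff₀ hB] at h2; linarith
  · obtain ⟨h1, -, h3, h4⟩ := h0 x (hP.trans hx)
    have hpos : 0 < x := by linarith
    have e1 : x ^ κ = x ^ (κ - 1) * x := by
      nth_rewrite 3 [← Real.rpow_one x]
      rw [← Real.rpow_add hpos]; congr 1; ring
    have e2 : x = x ^ (1 - η) * x ^ η := by
      rw [← Real.rpow_add hpos]
      nth_rewrite 1 [← Real.rpow_one x]
      congr 1; ring
    constructor
    · rw [div_le_iff₀ hc] at h1
      rw [e1]
      nlinarith
    · have := Real.rpow_pos_of_pos hpos η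
      nth_rewrite 2 [e2]
      exact mul_le_mul_of_nonneg_right h3 this.le

lemma exists_setup (α : ℝ) (hα : Irrational α) (τ : ℝ) (hτ : 1 < τ)
    (hDC : ∃ γ : ℝ, 0 < γ ∧ ∀ n : ℕ,
      (cfq α (n + 1) : ℝ) ≤ γ⁻¹ * (cfq α n : ℝ) ^ τ)
    (s : ℝ) (hs : τ + 1 < s) : ∃ Z : Setup, Z.α = α ∧ Z.σ + Z.θ = s := by
  obtain ⟨g, hg, hgk⟩ := arith1 α hα τ hτ hDC
  obtain ⟨m, hm⟩ := exists_nat_one_div_lt (show 0 < s - 1 - τ by linarith)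
  have hNo : Odd (2 * m + 1) := ⟨m, rfl⟩
  obtain ⟨χ, R, hR, hχ01, hχ1, hχ0, hχs, hψs, hφs⟩ := exists_bump hNo
  set σ : ℝ := 1 + 1 / ((2 * m + 1 : ℕ) : ℝ) with hσ
  have hN : (1:ℝ) / ((2 * m + 1 : ℕ) : ℝ) ≤ 1 / ((m:ℝ) + 1) := by
    apply one_div_le_one_div_of_le (by positivity)
    push_cast
    have : (0:ℝ) ≤ m := Nat.cast_nonneg m
    linarith
  have hN0 : (0:ℝ) < 1 / ((2 * m + 1 : ℕ) : ℝ) := by positivity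
  set θ : ℝ := s - σ with hθ
  have hθτ : τ < θ := by linarith
  obtain ⟨β, hβ1, hβ2⟩ := exists_between hθτ
  have hτ0 : 0 < τ := by linarith
  have hθ0 : 0 < θ := by linarith
  set κ := β / τ with hκ
  have hκ1 : 1 < κ := (one_lt_div hτ0).2 hβ1
  have hη : β / θ < 1 := (div_lt_one hθ0).2 hβ2
  set c := (g / 2) ^ (1 / τ) with hc
  have hc0 : 0 < c := Real.rpow_pos_of_pos (by positivity) _
  have hρ : (2:ℝ) ^ (1 - κ) < 1 := Real.rpow_lt_one_of_one_lt_of_neg (by norm_num) (by linarith)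
  have hρ0 : (0:ℝ) < (2:ℝ) ^ (1 - κ) := Real.rpow_pos_of_pos (by norm_num) _
  obtain ⟨P, hP8, hPA, hPx⟩ := scale_choice (C := 32 * (θ * (256 * R) ^ (1 / θ))) (A := 2 / c) hc0 hκ1 hη
    (show 0 < 1 - (2:ℝ) ^ (1 - κ) by linarith)
  have hX1 : ∀ n : ℕ, (P:ℝ) ≤ ((P * 2 ^ n : ℕ) : ℝ) := fun n => by
    exact_mod_cast Nat.le_mul_of_pos_right P (by positivity)
  have hP8' : (8:ℝ) ≤ P := by exact_mod_cast hP8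
  have hX0 : ∀ n : ℕ, (0:ℝ) < ((P * 2 ^ n : ℕ) : ℝ) := fun n => by have := hX1 n; linarith
  have hrgt : ∀ n : ℕ, c * ((P * 2 ^ n : ℕ) : ℝ) ^ κ - 1 < (⌊c * ((P * 2 ^ n : ℕ) : ℝ) ^ κ⌋₊ : ℝ) :=
    fun n => Nat.sub_one_lt_floor _
  have hZ : ∃ Z : Setup, Z.α = α ∧ Z.σ = σ ∧ Z.θ = θ := by
    refine ⟨{ α := α, σ := σ, θ := θ, R0 := R, χ := χ, P := P
              l := fun n => ((P * 2 ^ n : ℕ) : ℝ) ^ (-β)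
              r := fun n => ⌊c * ((P * 2 ^ n : ℕ) : ℝ) ^ κ⌋₊
              hσ := by linarith
              hθ := hθ0, hR0 := hR, hχ01 := hχ01, hχ1 := hχ1, hχ0 := hχ0
              hχs := hχs, hψs := hψs, hφs := hφs
              hl0 := fun n => Real.rpow_pos_of_pos (hX0 n) _
              hl1 := ?_, hl2 := ?_, hP := by omega, hr := ?_, hret := ?_, hsum := ?_, hconv := ?_
              hXl := ?_ }, rfl, rfl, rfl⟩
    · intro n
      have h1 := hX1 n
      calc ((P * 2 ^ n : ℕ) : ℝ) ^ (-β) ≤ ((P * 2 ^ n : ℕ) : ℝ) ^ (-1:ℝ) :=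
            Real.rpow_le_rpow_of_exponent_le (by linarith) (by linarith)
        _ = 1 / ((P * 2 ^ n : ℕ) : ℝ) := by rw [Real.rpow_neg_one, one_div]
        _ ≤ 1 / 8 := one_div_le_one_div_of_le (by norm_num) (by linarith)
    · intro n
      have e : ((P * 2 ^ (n + 1) : ℕ) : ℝ) = 2 * ((P * 2 ^ n : ℕ) : ℝ) := by push_cast; ring
      beta_reduce
      rw [e, Real.mul_rpow (by norm_num) (hX0 n).le]
      have h1 : (2:ℝ) ^ (-β) ≤ 2 ^ (-1:ℝ) :=
        Real.rpow_le_rpow_of_exponent_le (by norm_num) (by linarith)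
      rw [Real.rpow_neg_one] at h1
      have := Real.rpow_pos_of_pos (hX0 n) (-β)
      nlinarith
    · intro n
      have h1 := (hPx _ (hX1 n)).1
      have h2 := hrgt n
      have : ((2 * (P * 2 ^ n) : ℕ) : ℝ) < (⌊c * ((P * 2 ^ n : ℕ) : ℝ) ^ κ⌋₊ : ℝ) := by
        rw [Nat.cast_mul 2]; push_cast at h1 h2 ⊢; linarith
      exact_mod_cast this
    · intro n d hd1 hd2
      have hd0 : (0:ℝ) < d := by exact_mod_cast hd1
      have hd3 : (d:ℝ) < c * ((P * 2 ^ n : ℕ) : ℝ) ^ κ := Nat.lt_of_lt_floor hd2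
      refine lt_of_lt_of_le ?_ (hgk d hd1)
      have h1 : (d:ℝ) ^ τ < (c * ((P * 2 ^ n : ℕ) : ℝ) ^ κ) ^ τ := Real.rpow_lt_rpow hd0.le hd3 hτ0
      have hXk := Real.rpow_pos_of_pos (hX0 n) κ
      rw [Real.mul_rpow hc0.le hXk.le, ← Real.rpow_mul (hX0 n).le, hc,
        ← Real.rpow_mul (by positivity), one_div_mul_cancel hτ0.ne', Real.rpow_one,
        hκ, div_mul_cancel₀ _ hτ0.ne'] at h1
      rw [lt_div_iff₀ (Real.rpow_pos_of_pos hd0 _), Real.rpow_neg (hX0 n).le]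
      have hXb := Real.rpow_pos_of_pos (hX0 n) β
      calc 2 * (((P * 2 ^ n : ℕ) : ℝ) ^ β)⁻¹ * (d:ℝ) ^ τ
          < 2 * (((P * 2 ^ n : ℕ) : ℝ) ^ β)⁻¹ * (g / 2 * ((P * 2 ^ n : ℕ) : ℝ) ^ β) := by
            exact mul_lt_mul_of_pos_left h1 (by positivity)
        _ = g := by field_simp
    · intro n
      have hterm : ∀ j : ℕ, ((P * 2 ^ j : ℕ) : ℝ) / (⌊c * ((P * 2 ^ (j + 1) : ℕ) : ℝ) ^ κ⌋₊ : ℝ)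
          ≤ (2 / c) * (P:ℝ) ^ (1 - κ) * ((2:ℝ) ^ (1 - κ)) ^ j := by
        intro j
        have h1 := (hPx _ (hX1 (j + 1))).1
        have h2 := hrgt (j + 1)
        have hXk := Real.rpow_pos_of_pos (hX0 j) κ
        have h3 : ((P * 2 ^ j : ℕ) : ℝ) ^ κ ≤ ((P * 2 ^ (j + 1) : ℕ) : ℝ) ^ κ := by
          refine Real.rpow_le_rpow (hX0 j).le ?_ (by linarith)
          have e : ((P * 2 ^ (j + 1) : ℕ) : ℝ) = 2 * ((P * 2 ^ j : ℕ) : ℝ) := by push_cast; ring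
          have := hX0 j
          rw [e]; linarith
        have h5 := hX0 (j + 1)
        have h4 : c / 2 * ((P * 2 ^ j : ℕ) : ℝ) ^ κ ≤ (⌊c * ((P * 2 ^ (j + 1) : ℕ) : ℝ) ^ κ⌋₊ : ℝ) := by
          nlinarith
        have e1 : (P:ℝ) ^ (1 - κ) * ((2:ℝ) ^ (1 - κ)) ^ j = ((P * 2 ^ j : ℕ) : ℝ) / ((P * 2 ^ j : ℕ) : ℝ) ^ κ := by
          rw [← Real.rpow_natCast, ← Real.rpow_mul (by norm_num), mul_comm (1 - κ), Real.rpow_mul (by norm_num),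
            Real.rpow_natCast, ← Real.mul_rpow (by linarith) (by positivity)]
          push_cast
          rw [Real.rpow_sub (by have := hX0 j; push_cast at this; exact this), Real.rpow_one]
        rw [mul_assoc, e1]
        calc _ ≤ ((P * 2 ^ j : ℕ) : ℝ) / (c / 2 * ((P * 2 ^ j : ℕ) : ℝ) ^ κ) :=
              div_le_div_of_nonneg_left (hX0 j).le (by positivity) h4
          _ = _ := by field_simp
      calc _ ≤ ∑ j ∈ Finset.range n, (2 / c) * (P:ℝ) ^ (1 - κ) * ((2:ℝ) ^ (1 - κ)) ^ j :=
            Finset.sum_le_sum fun j _ => hterm j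
        _ = (2 / c) * (P:ℝ) ^ (1 - κ) * ∑ j ∈ Finset.range n, ((2:ℝ) ^ (1 - κ)) ^ j := by
            rw [Finset.mul_sum]
        _ ≤ (1 - (2:ℝ) ^ (1 - κ)) * (1 - (2:ℝ) ^ (1 - κ))⁻¹ := by
            refine mul_le_mul hPA ?_ (Finset.sum_nonneg fun j _ => by positivity) (by linarith)
            rw [← tsum_geometric_of_lt_one hρ0.le hρ]
            exact (summable_geometric_of_lt_one hρ0.le hρ).sum_le_tsum _ fun j _ => by positivity
        _ = 1 := mul_inv_cancel₀ (by linarith)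
    · intro n
      refine Real.exp_le_exp.2 ?_
      have h1 := (hPx _ (hX1 n)).2
      have e : 2 * (128 * (R / ((P * 2 ^ n : ℕ) : ℝ) ^ (-β))) = (256 * R) * ((P * 2 ^ n : ℕ) : ℝ) ^ β := by
        rw [Real.rpow_neg (hX0 n).le, div_inv_eq_mul]; ring
      rw [e, Real.mul_rpow (by positivity) (Real.rpow_pos_of_pos (hX0 n) _).le,
        ← Real.rpow_mul (hX0 n).le, mul_one_div]
      linarith
    · have h1 : Tendsto (fun n : ℕ => ((P * 2 ^ n : ℕ) : ℝ)) atTop atTop := by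
        refine tendsto_natCast_atTop_atTop.comp ?_
        refine tendsto_atTop_mono (fun n => ?_) tendsto_id
        have h2 := Nat.lt_two_pow_self (n := n)
        have h3 := Nat.le_mul_of_pos_left (2 ^ n) (show 0 < P by omega)
        simp only [id]; omega
      have h2 := (tendsto_rpow_neg_atTop (show 0 < β - 1 by linarith)).comp h1
      refine h2.congr fun n => ?_
      simp only [Function.comp]
      have : -(β - 1) = 1 + -β := by ring
      rw [this, Real.rpow_add (hX0 n), Real.rpow_one]
  obtain ⟨Z, h1, h2, h3⟩ := hZ
  exact ⟨Z, h1, by rw [h2, h3]; ring⟩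

/-- Discontinuity of the Lyapunov exponent in the Gevrey class `G^s(S¹, SL(2,ℝ))`, `s > τ+1`,
for any fixed Diophantine frequency `α ∈ DC(τ)` (i.e. `q_{n+1} ≤ γ⁻¹ q_n^τ`): there are
`D ∈ G^s` with `L(α,D) > 0`, `K > 0`, and `A_j → D` in `‖·‖_{s,K}` with
`limsup_j L(α,A_j) < L(α,D)`. -/
theorem statement2 (α : ℝ) (hα : Irrational α) (τ : ℝ) (hτ : 1 < τ)
    (hDC : ∃ γ : ℝ, 0 < γ ∧ ∀ n : ℕ,
      (cfq α (n + 1) : ℝ) ≤ γ⁻¹ * (cfq α n : ℝ) ^ τ)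
    (s : ℝ) (hs : τ + 1 < s) :
    ∃ D : ℝ → Matrix (Fin 2) (Fin 2) ℝ, ∃ K : ℝ, 0 < K ∧
      ∃ A : ℕ → ℝ → Matrix (Fin 2) (Fin 2) ℝ,
        Function.Periodic D 1 ∧ (∀ x, (D x).det = 1) ∧ MemGevrey s K D ∧
        (∀ j, Function.Periodic (A j) 1 ∧ (∀ x, ((A j) x).det = 1) ∧ MemGevrey s K (A j)) ∧
        0 < lyap α D ∧
        Tendsto (fun j : ℕ => gevreyNorm s K (fun x => A j x - D x)) atTop (nhds 0) ∧
        limsup (fun j : ℕ => lyap α (A j)) atTop < lyap α D := by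
  obtain ⟨Z, h1, h2⟩ := exists_setup α hα τ hτ hDC s hs
  have h := Z.main (by rw [h1]; exact hα)
  rw [h1, h2] at h
  exact h
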